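/- arXiv:1810.00676 — 2 statements merged into one kernel-verified Lean document; each statement's English description precedes it below -/
import Mathlib

section
/- For every ω > 0, the infimum d(ω) = inf{ S_ω(u,v) : (u,v) ∈ H¹×H¹ \ {(0,0)}, K_ω(u,v) = 0 } is strictly positive. Moreover there is a constant C > 0 such that every (u,v) ∈ H¹×H¹ \ {(0,0)} with K_ω(u,v) = 0 satisfies S_ω(u,v) ≥ (1/2)√(1/C) > 0. -/
open MeasureTheory Complex Filter
open scoped ENNReal NNReal

noncomputable section

abbrev E5 := EuclideanSpace ℝ (Fin 5)

/-- Membership in `H¹(ℝ⁵, ℂ)`: `u ∈ L²` with (weak) gradient in `L²`. -/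
def InH1 (u : E5 → ℂ) : Prop :=
  MemLp u 2 (volume : Measure E5) ∧ Differentiable ℝ u ∧
    MemLp (fun x => fderiv ℝ u x) 2 (volume : Measure E5)

/-- Squared `H¹` norm. -/
def H1normSq (u : E5 → ℂ) : ℝ :=
  (∫ x : E5, ‖u x‖ ^ 2) + ∫ x : E5, ‖fderiv ℝ u x‖ ^ 2

/-- The kinetic functional `K(u,v) = ‖∇u‖² + (1/2)‖∇v‖²`. -/
def Kin (u v : E5 → ℂ) : ℝ :=
  (∫ x : E5, ‖fderiv ℝ u x‖ ^ 2) + (1 / 2) * ∫ x : E5, ‖fderiv ℝ v x‖ ^ 2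

/-- The mass functional `M(u,v) = ‖u‖² + 2‖v‖²`. -/
def Mass (u v : E5 → ℂ) : ℝ :=
  (∫ x : E5, ‖u x‖ ^ 2) + 2 * ∫ x : E5, ‖v x‖ ^ 2

/-- The interaction functional `P(u,v) = Re ∫ conj v · u²`. -/
def Pot (u v : E5 → ℂ) : ℝ :=
  ∫ x : E5, ((starRingEnd ℂ) (v x) * (u x) ^ 2).re

/-- The action functional `S_ω`. -/
def Sfun (ω : ℝ) (u v : E5 → ℂ) : ℝ :=
  (1 / 2) * Kin u v + (ω / 2) * Mass u v - Pot u v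

/-- The Nehari functional `K_ω`. -/
def Nehari (ω : ℝ) (u v : E5 → ℂ) : ℝ :=
  Kin u v + ω * Mass u v - 3 * Pot u v

/-- The energy `E(u,v) = (1/2)K(u,v) − P(u,v)`. -/
def Efun (u v : E5 → ℂ) : ℝ := (1 / 2) * Kin u v - Pot u v

/-- The virial functional `Q(u,v) = K(u,v) − (5/2)P(u,v)`. -/
def Qfun (u v : E5 → ℂ) : ℝ := Kin u v - (5 / 2) * Pot u v

/-- Nontriviality of a pair. -/
def Nontriv2 (u v : E5 → ℂ) : Prop := ¬(u = 0 ∧ v = 0)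

/-- The infimum `d(ω)` of `S_ω` on the Nehari manifold. -/
def dmin (ω : ℝ) : ℝ :=
  sInf {s : ℝ | ∃ u v : E5 → ℂ, InH1 u ∧ InH1 v ∧ Nontriv2 u v ∧
    Nehari ω u v = 0 ∧ s = Sfun ω u v}

/-- Laplacian of a complex-valued function on `ℝ⁵`. -/
def lap (u : E5 → ℂ) (x : E5) : ℂ :=
  ∑ i : Fin 5,
    fderiv ℝ (fun y => fderiv ℝ u y (EuclideanSpace.single i (1 : ℝ))) x
      (EuclideanSpace.single i (1 : ℝ))

/-- `(φ,ψ)` is an `H¹` solution of the elliptic system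
`−Δφ + ωφ = 2ψ conj φ`, `−(1/2)Δψ + 2ωψ = φ²`. -/
def IsEllSol (ω : ℝ) (φ ψ : E5 → ℂ) : Prop :=
  InH1 φ ∧ InH1 ψ ∧
  (∀ x, -lap φ x + (ω : ℂ) * φ x = 2 * ψ x * (starRingEnd ℂ) (φ x)) ∧
  (∀ x, -(1 / 2 : ℂ) * lap ψ x + (2 * ω : ℂ) * ψ x = (φ x) ^ 2)

/-- A ground state: a nontrivial solution of the elliptic system minimizing
`S_ω` among all nontrivial solutions. -/
def IsGroundState (ω : ℝ) (φ ψ : E5 → ℂ) : Prop :=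
  IsEllSol ω φ ψ ∧ Nontriv2 φ ψ ∧
    ∀ u v : E5 → ℂ, IsEllSol ω u v → Nontriv2 u v → Sfun ω φ ψ ≤ Sfun ω u v

/-- The `L²`-invariant scaling `u^γ(x) = γ^{5/2} u(γ x)`. -/
def scaleFn (γ : ℝ) (u : E5 → ℂ) : E5 → ℂ :=
  fun x => ((γ ^ ((5 : ℝ) / 2) : ℝ) : ℂ) * u (γ • x)

/-- Finite variance. -/
def FinVar (u : E5 → ℂ) : Prop :=
  Integrable (fun x : E5 => ‖x‖ ^ 2 * ‖u x‖ ^ 2) (volume : Measure E5)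

/-- `(u,v)` solves the evolution system `i∂_t u + Δu = −2v conj u`,
`i∂_t v + (1/2)Δv = −u²` on the time set `I`, staying in `H¹ × H¹`. -/
def IsEvolSol (u v : ℝ → E5 → ℂ) (I : Set ℝ) : Prop :=
  (∀ t ∈ I, InH1 (u t) ∧ InH1 (v t)) ∧
  (∀ t ∈ I, ∀ x : E5,
    Complex.I * deriv (fun s => u s x) t + lap (u t) x
      = -2 * v t x * (starRingEnd ℂ) (u t x)) ∧
  (∀ t ∈ I, ∀ x : E5,
    Complex.I * deriv (fun s => v s x) t + (1 / 2 : ℂ) * lap (v t) x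
      = -(u t x) ^ 2)

/-- The time set `[0, T)` for `T : ℝ≥0∞`. -/
def timeSet (T : ℝ≥0∞) : Set ℝ := {t : ℝ | 0 ≤ t ∧ ENNReal.ofReal t < T}

/-- Conservation of mass and energy on a time set. -/
def Conserves (u v : ℝ → E5 → ℂ) (I : Set ℝ) : Prop :=
  (∀ t ∈ I, Mass (u t) (v t) = Mass (u 0) (v 0)) ∧
  (∀ t ∈ I, Efun (u t) (v t) = Efun (u 0) (v 0))

/-- Membership in the blow-up set `ℬ_ω` associated with a ground state `(φ,ψ)`. -/
def InBset (ω : ℝ) (φ ψ u v : E5 → ℂ) : Prop :=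
  InH1 u ∧ InH1 v ∧ Nontriv2 u v ∧ Sfun ω u v < Sfun ω φ ψ ∧ Qfun u v < 0

/-- A maximal solution of the evolution system on `[0,T)` with given data,
conserving mass and energy. -/
def IsMaximalSol (u v : ℝ → E5 → ℂ) (T : ℝ≥0∞) (u₀ v₀ : E5 → ℂ) : Prop :=
  0 < T ∧ u 0 = u₀ ∧ v 0 = v₀ ∧ IsEvolSol u v (timeSet T) ∧
    Conserves u v (timeSet T) ∧
    ∀ (u' v' : ℝ → E5 → ℂ) (T' : ℝ≥0∞),
      IsEvolSol u' v' (timeSet T') → Conserves u' v' (timeSet T') →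
      (∀ t ∈ timeSet T, u' t = u t ∧ v' t = v t) → u' 0 = u₀ → v' 0 = v₀ →
        T' ≤ T

/-- Blow-up in finite time: the maximal time is finite and the `H¹ × H¹` norm
tends to infinity as `t` approaches it from below. -/
def BlowsUp (u v : ℝ → E5 → ℂ) (T : ℝ≥0∞) : Prop :=
  T ≠ ⊤ ∧ Tendsto (fun t : ℝ => Real.sqrt (H1normSq (u t) + H1normSq (v t)))
    (nhdsWithin T.toReal (Set.Iio T.toReal)) atTop

end

open MeasureTheory Complex Filter
open scoped ENNReal

/-- A differentiable function on the line is bounded by its `W^{1,1}` norm. -/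
theorem enorm_le_lintegral_add_deriv {F : Type*} [NormedAddCommGroup F] [NormedSpace ℝ F]
    [CompleteSpace F] {f f' : ℝ → F} (hf : ∀ t, HasDerivAt f (f' t) t) (a : ℝ) :
    ‖f a‖ₑ ≤ ∫⁻ t, (‖f t‖ₑ + ‖f' t‖ₑ) := by
  have hcont : Continuous f := continuous_iff_continuousAt.2 fun t => (hf t).continuousAt
  have hf'_eq : f' = deriv f := funext fun t => (hf t).deriv.symm
  have hf'_meas : StronglyMeasurable f' := by
    rw [hf'_eq]; exact stronglyMeasurable_deriv f
  by_cases htop : ∫⁻ t, (‖f t‖ₑ + ‖f' t‖ₑ) = ⊤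
  · simp [htop]
  have hint : Integrable f :=
    ⟨hcont.aestronglyMeasurable, (lintegral_mono fun t => le_self_add).trans_lt
      (lt_top_iff_ne_top.2 htop)⟩
  have hint' : Integrable f' :=
    ⟨hf'_meas.aestronglyMeasurable, (lintegral_mono fun t => le_add_self).trans_lt
      (lt_top_iff_ne_top.2 htop)⟩
  have hlim := tendsto_zero_of_hasDerivAt_of_integrableOn_Iic (a := a) (fun t _ => hf t)
    hint'.integrableOn hint.integrableOn
  have hftc := integral_Iic_of_hasDerivAt_of_tendsto' (a := a) (fun t _ => hf t)
    hint'.integrableOn hlim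
  rw [sub_zero] at hftc
  rw [← hftc]
  calc ‖∫ t in Set.Iic a, f' t‖ₑ ≤ ∫⁻ t in Set.Iic a, ‖f' t‖ₑ := enorm_integral_le_lintegral_enorm _
    _ ≤ ∫⁻ t, ‖f' t‖ₑ := setLIntegral_le_lintegral _ _
    _ ≤ _ := lintegral_mono fun t => le_add_self

/-- A function dominated at every point by the integrals of `W` along all coordinate lines
lies in `L^{n/(n-1)}`, with norm at most the integral of `W`. -/
theorem lintegral_rpow_le_of_le_lintegral_update {ι : Type*} [Fintype ι] [DecidableEq ι]
    {p : ℝ} (hp : Real.HolderConjugate (Fintype.card ι) p)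
    {f W : (ι → ℝ) → ℝ≥0∞} (hW : Measurable W)
    (h : ∀ x i, f x ≤ ∫⁻ t, W (Function.update x i t)) :
    ∫⁻ x, f x ^ p ≤ (∫⁻ x, W x) ^ p := by
  have hcard : (1 : ℝ) ≤ Fintype.card ι - 1 := by
    have : (2 : ℝ) ≤ Fintype.card ι := by exact_mod_cast hp.lt
    linarith
  calc ∫⁻ x, f x ^ p
      = ∫⁻ x, ∏ _i : ι, f x ^ ((1 : ℝ) / (Fintype.card ι - 1 : ℝ)) := by
        congr! 2 with x
        rw [Finset.prod_const, ← ENNReal.rpow_natCast, ← ENNReal.rpow_mul, hp.conjugate_eq,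
          Finset.card_univ]
        field_simp
    _ ≤ ∫⁻ x, ∏ i, (∫⁻ t, W (Function.update x i t)) ^
          ((1 : ℝ) / (Fintype.card ι - 1 : ℝ)) := by
        gcongr with x i
        exact h x i
    _ ≤ (∫⁻ x, W x) ^ p := lintegral_prod_lintegral_pow_le _ hp hW

/-- The embedding `W^{1,1}(ℝ⁵) ⊂ L^{5/4}(ℝ⁵)` for differentiable functions. -/
theorem lintegral_rpow_five_fourths_le {f : E5 → ℝ} (hf : Differentiable ℝ f) :
    ∫⁻ x, ‖f x‖ₑ ^ (5 / 4 : ℝ) ≤ (∫⁻ x, (‖f x‖ₑ + ‖fderiv ℝ f x‖ₑ)) ^ (5 / 4 : ℝ) := by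
  have hmp := PiLp.volume_preserving_toLp (Fin 5)
  have hmeas : Measurable fun x => ‖f x‖ₑ + ‖fderiv ℝ f x‖ₑ :=
    hf.continuous.measurable.enorm.add (measurable_fderiv ℝ f).enorm
  have hmeas' : Measurable fun x => ‖f x‖ₑ ^ (5 / 4 : ℝ) :=
    hf.continuous.measurable.enorm.pow_const _
  rw [← hmp.lintegral_comp hmeas, ← hmp.lintegral_comp hmeas']
  refine lintegral_rpow_le_of_le_lintegral_update (f := fun x => ‖f (WithLp.toLp 2 x)‖ₑ)
    (W := fun x => ‖f (WithLp.toLp 2 x)‖ₑ + ‖fderiv ℝ f (WithLp.toLp 2 x)‖ₑ)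
    ?_ (hmeas.comp hmp.measurable) ?_
  · rw [Real.holderConjugate_iff]; norm_num
  intro x i
  have hline (t : ℝ) : HasDerivAt (fun s => WithLp.toLp 2 (Function.update x i s))
      (EuclideanSpace.single i (1 : ℝ)) t :=
    ((PiLp.continuousLinearEquiv 2 ℝ fun _ : Fin 5 => ℝ).symm.toContinuousLinearMap.hasFDerivAt
      ).comp_hasDerivAt t (hasDerivAt_update x i t)
  have hderiv (t : ℝ) := (hf (WithLp.toLp 2 (Function.update x i t))).hasFDerivAt.comp_hasDerivAt t
    (hline t)
  have hbound := enorm_le_lintegral_add_deriv hderiv (x i)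
  simp only [Function.comp_apply, Function.update_eq_self] at hbound
  refine hbound.trans (lintegral_mono fun t => add_le_add_right ?_ _)
  calc _ ≤ ‖fderiv ℝ f (WithLp.toLp 2 (Function.update x i t))‖ₑ *
        ‖EuclideanSpace.single i (1 : ℝ)‖ₑ := ContinuousLinearMap.le_opENorm _ _
    _ = _ := by rw [← ofReal_norm (EuclideanSpace.single i (1 : ℝ))]; simp

/-- One step of the bootstrap: the embedding of `W^{1,1}` applied to a power of `‖u‖`. -/
theorem lintegral_rpow_le_bootstrap {u : E5 → ℂ} (hu : Differentiable ℝ u) {γ : ℝ≥0}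
    (hγ : 1 < γ) :
    ∫⁻ x, ‖u x‖ₑ ^ (γ * (5 / 4) : ℝ) ≤
      ((∫⁻ x, ‖u x‖ₑ ^ (γ : ℝ)) + γ * ((∫⁻ x, ‖u x‖ₑ ^ ((γ - 1) * 2 : ℝ)) +
        ∫⁻ x, ‖fderiv ℝ u x‖ₑ ^ (2 : ℝ))) ^ (5 / 4 : ℝ) := by
  have hum : Measurable fun x => ‖u x‖ₑ := hu.continuous.measurable.enorm
  have hpow (x : E5) : ‖‖u x‖ ^ (γ : ℝ)‖ₑ = ‖u x‖ₑ ^ (γ : ℝ) := by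
    rw [Real.enorm_rpow_of_nonneg (norm_nonneg _) γ.coe_nonneg, enorm_norm]
  have hsob := lintegral_rpow_five_fourths_le (hu.norm_rpow (p := γ) (by exact_mod_cast hγ))
  simp only [hpow, ← ENNReal.rpow_mul] at hsob
  refine hsob.trans (ENNReal.rpow_le_rpow ?_ (by norm_num))
  rw [← lintegral_add_left (hum.pow_const _), ← lintegral_const_mul,
    ← lintegral_add_left (hum.pow_const _)]
  · refine lintegral_mono fun x => add_le_add_right ((enorm_fderiv_norm_rpow_le hu hγ).trans ?_) _
    rw [mul_assoc, ENNReal.rpow_mul]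
    gcongr
    set a := ‖u x‖ₑ ^ ((γ : ℝ) - 1)
    set b := ‖fderiv ℝ u x‖ₑ
    norm_cast
    rcases le_total a b with h | h
    · calc a * b ≤ b * b := by gcongr
        _ = b ^ 2 := (sq b).symm
        _ ≤ _ := le_add_self
    · calc a * b ≤ a * a := by gcongr
        _ = a ^ 2 := (sq a).symm
        _ ≤ _ := le_self_add
  · exact (hum.pow_const _).add ((measurable_fderiv ℝ u).enorm.pow_const _)

/-- Intermediate powers are integrable. -/
theorem lintegral_rpow_le_add {α : Type*} [MeasurableSpace α] {μ : Measure α} {f : α → ℝ≥0∞}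
    (hf : Measurable f) {p q r : ℝ} (hpq : p ≤ q) (hqr : q ≤ r) :
    ∫⁻ x, f x ^ q ∂μ ≤ (∫⁻ x, f x ^ p ∂μ) + ∫⁻ x, f x ^ r ∂μ := by
  rw [← lintegral_add_left (hf.pow_const _)]
  refine lintegral_mono fun x => ?_
  rcases le_total (f x) 1 with h | h
  · exact (ENNReal.rpow_le_rpow_of_exponent_ge h hpq).trans le_self_add
  · exact (ENNReal.rpow_le_rpow_of_exponent_le h hqr).trans le_add_self

/-- The embedding `H¹(ℝ⁵) ⊂ L³(ℝ⁵)` on the unit ball. -/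
theorem exists_lintegral_cube_le :
    ∃ C : ℝ≥0, ∀ u : E5 → ℂ, Differentiable ℝ u → ∫⁻ x, ‖u x‖ₑ ^ (2 : ℝ) ≤ 1 →
      ∫⁻ x, ‖fderiv ℝ u x‖ₑ ^ (2 : ℝ) ≤ 1 → ∫⁻ x, ‖u x‖ₑ ^ (3 : ℝ) ≤ C := by
  have step {γ q : ℝ≥0} (hγ : 2 ≤ γ) (hq : (γ - 1) * 2 ≤ (q : ℝ)) (A : ℝ≥0) :
      ∃ B : ℝ≥0, ∀ u : E5 → ℂ, Differentiable ℝ u → ∫⁻ x, ‖u x‖ₑ ^ (2 : ℝ) ≤ 1 →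
        ∫⁻ x, ‖fderiv ℝ u x‖ₑ ^ (2 : ℝ) ≤ 1 → ∫⁻ x, ‖u x‖ₑ ^ (q : ℝ) ≤ A →
        ∫⁻ x, ‖u x‖ₑ ^ (γ * (5 / 4) : ℝ) ≤ B := by
    refine ⟨((1 + A) + γ * ((1 + A) + 1)) ^ (5 / 4 : ℝ), fun u hu h2 hD hA => ?_⟩
    have hγ' : (2 : ℝ) ≤ γ := by exact_mod_cast hγ
    have hum : Measurable fun x => ‖u x‖ₑ := hu.continuous.measurable.enorm
    refine (lintegral_rpow_le_bootstrap hu (lt_of_lt_of_le one_lt_two hγ)).trans ?_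
    rw [ENNReal.coe_rpow_of_nonneg _ (by norm_num)]
    push_cast
    refine ENNReal.rpow_le_rpow ?_ (by norm_num)
    have h1 := (lintegral_rpow_le_add (μ := volume) hum hγ' (by linarith : (γ : ℝ) ≤ q)).trans
      (add_le_add h2 hA)
    have h3 := (lintegral_rpow_le_add (μ := volume) hum (by linarith : (2 : ℝ) ≤ (γ - 1) * 2)
      hq).trans (add_le_add h2 hA)
    gcongr
  obtain ⟨A, hA⟩ := step (γ := 2) (q := 2) le_rfl (by norm_num) 1
  obtain ⟨B, hB⟩ := step (γ := 9 / 4) (q := 5 / 2)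
    (by rw [← NNReal.coe_le_coe]; norm_num) (by norm_num) A
  obtain ⟨C, hC⟩ := step (γ := 12 / 5) (q := 45 / 16)
    (by rw [← NNReal.coe_le_coe]; norm_num) (by norm_num) B
  refine ⟨C, fun u hu h2 hD => ?_⟩
  have hA' := hA u hu h2 hD (by simpa using h2)
  have hB' := hB u hu h2 hD (by convert hA' using 4; norm_num)
  have hC' := hC u hu h2 hD (by convert hB' using 4; norm_num)
  convert hC' using 4
  norm_num

theorem lintegral_enorm_sq_eq {F : Type*} [NormedAddCommGroup F] {f : E5 → F}
    (hf : MemLp f 2 volume) :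
    ∫⁻ x, ‖f x‖ₑ ^ (2 : ℝ) = ENNReal.ofReal (∫ x, ‖f x‖ ^ 2) := by
  rw [ofReal_integral_eq_lintegral_ofReal ((memLp_two_iff_integrable_sq_norm hf.1).1 hf)
    (Eventually.of_forall fun x => by positivity)]
  refine lintegral_congr fun x => ?_
  rw [ENNReal.ofReal_pow (norm_nonneg _), ofReal_norm]
  norm_cast

theorem integral_norm_const_smul_sq {F : Type*} [NormedAddCommGroup F] [NormedSpace ℝ F] (c : ℝ)
    (f : E5 → F) : ∫ x, ‖c • f x‖ ^ 2 = c ^ 2 * ∫ x, ‖f x‖ ^ 2 := by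
  rw [← integral_const_mul]
  refine integral_congr_ae (Eventually.of_forall fun x => ?_)
  simp only [norm_smul, mul_pow, Real.norm_eq_abs, sq_abs]

theorem fderiv_real_smul (c : ℝ) {u : E5 → ℂ} (hu : Differentiable ℝ u) :
    fderiv ℝ (c • u) = fun x => c • fderiv ℝ u x :=
  funext fun x => fderiv_const_smul (hu x) c

theorem integral_norm_fderiv_const_smul_sq (c : ℝ) {u : E5 → ℂ} (hu : Differentiable ℝ u) :
    ∫ x, ‖fderiv ℝ (c • u) x‖ ^ 2 = c ^ 2 * ∫ x, ‖fderiv ℝ u x‖ ^ 2 := by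
  rw [fderiv_real_smul c hu]
  exact integral_norm_const_smul_sq c (fderiv ℝ u)

theorem InH1.const_smul {u : E5 → ℂ} (hu : InH1 u) (c : ℝ) : InH1 (c • u) := by
  refine ⟨hu.1.const_smul c, hu.2.1.const_smul c, ?_⟩
  rw [fderiv_real_smul c hu.2.1]
  exact hu.2.2.const_smul c

/-- The embedding `H¹(ℝ⁵) ⊂ L³(ℝ⁵)`. -/
theorem exists_lintegral_cube_le_of_H1normSq_le :
    ∃ C : ℝ, 0 < C ∧ ∀ u : E5 → ℂ, InH1 u → ∀ s : ℝ, 0 < s → H1normSq u ≤ s ^ 2 →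
      ∫⁻ x, ‖u x‖ₑ ^ 3 ≤ ENNReal.ofReal (C * s ^ 3) := by
  obtain ⟨C, hC⟩ := exists_lintegral_cube_le
  refine ⟨C + 1, by positivity, fun u hu s hs hH => ?_⟩
  have hmass : 0 ≤ ∫ x, ‖u x‖ ^ 2 := integral_nonneg fun x => by positivity
  have hkin : 0 ≤ ∫ x, ‖fderiv ℝ u x‖ ^ 2 := integral_nonneg fun x => by positivity
  unfold H1normSq at hH
  have hw := hu.const_smul s⁻¹
  have hcube := hC (s⁻¹ • u) hw.2.1
    (by
      rw [lintegral_enorm_sq_eq hw.1, ENNReal.ofReal_le_one]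
      simp only [Pi.smul_apply, integral_norm_const_smul_sq]
      rw [inv_pow, inv_mul_le_one₀ (by positivity)]
      linarith)
    (by
      rw [lintegral_enorm_sq_eq hw.2.2, ENNReal.ofReal_le_one,
        integral_norm_fderiv_const_smul_sq _ hu.2.1, inv_pow, inv_mul_le_one₀ (by positivity)]
      linarith)
  have hpt (x : E5) : ‖u x‖ₑ ^ 3 = ENNReal.ofReal (s ^ 3) * ‖(s⁻¹ • u) x‖ₑ ^ (3 : ℝ) := by
    have hux : u x = s • (s⁻¹ • u) x := by simp [hs.ne']
    have hs' : ‖s‖ₑ = ENNReal.ofReal s := Real.enorm_of_nonneg hs.le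
    conv_lhs => rw [hux, enorm_smul, mul_pow, hs', ← ENNReal.ofReal_pow hs.le]
    norm_cast
  simp_rw [hpt]
  rw [lintegral_const_mul' _ _ ENNReal.ofReal_ne_top, mul_comm, ENNReal.ofReal_mul (by positivity)]
  gcongr
  refine hcube.trans ?_
  rw [← ENNReal.ofReal_coe_nnreal]
  exact ENNReal.ofReal_le_ofReal (by linarith)

theorem abs_Pot_le {u v : E5 → ℂ} (hu : Continuous u) {A B : ℝ} (hA : 0 ≤ A) (hB : 0 ≤ B)
    (huA : ∫⁻ x, ‖u x‖ₑ ^ 3 ≤ ENNReal.ofReal A) (hvB : ∫⁻ x, ‖v x‖ₑ ^ 3 ≤ ENNReal.ofReal B) :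
    |Pot u v| ≤ A + B := by
  have hpt (x : E5) : ‖((starRingEnd ℂ) (v x) * (u x) ^ 2).re‖ₑ ≤ ‖u x‖ₑ ^ 3 + ‖v x‖ₑ ^ 3 := by
    have hre : ‖((starRingEnd ℂ) (v x) * (u x) ^ 2).re‖ₑ ≤ ‖v x‖ₑ * ‖u x‖ₑ ^ 2 := by
      rw [← ofReal_norm, ← ofReal_norm, ← ofReal_norm, ← ENNReal.ofReal_pow (norm_nonneg _),
        ← ENNReal.ofReal_mul (norm_nonneg _)]
      refine ENNReal.ofReal_le_ofReal ((Complex.abs_re_le_norm _).trans_eq ?_)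
      simp
    refine hre.trans ?_
    rcases le_total ‖u x‖ₑ ‖v x‖ₑ with h | h
    · calc ‖v x‖ₑ * ‖u x‖ₑ ^ 2 ≤ ‖v x‖ₑ * ‖v x‖ₑ ^ 2 := by gcongr
        _ = ‖v x‖ₑ ^ 3 := by ring
        _ ≤ _ := le_add_self
    · calc ‖v x‖ₑ * ‖u x‖ₑ ^ 2 ≤ ‖u x‖ₑ * ‖u x‖ₑ ^ 2 := by gcongr
        _ = ‖u x‖ₑ ^ 3 := by ring
        _ ≤ _ := le_self_add
  have hP : ‖Pot u v‖ₑ ≤ ENNReal.ofReal (A + B) := by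
    refine (enorm_integral_le_lintegral_enorm _).trans ((lintegral_mono hpt).trans ?_)
    rw [lintegral_add_left (hu.measurable.enorm.pow_const 3), ENNReal.ofReal_add hA hB]
    exact add_le_add huA hvB
  rwa [← ofReal_norm, ENNReal.ofReal_le_ofReal_iff (by positivity), Real.norm_eq_abs] at hP

theorem InH1.integral_norm_sq_pos {u : E5 → ℂ} (hu : InH1 u) (h0 : u ≠ 0) :
    0 < ∫ x, ‖u x‖ ^ 2 := by
  have hcont := hu.2.1.continuous
  obtain ⟨x, hx⟩ := Function.ne_iff.1 h0
  exact integral_pos_of_integrable_nonneg_nonzero (x := x) (by fun_prop)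
    ((memLp_two_iff_integrable_sq_norm hu.1.1).1 hu.1) (fun y => by positivity)
    (by simpa using hx)

theorem Kin_nonneg (u v : E5 → ℂ) : 0 ≤ Kin u v := by
  unfold Kin
  have h1 : 0 ≤ ∫ x, ‖fderiv ℝ u x‖ ^ 2 := integral_nonneg fun x => by positivity
  have h2 : 0 ≤ ∫ x, ‖fderiv ℝ v x‖ ^ 2 := integral_nonneg fun x => by positivity
  positivity

theorem Mass_pos {u v : E5 → ℂ} (hu : InH1 u) (hv : InH1 v) (h : Nontriv2 u v) :
    0 < Mass u v := by
  have h1 : 0 ≤ ∫ x, ‖u x‖ ^ 2 := integral_nonneg fun x => by positivity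
  have h2 : 0 ≤ ∫ x, ‖v x‖ ^ 2 := integral_nonneg fun x => by positivity
  unfold Mass
  rcases not_and_or.1 h with h | h
  · linarith [hu.integral_norm_sq_pos h]
  · linarith [hv.integral_norm_sq_pos h]

/-- `S_ω` is bounded below by a positive constant on the Nehari manifold. -/
theorem exists_pos_le_Sfun {ω : ℝ} (hω : 0 < ω) :
    ∃ δ : ℝ, 0 < δ ∧ ∀ u v : E5 → ℂ, InH1 u → InH1 v → Nontriv2 u v → Nehari ω u v = 0 →
      δ ≤ Sfun ω u v := by
  obtain ⟨C, hC, hcube⟩ := exists_lintegral_cube_le_of_H1normSq_le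
  set κ : ℝ := 2 + 1 / ω with hκ_def
  have hκ : 0 < κ := by positivity
  refine ⟨1 / (216 * C ^ 2 * κ ^ 3), by positivity, fun u v hu hv hne hN => ?_⟩
  set N : ℝ := Kin u v + ω * Mass u v with hN_def
  have hNpos : 0 < N := by
    have := mul_pos hω (Mass_pos hu hv hne)
    linarith [Kin_nonneg u v]
  have h1 : 0 ≤ ∫ x, ‖u x‖ ^ 2 := integral_nonneg fun x => by positivity
  have h2 : 0 ≤ ∫ x, ‖v x‖ ^ 2 := integral_nonneg fun x => by positivity
  have h3 : 0 ≤ ∫ x, ‖fderiv ℝ u x‖ ^ 2 := integral_nonneg fun x => by positivity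
  have h4 : 0 ≤ ∫ x, ‖fderiv ℝ v x‖ ^ 2 := integral_nonneg fun x => by positivity
  have hκN : κ * N = 2 * Kin u v + 2 * ω * Mass u v + Kin u v / ω + Mass u v := by
    rw [hκ_def, hN_def]; field_simp; ring
  have hrest : 0 ≤ 2 * ω * Mass u v + Kin u v / ω := by
    have := (Mass_pos hu hv hne).le
    have := Kin_nonneg u v
    positivity
  set s := √(κ * N)
  have hs : 0 < s := Real.sqrt_pos.2 (by positivity)
  have hs2 : s ^ 2 = κ * N := Real.sq_sqrt (by positivity)
  have hHu : H1normSq u ≤ s ^ 2 := by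
    rw [hs2, hκN]; unfold H1normSq Kin Mass at *; linarith
  have hHv : H1normSq v ≤ s ^ 2 := by
    rw [hs2, hκN]; unfold H1normSq Kin Mass at *; linarith
  have hP := (le_abs_self _).trans (abs_Pot_le hu.2.1.continuous (by positivity) (by positivity)
    (hcube u hu s hs hHu) (hcube v hv s hs hHv))
  have hNP : N = 3 * Pot u v := by unfold Nehari at hN; linarith
  have hS : Sfun ω u v = N / 6 := by unfold Sfun; linarith
  have hs_ge : 1 ≤ 6 * C * κ * s := by
    have : s ^ 2 * 1 ≤ s ^ 2 * (6 * C * κ * s) := by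
      calc s ^ 2 * 1 = κ * (3 * Pot u v) := by rw [mul_one, hs2, ← hNP]
        _ ≤ κ * (3 * (C * s ^ 3 + C * s ^ 3)) := by gcongr
        _ = s ^ 2 * (6 * C * κ * s) := by ring
    exact le_of_mul_le_mul_left this (by positivity)
  have hsq : 1 ≤ 36 * C ^ 2 * κ ^ 2 * (κ * N) := by
    rw [← hs2]
    nlinarith
  rw [hS, div_le_div_iff₀ (by positivity) (by norm_num)]
  linarith

theorem Kin_smul {u v : E5 → ℂ} (hu : InH1 u) (hv : InH1 v) (t : ℝ) :
    Kin (t • u) (t • v) = t ^ 2 * Kin u v := by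
  unfold Kin
  rw [integral_norm_fderiv_const_smul_sq t hu.2.1, integral_norm_fderiv_const_smul_sq t hv.2.1]
  ring

theorem Mass_smul (u v : E5 → ℂ) (t : ℝ) : Mass (t • u) (t • v) = t ^ 2 * Mass u v := by
  unfold Mass
  simp only [Pi.smul_apply, integral_norm_const_smul_sq]
  ring

theorem Pot_smul (u v : E5 → ℂ) (t : ℝ) : Pot (t • u) (t • v) = t ^ 3 * Pot u v := by
  unfold Pot
  rw [← integral_const_mul]
  refine integral_congr_ae (Eventually.of_forall fun x => ?_)
  have : (starRingEnd ℂ) ((t • v) x) * ((t • u) x) ^ 2 =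
      ((t ^ 3 : ℝ) : ℂ) * ((starRingEnd ℂ) (v x) * (u x) ^ 2) := by
    simp only [Pi.smul_apply, Complex.real_smul, map_mul, Complex.conj_ofReal]
    push_cast
    ring
  simp only [this, Complex.re_ofReal_mul]

/-- The Nehari manifold is nonempty. -/
theorem exists_Nehari_eq_zero {ω : ℝ} (hω : 0 < ω) :
    ∃ u v : E5 → ℂ, InH1 u ∧ InH1 v ∧ Nontriv2 u v ∧ Nehari ω u v = 0 := by
  let f : ContDiffBump (0 : E5) := ⟨1, 2, one_pos, one_lt_two⟩
  let φ : E5 → ℂ := fun x => (f x : ℂ)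
  have hsmooth : ContDiff ℝ 1 φ := Complex.ofRealCLM.contDiff.comp f.contDiff
  have hsupp : HasCompactSupport φ := f.hasCompactSupport.comp_left Complex.ofReal_zero
  have hφ0 : φ 0 = 1 := by
    simp [φ, f.one_of_mem_closedBall (Metric.mem_closedBall_self f.rIn_pos.le)]
  have hφ : InH1 φ :=
    ⟨hsmooth.continuous.memLp_of_hasCompactSupport hsupp, hsmooth.differentiable one_ne_zero,
      (hsmooth.continuous_fderiv one_ne_zero).memLp_of_hasCompactSupport (hsupp.fderiv ℝ)⟩
  have hφne : Nontriv2 φ φ := fun h => by simpa [hφ0] using congrFun h.1 0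
  have hpot_eq : Pot φ φ = ∫ x, f x ^ 3 := by
    unfold Pot
    refine integral_congr_ae (Eventually.of_forall fun x => ?_)
    have : (starRingEnd ℂ) (φ x) * φ x ^ 2 = ((f x ^ 3 : ℝ) : ℂ) := by
      simp only [φ, Complex.conj_ofReal]
      push_cast
      ring
    simp only [this, Complex.ofReal_re]
  have hpot : 0 < Pot φ φ := by
    rw [hpot_eq]
    have hcont : Continuous fun x => f x ^ 3 := f.continuous.pow 3
    refine integral_pos_of_integrable_nonneg_nonzero (x := 0) hcont
      (hcont.integrable_of_hasCompactSupport
        (f.hasCompactSupport.comp_left (g := fun y : ℝ => y ^ 3) (by norm_num)))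
      (fun x => pow_nonneg f.nonneg 3) ?_
    simp [f.one_of_mem_closedBall (Metric.mem_closedBall_self f.rIn_pos.le)]
  have hA : 0 < Kin φ φ + ω * Mass φ φ :=
    add_pos_of_nonneg_of_pos (Kin_nonneg φ φ) (mul_pos hω (Mass_pos hφ hφ hφne))
  set t : ℝ := (Kin φ φ + ω * Mass φ φ) / (3 * Pot φ φ) with ht_def
  have ht : 0 < t := by positivity
  refine ⟨t • φ, t • φ, hφ.const_smul t, hφ.const_smul t, fun h => ?_, ?_⟩
  · simpa [hφ0, ht.ne'] using congrFun h.1 0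
  · have htP : t * (3 * Pot φ φ) = Kin φ φ + ω * Mass φ φ := div_mul_cancel₀ _ (by positivity)
    unfold Nehari
    rw [Kin_smul hφ hφ, Mass_smul, Pot_smul]
    linear_combination -t ^ 2 * htP

/-- For every `ω > 0`, `d(ω) > 0`; moreover there is `C > 0` such that every
nontrivial `(u,v) ∈ H¹ × H¹` with `K_ω(u,v) = 0` satisfies
`S_ω(u,v) ≥ (1/2)√(1/C) > 0`. -/
theorem dmin_pos (ω : ℝ) (hω : 0 < ω) :
    0 < dmin ω ∧
    ∃ C : ℝ, 0 < C ∧ 0 < (1 / 2) * Real.sqrt (1 / C) ∧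
      ∀ u v : E5 → ℂ, InH1 u → InH1 v → Nontriv2 u v → Nehari ω u v = 0 →
        (1 / 2) * Real.sqrt (1 / C) ≤ Sfun ω u v := by
  obtain ⟨δ, hδ, hS⟩ := exists_pos_le_Sfun hω
  have hsqrt : (1 / 2) * Real.sqrt (1 / (1 / (2 * δ) ^ 2)) = δ := by
    rw [one_div_one_div, Real.sqrt_sq (by positivity)]
    ring
  refine ⟨?_, 1 / (2 * δ) ^ 2, by positivity, by rwa [hsqrt], by rwa [hsqrt]⟩
  obtain ⟨u, v, hu, hv, hne, hN⟩ := exists_Nehari_eq_zero hω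
  refine hδ.trans_le (le_csInf ⟨_, u, v, hu, hv, hne, hN, rfl⟩ ?_)
  rintro _ ⟨u, v, hu, hv, hne, hN, rfl⟩
  exact hS u v hu hv hne hN
end

section
/- For every ω > 0 the infimum d(ω) is attained: the set ℳ_ω = {(u,v) ∈ H¹×H¹ \ {(0,0)} : K_ω(u,v) = 0, S_ω(u,v) = d(ω)} is nonempty. -/
open MeasureTheory Complex Filter
open scoped ENNReal NNReal

open MeasureTheory Complex Filter
open scoped ENNReal

namespace GroundState

open scoped FourierTransform SchwartzMap Topology

/-- On `L¹ ∩ L²` the `L²` Fourier transform is given by the Fourier integral. -/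
theorem fourier_toLp_ae_eq {f : E5 → ℂ} (hf : Integrable f) (hf2 : MemLp f 2) :
    (𝓕 (hf2.toLp f) : Lp (α := E5) ℂ 2) =ᵐ[volume] 𝓕 f := by
  have hcont : Continuous (𝓕 f) :=
    VectorFourier.fourierIntegral_continuous Real.continuous_fourierChar
      (by exact continuous_inner) hf
  refine ae_eq_of_integral_contDiff_smul_eq
    ((Lp.memLp _).locallyIntegrable (by norm_num)) hcont.locallyIntegrable ?_
  intro g hg hgc
  have hgc' : HasCompactSupport (fun x => (g x : ℂ)) := hgc.comp_left (g := ((↑) : ℝ → ℂ)) rfl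
  have hg' : ContDiff ℝ ((⊤ : ℕ∞) : WithTop ℕ∞) (fun x => (g x : ℂ)) :=
    Complex.ofRealCLM.contDiff.comp hg
  let φ : 𝓢(E5, ℂ) := hgc'.toSchwartzMap hg'
  have h := congrArg (fun T => T φ) (Lp.fourier_toTemperedDistribution_eq (hf2.toLp f))
  simp only [TemperedDistribution.fourier_apply, Lp.toTemperedDistribution_apply] at h
  have h1 : ∫ x, g x • (𝓕 (hf2.toLp f) : Lp (α := E5) ℂ 2 volume) x =
      ∫ x, φ x • (𝓕 (hf2.toLp f) : Lp (α := E5) ℂ 2 volume) x := by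
    refine integral_congr_ae (.of_forall fun x => ?_)
    simp [φ]
  rw [h1, ← h]
  have h2 : ∫ x, (𝓕 φ) x • (hf2.toLp f) x = ∫ x, (𝓕 φ) x • f x :=
    integral_congr_ae (by filter_upwards [hf2.coeFn_toLp] with x hx; rw [hx])
  rw [h2]
  have h3 := VectorFourier.integral_fourierIntegral_smul_eq_flip (f := φ) (g := f)
    (L := innerₗ E5) Real.continuous_fourierChar continuous_inner
    (φ.integrable (μ := volume)) hf
  rw [flip_innerₗ] at h3
  refine h3.trans ?_
  refine integral_congr_ae (.of_forall fun x => ?_)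
  exact (RCLike.real_smul_eq_coe_smul (K := ℂ) (g x) (𝓕 f x)).symm

theorem memLp_fourier {f : E5 → ℂ} (hf : Integrable f) (hf2 : MemLp f 2) :
    MemLp (𝓕 f) 2 :=
  (memLp_congr_ae (fourier_toLp_ae_eq hf hf2)).1 (Lp.memLp _)

/-- Parseval's identity on `L¹ ∩ L²`. -/
theorem integral_conj_fourier_mul_fourier {f g : E5 → ℂ} (hf : Integrable f) (hf2 : MemLp f 2)
    (hg : Integrable g) (hg2 : MemLp g 2) :
    ∫ ξ, (starRingEnd ℂ) (𝓕 f ξ) * 𝓕 g ξ = ∫ x, (starRingEnd ℂ) (f x) * g x := by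
  have h := Lp.inner_fourier_eq (hf2.toLp f) (hg2.toLp g)
  rw [L2.inner_def, L2.inner_def] at h
  convert h using 1
  · refine integral_congr_ae ?_
    filter_upwards [fourier_toLp_ae_eq hf hf2, fourier_toLp_ae_eq hg hg2] with x hx hy
    rw [hx, hy]; simp [mul_comm]
  · refine integral_congr_ae ?_
    filter_upwards [hf2.coeFn_toLp, hg2.coeFn_toLp] with x hx hy
    rw [hx, hy]; simp [mul_comm]

theorem integral_norm_fourier_sq {f : E5 → ℂ} (hf : Integrable f) (hf2 : MemLp f 2) :
    ∫ ξ, ‖𝓕 f ξ‖ ^ 2 = ∫ x, ‖f x‖ ^ 2 := by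
  have h := integral_conj_fourier_mul_fourier hf hf2 hf hf2
  simp only [Complex.conj_mul'] at h
  norm_cast at h

/-- The weight `1 + |ξ|`. -/
noncomputable def wt (ξ : E5) : ℝ≥0∞ := 1 + ‖ξ‖ₑ

theorem one_le_wt (ξ : E5) : 1 ≤ wt ξ := le_self_add

theorem wt_ne_zero (ξ : E5) : wt ξ ≠ 0 := (zero_lt_one.trans_le (one_le_wt ξ)).ne'

theorem wt_ne_top (ξ : E5) : wt ξ ≠ ⊤ := by simp [wt]

@[fun_prop]
theorem measurable_wt : Measurable wt := by unfold wt; fun_prop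

theorem wt_eq_ofReal (ξ : E5) : wt ξ = ENNReal.ofReal (1 + ‖ξ‖) := by
  rw [ENNReal.ofReal_add zero_le_one (norm_nonneg _), ofReal_norm, ENNReal.ofReal_one, wt]

theorem wt_rpow_mul_wt_rpow (ξ : E5) (s t : ℝ) : wt ξ ^ s * wt ξ ^ t = wt ξ ^ (s + t) :=
  (ENNReal.rpow_add s t (wt_ne_zero ξ) (wt_ne_top ξ)).symm

theorem wt_rpow_le_wt_rpow (ξ : E5) {s t : ℝ} (h : s ≤ t) : wt ξ ^ s ≤ wt ξ ^ t :=
  ENNReal.rpow_le_rpow_of_exponent_le (one_le_wt ξ) h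

theorem rpow_neg_le_rpow_neg {x y : ℝ≥0∞} {α : ℝ} (hα : 0 ≤ α) (h : x ≤ y) :
    y ^ (-α) ≤ x ^ (-α) := by
  rw [ENNReal.rpow_neg, ENNReal.rpow_neg]
  exact ENNReal.inv_le_inv.2 (ENNReal.rpow_le_rpow h hα)

theorem wt_rpow_mul_le (ξ η ζ : E5) {α β γ s : ℝ} (hα : 0 ≤ α) (hβ : 0 ≤ β) (hγ : 0 ≤ γ)
    (hs : s ≤ α + β + γ) :
    wt ξ ^ (-α) * wt η ^ (-β) * wt ζ ^ (-γ) ≤ wt ξ ^ (-s) + wt η ^ (-s) + wt ζ ^ (-s) := by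
  have key : ∀ x : E5, wt x ≤ wt ξ → wt x ≤ wt η → wt x ≤ wt ζ →
      wt ξ ^ (-α) * wt η ^ (-β) * wt ζ ^ (-γ) ≤ wt x ^ (-s) := by
    intro x h1 h2 h3
    calc wt ξ ^ (-α) * wt η ^ (-β) * wt ζ ^ (-γ)
        ≤ wt x ^ (-α) * wt x ^ (-β) * wt x ^ (-γ) :=
          mul_le_mul' (mul_le_mul' (rpow_neg_le_rpow_neg hα h1) (rpow_neg_le_rpow_neg hβ h2))
            (rpow_neg_le_rpow_neg hγ h3)
      _ = wt x ^ (-α + -β + -γ) := by rw [wt_rpow_mul_wt_rpow, wt_rpow_mul_wt_rpow]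
      _ ≤ wt x ^ (-s) := wt_rpow_le_wt_rpow x (by linarith)
  rcases le_total (wt ξ) (wt η) with h1 | h1 <;> rcases le_total (wt η) (wt ζ) with h2 | h2 <;>
    rcases le_total (wt ξ) (wt ζ) with h3 | h3
  · exact (key ξ le_rfl h1 h3).trans (le_self_add.trans le_self_add)
  · exact (key ξ le_rfl h1 (h1.trans h2)).trans (le_self_add.trans le_self_add)
  · exact (key ξ le_rfl h1 h3).trans (le_self_add.trans le_self_add)
  · exact (key ζ h3 h2 le_rfl).trans le_add_self
  · exact (key η h1 le_rfl h2).trans (le_add_self.trans le_self_add)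
  · exact (key η h1 le_rfl h2).trans (le_add_self.trans le_self_add)
  · exact (key ζ (h2.trans h1) h2 le_rfl).trans le_add_self
  · exact (key ζ h3 h2 le_rfl).trans le_add_self

/-- The `L²` norm of an extended nonnegative function. -/
noncomputable def nrm (f : E5 → ℝ≥0∞) : ℝ≥0∞ := (∫⁻ x, f x ^ (2 : ℝ)) ^ (1 / 2 : ℝ)

theorem nrm_mono {f g : E5 → ℝ≥0∞} (h : ∀ x, f x ≤ g x) : nrm f ≤ nrm g := by
  unfold nrm; gcongr with x; exact h x

theorem nrm_const_mul {f : E5 → ℝ≥0∞} (hf : Measurable f) (c : ℝ≥0∞) :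
    nrm (fun x => c * f x) = c * nrm f := by
  unfold nrm
  simp_rw [ENNReal.mul_rpow_of_nonneg _ _ (zero_le_two : (0 : ℝ) ≤ 2)]
  rw [lintegral_const_mul _ (by fun_prop), ENNReal.mul_rpow_of_nonneg _ _ (by norm_num),
    ← ENNReal.rpow_mul]
  norm_num

theorem lintegral_mul_le_nrm {f g : E5 → ℝ≥0∞} (hf : Measurable f) (hg : Measurable g) :
    ∫⁻ x, f x * g x ≤ nrm f * nrm g :=
  ENNReal.lintegral_mul_le_Lp_mul_Lq volume Real.HolderConjugate.two_two hf.aemeasurable hg.aemeasurable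

theorem nrm_add_le {f g : E5 → ℝ≥0∞} (hf : Measurable f) (hg : Measurable g) :
    nrm (fun x => f x + g x) ≤ nrm f + nrm g :=
  ENNReal.lintegral_Lp_add_le hf.aemeasurable hg.aemeasurable (by norm_num)

theorem nrm_comp_sub (f : E5 → ℝ≥0∞) (y : E5) : nrm (fun x => f (y - x)) = nrm f := by
  unfold nrm
  rw [lintegral_sub_left_eq_self (fun x => f x ^ (2 : ℝ)) y]

theorem nrm_wt_lt_top : nrm (fun x => wt x ^ (-(11 / 4) : ℝ)) < ⊤ := by
  refine ENNReal.rpow_lt_top_of_nonneg (by norm_num) ?_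
  have h : Integrable (fun x : E5 => (1 + ‖x‖) ^ (-(11 / 2) : ℝ)) :=
    integrable_one_add_norm (by simp; norm_num)
  refine ne_top_of_le_ne_top h.lintegral_lt_top.ne (lintegral_mono fun x => ?_)
  rw [← ENNReal.rpow_mul, wt_eq_ofReal, ENNReal.ofReal_rpow_of_pos (by positivity)]
  norm_num

/-- The trilinear form `∫∫ a(ξ) b(η) c(-ξ-η)` on nonnegative functions. -/
noncomputable def ltri (a b c : E5 → ℝ≥0∞) : ℝ≥0∞ := ∫⁻ ξ, ∫⁻ η, a ξ * b η * c (-ξ - η)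

theorem ltri_comm {a b c : E5 → ℝ≥0∞} (ha : Measurable a) (hb : Measurable b)
    (hc : Measurable c) : ltri a b c = ltri b a c := by
  unfold ltri
  rw [lintegral_lintegral_swap (by fun_prop)]
  congr! 5 with ξ η
  · ring
  · abel_nf

theorem ltri_comm' {a b c : E5 → ℝ≥0∞} : ltri a b c = ltri a c b := by
  unfold ltri
  congr! 2 with ξ
  rw [← lintegral_sub_left_eq_self _ (-ξ)]
  congr! 2 with η
  rw [sub_sub_cancel]; ring

theorem ltri_le_lintegral_mul_nrm {f g h : E5 → ℝ≥0∞} (hf : Measurable f)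
    (hg : Measurable g) (hh : Measurable h) : ltri f g h ≤ (∫⁻ x, f x) * nrm g * nrm h := by
  unfold ltri
  have : ∀ ξ, ∫⁻ η, f ξ * g η * h (-ξ - η) ≤ f ξ * (nrm g * nrm h) := by
    intro ξ
    simp_rw [mul_assoc]
    rw [lintegral_const_mul _ (by fun_prop)]
    gcongr
    refine (lintegral_mul_le_nrm hg (by fun_prop)).trans ?_
    rw [nrm_comp_sub]
  refine (lintegral_mono this).trans ?_
  rw [lintegral_mul_const _ hf, mul_assoc]

theorem ltri_le_sum {a b c : E5 → ℝ≥0∞} (ha : Measurable a) (hb : Measurable b)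
    (hc : Measurable c) {α β γ : ℝ} (hα : 0 ≤ α) (hβ : 0 ≤ β) (hγ : 0 ≤ γ)
    (hs : 11 / 4 ≤ α + β + γ) :
    ltri a b c ≤
      (∫⁻ x, wt x ^ (-(11 / 4) : ℝ) * (wt x ^ α * a x)) * nrm (fun x => wt x ^ β * b x) *
        nrm (fun x => wt x ^ γ * c x) +
      (∫⁻ x, wt x ^ (-(11 / 4) : ℝ) * (wt x ^ β * b x)) * nrm (fun x => wt x ^ α * a x) *
        nrm (fun x => wt x ^ γ * c x) +
      (∫⁻ x, wt x ^ (-(11 / 4) : ℝ) * (wt x ^ γ * c x)) * nrm (fun x => wt x ^ α * a x) *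
        nrm (fun x => wt x ^ β * b x) := by
  set k : E5 → ℝ≥0∞ := fun x => wt x ^ (-(11 / 4) : ℝ) with hk
  set f : E5 → ℝ≥0∞ := fun x => wt x ^ α * a x with hf
  set g : E5 → ℝ≥0∞ := fun x => wt x ^ β * b x with hg
  set h : E5 → ℝ≥0∞ := fun x => wt x ^ γ * c x with hh
  have mk : Measurable k := by fun_prop
  have mf : Measurable f := by fun_prop
  have mg : Measurable g := by fun_prop
  have mh : Measurable h := by fun_prop
  have hinv : ∀ (x : E5) (t : ℝ) (y : ℝ≥0∞), wt x ^ (-t) * (wt x ^ t * y) = y := by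
    intro x t y
    rw [← mul_assoc, wt_rpow_mul_wt_rpow]; simp
  have hpt : ∀ ξ η, a ξ * b η * c (-ξ - η) ≤
      (k ξ * f ξ) * g η * h (-ξ - η) + f ξ * (k η * g η) * h (-ξ - η) +
        f ξ * g η * (k (-ξ - η) * h (-ξ - η)) := by
    intro ξ η
    calc a ξ * b η * c (-ξ - η)
        = (wt ξ ^ (-α) * wt η ^ (-β) * wt (-ξ - η) ^ (-γ)) * (f ξ * g η * h (-ξ - η)) := by
          conv_lhs => rw [← hinv ξ α (a ξ), ← hinv η β (b η), ← hinv (-ξ - η) γ (c (-ξ - η))]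
          simp only [hf, hg, hh]; ring
      _ ≤ (k ξ + k η + k (-ξ - η)) * (f ξ * g η * h (-ξ - η)) := by
          gcongr; exact wt_rpow_mul_le ξ η _ hα hβ hγ hs
      _ = _ := by ring
  have hle : ltri a b c ≤ ltri (fun x => k x * f x) g h + ltri f (fun x => k x * g x) h +
      ltri f g (fun x => k x * h x) := by
    unfold ltri
    calc _ ≤ ∫⁻ ξ, ∫⁻ η, ((k ξ * f ξ) * g η * h (-ξ - η) + f ξ * (k η * g η) * h (-ξ - η) +
        f ξ * g η * (k (-ξ - η) * h (-ξ - η))) :=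
          lintegral_mono fun ξ => lintegral_mono fun η => hpt ξ η
      _ = _ := by
          rw [← lintegral_add_left (by fun_prop), ← lintegral_add_left (by fun_prop)]
          congr! 2 with ξ
          rw [lintegral_add_left (by fun_prop), lintegral_add_left (by fun_prop)]
  refine hle.trans ?_
  gcongr
  · exact ltri_le_lintegral_mul_nrm (by fun_prop) mg mh
  · rw [ltri_comm mf (by fun_prop) mh]
    exact ltri_le_lintegral_mul_nrm (by fun_prop) mf mh
  · rw [ltri_comm', ltri_comm mf (by fun_prop) mg]
    exact ltri_le_lintegral_mul_nrm (by fun_prop) mf mg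

/-- A constant in the trilinear estimate `ltri_le`. -/
noncomputable def triConst : ℝ≥0∞ := 3 * nrm (fun x => wt x ^ (-(11 / 4) : ℝ))

theorem triConst_lt_top : triConst < ⊤ := ENNReal.mul_lt_top (by simp) nrm_wt_lt_top

theorem ltri_le {a b c : E5 → ℝ≥0∞} (ha : Measurable a) (hb : Measurable b)
    (hc : Measurable c) {α β γ : ℝ} (hα : 0 ≤ α) (hβ : 0 ≤ β) (hγ : 0 ≤ γ)
    (hs : 11 / 4 ≤ α + β + γ) :
    ltri a b c ≤ triConst * (nrm (fun x => wt x ^ α * a x) * nrm (fun x => wt x ^ β * b x) *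
      nrm (fun x => wt x ^ γ * c x)) := by
  have e : ∀ f : E5 → ℝ≥0∞, Measurable f → ∫⁻ x, wt x ^ (-(11 / 4) : ℝ) * f x ≤
      nrm (fun x => wt x ^ (-(11 / 4) : ℝ)) * nrm f := fun f hf =>
    lintegral_mul_le_nrm (by fun_prop) hf
  refine (ltri_le_sum ha hb hc hα hβ hγ hs).trans ?_
  refine (add_le_add (add_le_add (mul_le_mul_left (mul_le_mul_left (e _ (by fun_prop)) _) _)
    (mul_le_mul_left (mul_le_mul_left (e _ (by fun_prop)) _) _))
    (mul_le_mul_left (mul_le_mul_left (e _ (by fun_prop)) _) _)).trans (le_of_eq ?_)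
  unfold triConst
  ring

/-- The norm `‖(1 + |ξ|) a‖_{L²}`. -/
noncomputable def nx (a : E5 → ℝ) : ℝ≥0∞ := nrm (fun x => wt x * ‖a x‖ₑ)

/-- Measurable functions with finite weighted norm `nx`. -/
structure InX (a : E5 → ℝ) : Prop where
  measurable : Measurable a
  nx_lt_top : nx a < ⊤

theorem nx_mono {a b : E5 → ℝ} (h : ∀ x, |a x| ≤ |b x|) : nx a ≤ nx b :=
  nrm_mono fun x => by
    rw [← ofReal_norm, ← ofReal_norm]; exact mul_le_mul_right (ENNReal.ofReal_le_ofReal (h x)) _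

theorem InX.mono {a b : E5 → ℝ} (hb : InX b) (ha : Measurable a) (h : ∀ x, |a x| ≤ |b x|) :
    InX a := ⟨ha, (nx_mono h).trans_lt hb.2⟩

theorem nx_add_le {a b : E5 → ℝ} (ha : Measurable a) (hb : Measurable b) :
    nx (fun x => a x + b x) ≤ nx a + nx b := by
  refine le_trans (nrm_mono fun x => ?_) (nrm_add_le (by fun_prop) (by fun_prop))
  rw [← mul_add]; gcongr; exact enorm_add_le _ _

theorem nx_const_mul {a : E5 → ℝ} (ha : Measurable a) (t : ℝ) :
    nx (fun x => t * a x) = ‖t‖ₑ * nx a := by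
  unfold nx
  rw [← nrm_const_mul (by fun_prop)]
  congr! 2 with x
  rw [enorm_mul]; ring

theorem InX.add {a b : E5 → ℝ} (ha : InX a) (hb : InX b) : InX (fun x => a x + b x) :=
  ⟨ha.1.add hb.1, (nx_add_le ha.1 hb.1).trans_lt (ENNReal.add_lt_top.2 ⟨ha.2, hb.2⟩)⟩

theorem InX.const_mul {a : E5 → ℝ} (ha : InX a) (t : ℝ) : InX (fun x => t * a x) :=
  ⟨ha.1.const_mul t, by rw [nx_const_mul ha.1]; exact ENNReal.mul_lt_top (by simp) ha.2⟩

theorem InX.sub {a b : E5 → ℝ} (ha : InX a) (hb : InX b) : InX (fun x => a x - b x) := by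
  simpa [sub_eq_add_neg] using ha.add (hb.const_mul (-1))

theorem InX.abs {a : E5 → ℝ} (ha : InX a) : InX (fun x => |a x|) :=
  ha.mono ha.1.abs fun x => by simp

theorem nrm_enorm_le_nx (a : E5 → ℝ) : nrm (fun x => ‖a x‖ₑ) ≤ nx a :=
  nrm_mono fun x => le_mul_of_one_le_left' (one_le_wt x)

theorem nrm_enorm_eq (f : E5 → ℝ) : nrm (fun x => ‖f x‖ₑ) = eLpNorm f 2 volume := by
  rw [eLpNorm_eq_lintegral_rpow_enorm_toReal (by norm_num) (by norm_num)]; simp [nrm]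

theorem nx_eq_eLpNorm (a : E5 → ℝ) : nx a = eLpNorm (fun x => (1 + ‖x‖) * a x) 2 volume := by
  rw [← nrm_enorm_eq]
  unfold nx
  congr! 2 with x
  rw [enorm_mul, wt_eq_ofReal, Real.enorm_of_nonneg (show (0 : ℝ) ≤ 1 + ‖x‖ by positivity)]

theorem InX.memLp {a : E5 → ℝ} (ha : InX a) : MemLp (fun x => (1 + ‖x‖) * a x) 2 :=
  ⟨by have := ha.1; fun_prop, by rw [← nx_eq_eLpNorm]; exact ha.2⟩

theorem InX.of_memLp {a : E5 → ℝ} (hm : Measurable a) (ha : MemLp (fun x => (1 + ‖x‖) * a x) 2) :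
    InX a := ⟨hm, by rw [nx_eq_eLpNorm]; exact ha.2⟩

/-- The trilinear form `∫∫ a(ξ) b(η) c(-ξ-η)`. -/
noncomputable def tri (a b c : E5 → ℝ) : ℝ := ∫ p : E5 × E5, a p.1 * b p.2 * c (-p.1 - p.2)

theorem lintegral_enorm_tri {a b c : E5 → ℝ} (ha : Measurable a) (hb : Measurable b)
    (hc : Measurable c) : ∫⁻ p : E5 × E5, ‖a p.1 * b p.2 * c (-p.1 - p.2)‖ₑ =
      ltri (fun x => ‖a x‖ₑ) (fun x => ‖b x‖ₑ) (fun x => ‖c x‖ₑ) := by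
  rw [Measure.volume_eq_prod, lintegral_prod _ (by fun_prop)]
  simp only [enorm_mul, ltri]

theorem enorm_tri_le {a b c : E5 → ℝ} (ha : Measurable a) (hb : Measurable b)
    (hc : Measurable c) : ‖tri a b c‖ₑ ≤
      ltri (fun x => ‖a x‖ₑ) (fun x => ‖b x‖ₑ) (fun x => ‖c x‖ₑ) := by
  rw [← lintegral_enorm_tri ha hb hc]; exact enorm_integral_le_lintegral_enorm _

theorem ltri_le_nx {a b c : E5 → ℝ} (ha : Measurable a) (hb : Measurable b)
    (hc : Measurable c) : ltri (fun x => ‖a x‖ₑ) (fun x => ‖b x‖ₑ) (fun x => ‖c x‖ₑ) ≤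
      triConst * (nx a * nx b * nx c) := by
  simpa [nx] using ltri_le (α := 1) (β := 1) (γ := 1) ha.enorm hb.enorm hc.enorm
    zero_le_one zero_le_one zero_le_one (by norm_num)

theorem ltri_lt_top {a b c : E5 → ℝ} (ha : InX a) (hb : InX b) (hc : InX c) :
    ltri (fun x => ‖a x‖ₑ) (fun x => ‖b x‖ₑ) (fun x => ‖c x‖ₑ) < ⊤ :=
  (ltri_le_nx ha.1 hb.1 hc.1).trans_lt (ENNReal.mul_lt_top triConst_lt_top
    (ENNReal.mul_lt_top (ENNReal.mul_lt_top ha.2 hb.2) hc.2))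

theorem integrable_tri {a b c : E5 → ℝ} (ha : InX a) (hb : InX b) (hc : InX c) :
    Integrable (fun p : E5 × E5 => a p.1 * b p.2 * c (-p.1 - p.2)) := by
  refine ⟨?_, ?_⟩
  · have h1 := ha.1; have h2 := hb.1; have h3 := hc.1
    exact Measurable.aestronglyMeasurable (by fun_prop)
  · rw [HasFiniteIntegral, lintegral_enorm_tri ha.1 hb.1 hc.1]
    exact ltri_lt_top ha hb hc

theorem tri_eq_integral_integral {a b c : E5 → ℝ} (ha : InX a) (hb : InX b) (hc : InX c) :
    tri a b c = ∫ ξ, a ξ * ∫ η, b η * c (-ξ - η) := by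
  unfold tri
  rw [Measure.volume_eq_prod, integral_prod _ (integrable_tri ha hb hc)]
  simp only [mul_assoc, integral_const_mul]

theorem tri_comm (a b c : E5 → ℝ) : tri a b c = tri b a c := by
  unfold tri
  rw [Measure.volume_eq_prod, ← integral_prod_swap]
  refine integral_congr_ae (.of_forall fun p => ?_)
  simp only [Prod.fst_swap, Prod.snd_swap, mul_comm (a p.2)]
  congr 2; abel

theorem tri_comm' {a b c : E5 → ℝ} (ha : InX a) (hb : InX b) (hc : InX c) :
    tri a b c = tri a c b := by
  rw [tri_eq_integral_integral ha hb hc, tri_eq_integral_integral ha hc hb]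
  congr! 3 with ξ
  rw [← integral_sub_left_eq_self _ _ (-ξ)]
  congr! 2 with η
  rw [sub_sub_cancel, mul_comm]

theorem tri_add_left {a a' b c : E5 → ℝ} (ha : InX a) (ha' : InX a') (hb : InX b) (hc : InX c) :
    tri (fun x => a x + a' x) b c = tri a b c + tri a' b c := by
  unfold tri
  rw [← integral_add (integrable_tri ha hb hc) (integrable_tri ha' hb hc)]
  congr! 2 with p; ring

theorem tri_add_mid {a b b' c : E5 → ℝ} (ha : InX a) (hb : InX b) (hb' : InX b') (hc : InX c) :
    tri a (fun x => b x + b' x) c = tri a b c + tri a b' c := by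
  rw [tri_comm, tri_add_left hb hb' ha hc, tri_comm b, tri_comm b']

theorem tri_add_right {a b c c' : E5 → ℝ} (ha : InX a) (hb : InX b) (hc : InX c) (hc' : InX c') :
    tri a b (fun x => c x + c' x) = tri a b c + tri a b c' := by
  unfold tri
  rw [← integral_add (integrable_tri ha hb hc) (integrable_tri ha hb hc')]
  congr! 2 with p; ring

theorem tri_const_mul_left (a b c : E5 → ℝ) (t : ℝ) :
    tri (fun x => t * a x) b c = t * tri a b c := by
  unfold tri
  rw [← integral_const_mul]; congr! 2 with p; ring

theorem tri_const_mul_mid (a b c : E5 → ℝ) (t : ℝ) :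
    tri a (fun x => t * b x) c = t * tri a b c := by
  unfold tri
  rw [← integral_const_mul]; congr! 2 with p; ring

theorem tri_const_mul_right (a b c : E5 → ℝ) (t : ℝ) :
    tri a b (fun x => t * c x) = t * tri a b c := by
  unfold tri
  rw [← integral_const_mul]; congr! 2 with p; ring

theorem tri_le_tri_abs {a b c : E5 → ℝ} (ha : InX a) (hb : InX b) (hc : InX c) :
    tri a b c ≤ tri (fun x => |a x|) (fun x => |b x|) (fun x => |c x|) :=
  integral_mono (integrable_tri ha hb hc) (integrable_tri ha.abs hb.abs hc.abs) fun p => by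
    dsimp only; rw [← abs_mul, ← abs_mul]; exact le_abs_self _

/-- Admissible densities: measurable functions comparable to `(1 + |ξ|)²`. -/
structure IsDensity (m : E5 → ℝ) : Prop where
  measurable : Measurable m
  lower : ∃ c > 0, ∀ ξ, c * (1 + ‖ξ‖) ^ 2 ≤ m ξ
  upper : ∃ C, ∀ ξ, m ξ ≤ C * (1 + ‖ξ‖) ^ 2

theorem IsDensity.pos {m : E5 → ℝ} (hm : IsDensity m) (ξ : E5) : 0 < m ξ := by
  obtain ⟨c, hc, h⟩ := hm.lower
  exact lt_of_lt_of_le (by positivity) (h ξ)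

theorem isDensity_sq : IsDensity (fun ξ => (1 + ‖ξ‖) ^ 2) :=
  ⟨by fun_prop, ⟨1, one_pos, fun ξ => by simp⟩, ⟨1, fun ξ => by simp⟩⟩

/-- The weighted pairing `∫ m a b`. -/
noncomputable def pair (m a b : E5 → ℝ) : ℝ := ∫ ξ, m ξ * (a ξ * b ξ)

theorem integrable_pair {m a b : E5 → ℝ} (hm : IsDensity m) (ha : InX a) (hb : InX b) :
    Integrable (fun ξ => m ξ * (a ξ * b ξ)) := by
  obtain ⟨C, hC⟩ := hm.upper
  have h := (ha.memLp.integrable_mul hb.memLp).norm.const_mul C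
  refine h.mono' ?_ (.of_forall fun ξ => ?_)
  · have h1 := ha.1; have h2 := hb.1; have h3 := hm.1
    exact Measurable.aestronglyMeasurable (by fun_prop)
  · simp only [Pi.mul_apply, norm_mul, Real.norm_eq_abs, abs_of_pos (hm.pos ξ)]
    rw [abs_of_pos (show (0 : ℝ) < 1 + ‖ξ‖ by positivity)]
    calc m ξ * (|a ξ| * |b ξ|) ≤ (C * (1 + ‖ξ‖) ^ 2) * (|a ξ| * |b ξ|) := by gcongr; exact hC ξ
      _ = _ := by ring

theorem pair_comm (m a b : E5 → ℝ) : pair m a b = pair m b a := by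
  simp only [pair, mul_comm (a _)]

theorem pair_add_left {m a a' b : E5 → ℝ} (hm : IsDensity m) (ha : InX a) (ha' : InX a')
    (hb : InX b) : pair m (fun x => a x + a' x) b = pair m a b + pair m a' b := by
  unfold pair
  rw [← integral_add (integrable_pair hm ha hb) (integrable_pair hm ha' hb)]
  congr! 2 with p; ring

theorem pair_const_mul_left (m a b : E5 → ℝ) (t : ℝ) :
    pair m (fun x => t * a x) b = t * pair m a b := by
  unfold pair
  rw [← integral_const_mul]; congr! 2 with p; ring

theorem pair_sub_left {m a a' b : E5 → ℝ} (hm : IsDensity m) (ha : InX a) (ha' : InX a')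
    (hb : InX b) : pair m (fun x => a x - a' x) b = pair m a b - pair m a' b := by
  unfold pair
  rw [← integral_sub (integrable_pair hm ha hb) (integrable_pair hm ha' hb)]
  congr! 2 with p; ring

theorem pair_self_nonneg {m : E5 → ℝ} (hm : IsDensity m) (a : E5 → ℝ) : 0 ≤ pair m a a :=
  integral_nonneg fun ξ => mul_nonneg (hm.pos ξ).le (mul_self_nonneg _)

theorem pair_add_self {m a b : E5 → ℝ} (hm : IsDensity m) (ha : InX a) (hb : InX b) :
    pair m (fun x => a x + b x) (fun x => a x + b x) =
      pair m a a + 2 * pair m b a + pair m b b := by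
  rw [pair_add_left hm ha hb (ha.add hb), pair_comm m a, pair_comm m b,
    pair_add_left hm ha hb ha, pair_add_left hm ha hb hb, pair_comm m a b]
  ring

theorem ae_eq_zero_of_pair_self {m a : E5 → ℝ} (hm : IsDensity m) (ha : InX a)
    (h : pair m a a = 0) : a =ᵐ[volume] 0 := by
  have := (integral_eq_zero_iff_of_nonneg
    (fun ξ => mul_nonneg (hm.pos ξ).le (mul_self_nonneg _)) (integrable_pair hm ha ha)).1 h
  filter_upwards [this] with ξ hξ
  simpa [(hm.pos ξ).ne'] using hξ

theorem nx_sq {a : E5 → ℝ} (ha : InX a) :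
    nx a = ENNReal.ofReal (√(pair (fun ξ => (1 + ‖ξ‖) ^ 2) a a)) := by
  have hI := integrable_pair isDensity_sq ha ha
  unfold nx nrm
  rw [Real.sqrt_eq_rpow, ← ENNReal.ofReal_rpow_of_nonneg (pair_self_nonneg isDensity_sq a)
    (by norm_num), pair, ofReal_integral_eq_lintegral_ofReal hI (.of_forall fun ξ => by
      dsimp; exact mul_nonneg (by positivity) (mul_self_nonneg _))]
  congr! 3 with ξ
  dsimp only
  rw [wt_eq_ofReal, ← ofReal_norm, ← ENNReal.ofReal_mul (by positivity),
    ENNReal.ofReal_rpow_of_nonneg (by positivity) (by norm_num)]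
  congr 1
  rw [Real.norm_eq_abs, Real.rpow_two, mul_pow, sq_abs]; ring

theorem exists_nx_le {m : E5 → ℝ} (hm : IsDensity m) :
    ∃ A : ℝ, 0 ≤ A ∧ ∀ a, InX a → nx a ≤ ENNReal.ofReal (A * √(pair m a a)) := by
  obtain ⟨c, hc, h⟩ := hm.lower
  refine ⟨√(1 / c), by positivity, fun a ha => ?_⟩
  rw [nx_sq ha, ← Real.sqrt_mul (by positivity)]
  gcongr
  unfold pair
  rw [← integral_const_mul]
  refine integral_mono (integrable_pair isDensity_sq ha ha)
    ((integrable_pair hm ha ha).const_mul _) fun ξ => ?_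
  dsimp only
  have h1 : (1 + ‖ξ‖) ^ 2 ≤ 1 / c * m ξ := by
    rw [one_div, ← div_eq_inv_mul, le_div_iff₀ hc, mul_comm]; exact h ξ
  simpa [mul_assoc] using mul_le_mul_of_nonneg_right h1 (mul_self_nonneg (a ξ))

theorem exists_subseq_tendsto_inner {H : Type*} [NormedAddCommGroup H] [InnerProductSpace ℝ H]
    [CompleteSpace H] [TopologicalSpace.SeparableSpace H] {x : ℕ → H} {r : ℝ}
    (hx : ∀ n, ‖x n‖ ≤ r) : ∃ y : H, ∃ φ : ℕ → ℕ, StrictMono φ ∧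
      ∀ z : H, Tendsto (fun n => inner ℝ (x (φ n)) z) atTop (𝓝 (inner ℝ y z)) := by
  obtain ⟨L, -, φ, hφ, hL⟩ := WeakDual.isSeqCompact_closedBall ℝ H 0 r
    (x := fun n => StrongDual.toWeakDual (InnerProductSpace.toDual ℝ H (x n)))
    (fun n => by simpa using hx n)
  refine ⟨(InnerProductSpace.toDual ℝ H).symm (WeakDual.toStrongDual L), φ, hφ, fun z => ?_⟩
  have := tendsto_iff_forall_eval_tendsto_topDualPairing.1 hL z
  rw [InnerProductSpace.toDual_symm_apply]
  exact this

theorem InX.inner_toLp {a b : E5 → ℝ} (ha : InX a) (hb : InX b) :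
    inner ℝ (ha.memLp.toLp _) (hb.memLp.toLp _) = pair (fun ξ => (1 + ‖ξ‖) ^ 2) a b := by
  rw [L2.inner_def, pair]
  refine integral_congr_ae ?_
  filter_upwards [ha.memLp.coeFn_toLp, hb.memLp.coeFn_toLp] with x h1 h2
  rw [h1, h2]; simp only [RCLike.inner_apply, conj_trivial]; ring

/-- Weak convergence in the Hilbert space `L²((1 + |ξ|)² dξ)`. -/
def WeakTo (a : ℕ → E5 → ℝ) (a₀ : E5 → ℝ) : Prop := ∀ b, InX b →
  Tendsto (fun n => pair (fun ξ => (1 + ‖ξ‖) ^ 2) (a n) b) atTop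
    (𝓝 (pair (fun ξ => (1 + ‖ξ‖) ^ 2) a₀ b))

theorem WeakTo.comp {a : ℕ → E5 → ℝ} {a₀ : E5 → ℝ} (h : WeakTo a a₀) {φ : ℕ → ℕ}
    (hφ : StrictMono φ) : WeakTo (fun n => a (φ n)) a₀ :=
  fun b hb => (h b hb).comp hφ.tendsto_atTop

theorem exists_weakTo {a : ℕ → E5 → ℝ} (ha : ∀ n, InX (a n)) {M : ℝ≥0∞} (hM : M < ⊤)
    (h : ∀ n, nx (a n) ≤ M) :
    ∃ a₀, InX a₀ ∧ ∃ φ : ℕ → ℕ, StrictMono φ ∧ WeakTo (fun n => a (φ n)) a₀ := by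
  have : Fact ((2 : ℝ≥0∞) ≠ ⊤) := ⟨by simp⟩
  obtain ⟨y, φ, hφ, hy⟩ := exists_subseq_tendsto_inner
    (x := fun n => (ha n).memLp.toLp _) (r := M.toReal) fun n => by
      rw [Lp.norm_toLp, ← nx_eq_eLpNorm]; exact ENNReal.toReal_mono hM.ne (h n)
  have hmul : ∀ x : E5, (1 + ‖x‖) * (y x / (1 + ‖x‖)) = y x := fun x => by field_simp
  have hX : InX (fun x => y x / (1 + ‖x‖)) := by
    refine InX.of_memLp ?_ ?_
    · have := (Lp.stronglyMeasurable y).measurable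
      fun_prop
    · simp only [hmul]; exact Lp.memLp y
  refine ⟨_, hX, φ, hφ, fun b hb => ?_⟩
  have hyX : hX.memLp.toLp _ = y := by
    refine Lp.ext (hX.memLp.coeFn_toLp.trans (.of_forall fun x => hmul x))
  have := hy (hb.memLp.toLp _)
  rw [← hyX] at this
  rw [hX.inner_toLp hb] at this
  exact this.congr fun n => (ha (φ n)).inner_toLp hb

theorem WeakTo.tendsto_pair {a : ℕ → E5 → ℝ} {a₀ : E5 → ℝ} (h : WeakTo a a₀) {m b : E5 → ℝ}
    (hm : IsDensity m) (hb : InX b) :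
    Tendsto (fun n => pair m (a n) b) atTop (𝓝 (pair m a₀ b)) := by
  have e : ∀ c : E5 → ℝ, pair m c b =
      pair (fun ξ => (1 + ‖ξ‖) ^ 2) c (fun ξ => m ξ / (1 + ‖ξ‖) ^ 2 * b ξ) := fun c => by
    unfold pair
    congr! 2 with ξ
    field_simp
  simp only [e]
  obtain ⟨C, hC⟩ := hm.upper
  refine h _ ((hb.const_mul C).mono (by have := hm.1; have := hb.1; fun_prop) fun ξ => ?_)
  rw [abs_mul, abs_mul]
  refine mul_le_mul_of_nonneg_right ?_ (abs_nonneg _)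
  rw [abs_of_pos (div_pos (hm.pos ξ) (by positivity))]
  refine le_trans ?_ (le_abs_self _)
  rw [div_le_iff₀ (by positivity)]
  exact hC ξ

theorem inX_comp_sub_div {h : E5 → ℝ} (hh : InX h) (y : E5) :
    InX (fun x => h (y - x) / (1 + ‖x‖) ^ 2) := by
  refine ⟨by have := hh.1; fun_prop, lt_of_le_of_lt ?_ hh.2⟩
  refine le_trans ?_ (nrm_enorm_le_nx h)
  rw [← nrm_comp_sub _ y]
  refine nrm_mono fun x => ?_
  rw [wt_eq_ofReal, ← ofReal_norm, ← ofReal_norm, ← ENNReal.ofReal_mul (by positivity)]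
  refine ENNReal.ofReal_le_ofReal ?_
  rw [norm_div, norm_pow, Real.norm_of_nonneg (show (0 : ℝ) ≤ 1 + ‖x‖ by positivity), ← mul_div_assoc,
    div_le_iff₀ (by positivity), mul_comm]
  refine mul_le_mul_of_nonneg_left ?_ (norm_nonneg _)
  nlinarith [norm_nonneg x]

theorem enorm_integral_comp_sub_le {s h : E5 → ℝ} (hs : Measurable s) (hh : Measurable h) (y : E5) :
    ‖∫ η, s η * h (y - η)‖ₑ ≤ nx s * nx h := by
  refine (enorm_integral_le_lintegral_enorm _).trans ?_
  simp only [enorm_mul]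
  refine (lintegral_mul_le_nrm (by fun_prop) (by fun_prop)).trans ?_
  rw [nrm_comp_sub (fun x => ‖h x‖ₑ)]
  exact mul_le_mul' (nrm_enorm_le_nx _) (nrm_enorm_le_nx _)

theorem enorm_tri_high_le {r s h : E5 → ℝ} (hr : Measurable r) (hs : Measurable s)
    (hh : Measurable h) (R : ℕ) (hR : ∀ x, ‖x‖ < R → r x = 0) :
    ‖tri r s h‖ₑ ≤ ((R : ℝ≥0∞)⁻¹ ^ (1 / 4 : ℝ)) * (triConst * (nx r * nx s * nx h)) := by
  have h1 := (enorm_tri_le hr hs hh).trans (ltri_le (α := 3 / 4) (β := 1) (γ := 1) hr.enorm hs.enorm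
    hh.enorm (by norm_num) zero_le_one zero_le_one (by norm_num))
  simp only [ENNReal.rpow_one] at h1
  have h2 : nrm (fun x => wt x ^ (3 / 4 : ℝ) * ‖r x‖ₑ) ≤ (R : ℝ≥0∞)⁻¹ ^ (1 / 4 : ℝ) * nx r := by
    unfold nx
    rw [← nrm_const_mul (by fun_prop)]
    refine nrm_mono fun x => ?_
    by_cases hx : ‖x‖ < R
    · simp [hR x hx]
    · rw [← mul_assoc]
      refine mul_le_mul_left ?_ _
      have h3 : (R : ℝ≥0∞) ≤ wt x := by
        rw [wt_eq_ofReal, ← ENNReal.ofReal_natCast]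
        exact ENNReal.ofReal_le_ofReal (by push Not at hx; linarith)
      calc wt x ^ (3 / 4 : ℝ) = (wt x)⁻¹ ^ (1 / 4 : ℝ) * wt x ^ (1 : ℝ) := by
            rw [ENNReal.inv_rpow, ← ENNReal.rpow_neg, wt_rpow_mul_wt_rpow]; norm_num
        _ ≤ _ := by
            rw [ENNReal.rpow_one]; gcongr
  refine h1.trans ((mul_le_mul_right (mul_le_mul_left (mul_le_mul_left h2 _) _) _).trans
    (le_of_eq ?_))
  unfold nx; ring

theorem tendsto_tri_low {r s : ℕ → E5 → ℝ} {h : E5 → ℝ} (hr : ∀ n, InX (r n))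
    (hs : ∀ n, InX (s n)) (hh : InX h) {M : ℝ≥0∞} (hM : M < ⊤) (hrM : ∀ n, nx (r n) ≤ M)
    (hsM : ∀ n, nx (s n) ≤ M) (hw : WeakTo s 0) {A : Set E5} (hA : MeasurableSet A)
    (hAfin : volume A < ⊤) (hrA : ∀ n, ∀ x ∉ A, r n x = 0) :
    Tendsto (fun n => ‖tri (r n) (s n) h‖ₑ) atTop (𝓝 0) := by
  set S : ℕ → E5 → ℝ := fun n ξ => ∫ η, s n η * h (-ξ - η) with hS
  have mS : ∀ n, Measurable (S n) := fun n => by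
    have h1 := (hs n).1; have h2 := hh.1
    have : Measurable (fun p : E5 × E5 => s n p.2 * h (-p.1 - p.2)) := by fun_prop
    exact (this.stronglyMeasurable.integral_prod_right' (ν := volume)).measurable
  have bS : ∀ n ξ, ‖S n ξ‖ₑ ≤ M * nx h := fun n ξ =>
    (enorm_integral_comp_sub_le (hs n).1 hh.1 _).trans (mul_le_mul_left (hsM n) _)
  have tS : ∀ ξ, Tendsto (fun n => S n ξ) atTop (𝓝 0) := fun ξ => by
    have h1 := hw _ (inX_comp_sub_div hh (-ξ))
    have e : ∀ n, pair (fun ξ => (1 + ‖ξ‖) ^ 2) (s n) (fun x => h (-ξ - x) / (1 + ‖x‖) ^ 2) =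
        S n ξ := fun n => by
      unfold pair
      rw [hS]; dsimp only
      congr! 2 with η
      field_simp
    simp only [e] at h1
    simpa [pair] using h1
  have hle : ∀ n, ‖tri (r n) (s n) h‖ₑ ≤ M * nrm (A.indicator fun x => ‖S n x‖ₑ) := fun n => by
    rw [tri_eq_integral_integral (hr n) (hs n) hh]
    refine (enorm_integral_le_lintegral_enorm _).trans ?_
    have e : ∀ x, ‖r n x * ∫ η, s n η * h (-x - η)‖ₑ =
        ‖r n x‖ₑ * A.indicator (fun x => ‖S n x‖ₑ) x := fun x => by
      by_cases hx : x ∈ A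
      · rw [Set.indicator_of_mem hx, enorm_mul]
      · rw [hrA n x hx]; simp
    simp only [e]
    refine (lintegral_mul_le_nrm (hr n).1.enorm ((mS n).enorm.indicator hA)).trans ?_
    exact mul_le_mul_left ((nrm_enorm_le_nx _).trans (hrM n)) _
  refine tendsto_of_tendsto_of_tendsto_of_le_of_le tendsto_const_nhds ?_ (fun n => zero_le) hle
  rw [← mul_zero M]
  refine ENNReal.Tendsto.const_mul ?_ (Or.inr hM.ne)
  have h0 : (0 : ℝ≥0∞) = (∫⁻ _ : E5, 0) ^ (1 / 2 : ℝ) := by simp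
  rw [h0]
  refine (ENNReal.continuous_rpow_const.tendsto _).comp ?_
  refine tendsto_lintegral_of_dominated_convergence
    (A.indicator fun _ => (M * nx h) ^ (2 : ℝ)) (fun n => ?_) (fun n => ?_) ?_ ?_
  · exact ((mS n).enorm.indicator hA).pow_const _
  · refine .of_forall fun x => ?_
    by_cases hx : x ∈ A
    · simp only [Set.indicator_of_mem hx]
      exact ENNReal.rpow_le_rpow (bS n x) (by norm_num)
    · simp [Set.indicator_of_notMem hx]
  · rw [lintegral_indicator hA, setLIntegral_const]
    exact (ENNReal.mul_lt_top (ENNReal.rpow_lt_top_of_nonneg (by norm_num)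
      (ENNReal.mul_lt_top hM hh.2).ne) hAfin).ne
  · refine .of_forall fun x => ?_
    by_cases hx : x ∈ A
    · simp only [Set.indicator_of_mem hx]
      have := (ENNReal.continuous_rpow_const (y := (2 : ℝ))).tendsto _ |>.comp
        ((continuous_enorm.tendsto _).comp (tS x))
      simpa [Function.comp_def] using this
    · simp [Set.indicator_of_notMem hx]

theorem tendsto_tri_zero {r s : ℕ → E5 → ℝ} {h : E5 → ℝ} (hr : ∀ n, InX (r n))
    (hs : ∀ n, InX (s n)) (hh : InX h) {M : ℝ≥0∞} (hM : M < ⊤) (hrM : ∀ n, nx (r n) ≤ M)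
    (hsM : ∀ n, nx (s n) ≤ M) (hw : WeakTo s 0) :
    Tendsto (fun n => tri (r n) (s n) h) atTop (𝓝 0) := by
  rw [tendsto_zero_iff_enorm_tendsto_zero, ENNReal.tendsto_nhds_zero]
  intro ε hε
  have hK : triConst * (M * M * nx h) < ⊤ := ENNReal.mul_lt_top triConst_lt_top
    (ENNReal.mul_lt_top (ENNReal.mul_lt_top hM hM) hh.2)
  have hlim : Tendsto (fun R : ℕ => ((R : ℝ≥0∞)⁻¹ ^ (1 / 4 : ℝ)) * (triConst * (M * M * nx h)))
      atTop (𝓝 0) := by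
    rw [← zero_mul (triConst * (M * M * nx h))]
    refine ENNReal.Tendsto.mul_const ?_ (Or.inr hK.ne)
    have := (ENNReal.continuous_rpow_const (y := (1 / 4 : ℝ))).tendsto _ |>.comp
      ENNReal.tendsto_inv_nat_nhds_zero
    simpa [Function.comp_def] using this
  obtain ⟨R, hR⟩ := ((ENNReal.tendsto_nhds_zero.1 hlim) (ε / 2) (ENNReal.half_pos hε.ne')).exists
  set A : Set E5 := {x | ‖x‖ < R} with hA
  have mA : MeasurableSet A := measurableSet_lt measurable_norm measurable_const
  have hAfin : volume A < ⊤ := by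
    have : A = Metric.ball 0 R := by ext x; simp [hA]
    rw [this]; exact measure_ball_lt_top
  have hlo : ∀ n, InX (A.indicator (r n)) := fun n => (hr n).mono ((hr n).1.indicator mA) fun x => by
    by_cases hx : x ∈ A <;> simp [hx]
  have hhi : ∀ n, InX (Aᶜ.indicator (r n)) := fun n =>
    (hr n).mono ((hr n).1.indicator mA.compl) fun x => by by_cases hx : x ∈ A <;> simp [hx]
  have hnlo : ∀ n, nx (A.indicator (r n)) ≤ M := fun n => (nx_mono fun x => by
    by_cases hx : x ∈ A <;> simp [hx]).trans (hrM n)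
  have hnhi : ∀ n, nx (Aᶜ.indicator (r n)) ≤ M := fun n => (nx_mono fun x => by
    by_cases hx : x ∈ A <;> simp [hx]).trans (hrM n)
  have hlow := tendsto_tri_low hlo hs hh hM hnlo hsM hw mA hAfin fun n x hx => by simp [hx]
  filter_upwards [(ENNReal.tendsto_nhds_zero.1 hlow) (ε / 2) (ENNReal.half_pos hε.ne')] with n hn
  have e : tri (r n) (s n) h = tri (A.indicator (r n)) (s n) h + tri (Aᶜ.indicator (r n)) (s n) h := by
    rw [← tri_add_left (hlo n) (hhi n) (hs n) hh]
    congr 1; ext x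
    exact (congrFun (Set.indicator_self_add_compl A (r n)) x).symm
  rw [e]
  refine (enorm_add_le _ _).trans ?_
  rw [← ENNReal.add_halves ε]
  refine add_le_add hn (le_trans ?_ hR)
  refine (enorm_tri_high_le (hhi n).1 (hs n).1 hh.1 R fun x hx => by
    simp [hA, hx]).trans ?_
  gcongr
  exacts [hnhi n, hsM n]

/-- The quadratic energy `∫ m₁ a² + ∫ m₂ c²`. -/
noncomputable def en (m₁ m₂ a c : E5 → ℝ) : ℝ := pair m₁ a a + pair m₂ c c

/-- The best constant in `tri a a c ≤ C * (en a c)^{3/2}`. -/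
noncomputable def best (m₁ m₂ : E5 → ℝ) : ℝ :=
  sSup {t | ∃ a c, InX a ∧ InX c ∧ en m₁ m₂ a c ≤ 1 ∧ t = tri a a c}

theorem en_nonneg {m₁ m₂ : E5 → ℝ} (h₁ : IsDensity m₁) (h₂ : IsDensity m₂) (a c : E5 → ℝ) :
    0 ≤ en m₁ m₂ a c := add_nonneg (pair_self_nonneg h₁ a) (pair_self_nonneg h₂ c)

theorem pair_const_mul_self (m a : E5 → ℝ) (t : ℝ) :
    pair m (fun x => t * a x) (fun x => t * a x) = t ^ 2 * pair m a a := by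
  rw [pair_const_mul_left, pair_comm, pair_const_mul_left]; ring

theorem en_const_mul (m₁ m₂ a c : E5 → ℝ) (t : ℝ) :
    en m₁ m₂ (fun x => t * a x) (fun x => t * c x) = t ^ 2 * en m₁ m₂ a c := by
  unfold en; rw [pair_const_mul_self, pair_const_mul_self]; ring

theorem en_abs (m₁ m₂ a c : E5 → ℝ) :
    en m₁ m₂ (fun x => |a x|) (fun x => |c x|) = en m₁ m₂ a c := by
  simp [en, pair]

theorem exists_nx_le_of_en_le {m₁ m₂ : E5 → ℝ} (h₁ : IsDensity m₁) (h₂ : IsDensity m₂) (e : ℝ) :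
    ∃ M < (⊤ : ℝ≥0∞), ∀ a c, InX a → InX c → en m₁ m₂ a c ≤ e → nx a ≤ M ∧ nx c ≤ M := by
  obtain ⟨A, hA, hA'⟩ := exists_nx_le h₁
  obtain ⟨B, hB, hB'⟩ := exists_nx_le h₂
  refine ⟨ENNReal.ofReal (A * √e) + ENNReal.ofReal (B * √e), by simp, fun a c ha hc he => ?_⟩
  have p1 := pair_self_nonneg h₁ a
  have p2 := pair_self_nonneg h₂ c
  unfold en at he
  constructor
  · refine (hA' a ha).trans (le_trans (ENNReal.ofReal_le_ofReal ?_) le_self_add)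
    gcongr; linarith
  · refine (hB' c hc).trans (le_trans (ENNReal.ofReal_le_ofReal ?_) le_add_self)
    gcongr; linarith

theorem abs_tri_le_toReal {a b c : E5 → ℝ} (ha : InX a) (hb : InX b) (hc : InX c) {M : ℝ≥0∞}
    (hM : M < ⊤) (h1 : nx a ≤ M) (h2 : nx b ≤ M) (h3 : nx c ≤ M) :
    |tri a b c| ≤ (triConst * (M * M * M)).toReal := by
  have hT : triConst * (M * M * M) < ⊤ := ENNReal.mul_lt_top triConst_lt_top
    (ENNReal.mul_lt_top (ENNReal.mul_lt_top hM hM) hM)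
  have h := ((enorm_tri_le ha.1 hb.1 hc.1).trans (ltri_le_nx ha.1 hb.1 hc.1)).trans
    (mul_le_mul_right (mul_le_mul' (mul_le_mul' h1 h2) h3) _)
  have := ENNReal.toReal_mono hT.ne h
  rwa [toReal_enorm, Real.norm_eq_abs] at this

theorem bddAbove_best {m₁ m₂ : E5 → ℝ} (h₁ : IsDensity m₁) (h₂ : IsDensity m₂) :
    BddAbove {t | ∃ a c, InX a ∧ InX c ∧ en m₁ m₂ a c ≤ 1 ∧ t = tri a a c} := by
  obtain ⟨M, hM, h⟩ := exists_nx_le_of_en_le h₁ h₂ 1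
  refine ⟨(triConst * (M * M * M)).toReal, ?_⟩
  rintro _ ⟨a, c, ha, hc, he, rfl⟩
  obtain ⟨i, j⟩ := h a c ha hc he
  exact (le_abs_self _).trans (abs_tri_le_toReal ha ha hc hM i i j)

theorem tri_scale (a c : E5 → ℝ) (t : ℝ) :
    tri (fun x => t * a x) (fun x => t * a x) (fun x => t * c x) = t ^ 3 * tri a a c := by
  rw [tri_const_mul_left, tri_const_mul_mid, tri_const_mul_right]; ring

theorem tri_le_best {m₁ m₂ a c : E5 → ℝ} (h₁ : IsDensity m₁) (h₂ : IsDensity m₂)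
    (ha : InX a) (hc : InX c) :
    tri a a c ≤ best m₁ m₂ * (en m₁ m₂ a c * √(en m₁ m₂ a c)) := by
  rcases (en_nonneg h₁ h₂ a c).eq_or_lt with h | h
  · obtain ⟨A, hA, hA'⟩ := exists_nx_le h₁
    have p1 := pair_self_nonneg h₁ a
    have p2 := pair_self_nonneg h₂ c
    have h0 : pair m₁ a a = 0 := by unfold en at h; linarith
    have hn : nx a ≤ 0 := by simpa [h0] using hA' a ha
    have ht : ‖tri a a c‖ₑ ≤ 0 := by
      refine ((enorm_tri_le ha.1 ha.1 hc.1).trans (ltri_le_nx ha.1 ha.1 hc.1)).trans ?_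
      simp [nonpos_iff_eq_zero.1 hn]
    have : tri a a c = 0 := by simpa using ht
    rw [this, ← h]; simp
  · set n := en m₁ m₂ a c
    have hs : 0 < √n := Real.sqrt_pos.2 h
    have hsq : √n ^ 2 = n := Real.sq_sqrt h.le
    have hmem := le_csSup (bddAbove_best h₁ h₂)
      ⟨fun x => (√n)⁻¹ * a x, fun x => (√n)⁻¹ * c x, ha.const_mul _, hc.const_mul _, by
        rw [en_const_mul, inv_pow, hsq]; exact (inv_mul_cancel₀ h.ne').le, rfl⟩
    rw [tri_scale] at hmem
    change _ ≤ best m₁ m₂ at hmem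
    have e : n * √n = √n ^ 3 := by rw [pow_succ, hsq]
    rw [e, ← div_le_iff₀ (by positivity), div_eq_inv_mul, ← inv_pow]
    exact hmem

/-- A strictly positive reference function. -/
noncomputable def refFun (x : E5) : ℝ := (1 + ‖x‖) ^ (-(15 / 4) : ℝ)

theorem refFun_pos (x : E5) : 0 < refFun x := by unfold refFun; positivity

theorem measurable_refFun : Measurable refFun := by unfold refFun; fun_prop

theorem enorm_refFun (x : E5) : ‖refFun x‖ₑ = wt x ^ (-(15 / 4) : ℝ) := by
  rw [Real.enorm_of_nonneg (refFun_pos x).le, refFun, wt_eq_ofReal,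
    ENNReal.ofReal_rpow_of_pos (by positivity)]

theorem inX_refFun : InX refFun := by
  refine ⟨measurable_refFun, lt_of_le_of_lt (nrm_mono fun x => le_of_eq ?_) nrm_wt_lt_top⟩
  rw [enorm_refFun]
  have h := wt_rpow_mul_wt_rpow x 1 (-(15 / 4))
  rw [ENNReal.rpow_one] at h
  rw [h]; norm_num

theorem tri_refFun_pos : 0 < tri refFun refFun refFun := by
  have hp : ∀ p : E5 × E5, 0 < refFun p.1 * refFun p.2 * refFun (-p.1 - p.2) := fun p =>
    mul_pos (mul_pos (refFun_pos _) (refFun_pos _)) (refFun_pos _)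
  unfold tri
  rw [integral_pos_iff_support_of_nonneg (fun p => (hp p).le)
    (integrable_tri inX_refFun inX_refFun inX_refFun)]
  have : Function.support (fun p : E5 × E5 => refFun p.1 * refFun p.2 * refFun (-p.1 - p.2)) =
      Set.univ := by ext p; simpa using (hp p).ne'
  rw [this]
  exact isOpen_univ.measure_pos _ ⟨0, trivial⟩

theorem best_pos {m₁ m₂ : E5 → ℝ} (h₁ : IsDensity m₁) (h₂ : IsDensity m₂) :
    0 < best m₁ m₂ := by
  by_contra! h
  have h0 := tri_le_best h₁ h₂ inX_refFun inX_refFun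
  have h1 := en_nonneg h₁ h₂ refFun refFun
  have h2 : best m₁ m₂ * (en m₁ m₂ refFun refFun * √(en m₁ m₂ refFun refFun)) ≤ 0 :=
    mul_nonpos_of_nonpos_of_nonneg h (by positivity)
  linarith [tri_refFun_pos]

theorem lintegral_wt_eq_pair {a : E5 → ℝ} (ha : InX a) (h0 : ∀ x, 0 ≤ a x) :
    ∫⁻ x, wt x ^ (-(11 / 4) : ℝ) * (wt x ^ (1 : ℝ) * ‖a x‖ₑ) =
      ENNReal.ofReal (pair (fun ξ => (1 + ‖ξ‖) ^ 2) a refFun) := by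
  rw [pair, ofReal_integral_eq_lintegral_ofReal (integrable_pair isDensity_sq ha inX_refFun)
    (.of_forall fun x => mul_nonneg (by positivity) (mul_nonneg (h0 x) (refFun_pos x).le))]
  refine lintegral_congr fun x => ?_
  rw [← mul_assoc, wt_rpow_mul_wt_rpow, Real.enorm_of_nonneg (h0 x), wt_eq_ofReal,
    ENNReal.ofReal_rpow_of_pos (by positivity), ← ENNReal.ofReal_mul (by positivity)]
  congr 1
  rw [refFun, mul_comm (a x), ← mul_assoc]
  congr 1
  rw [← Real.rpow_natCast, ← Real.rpow_add (by positivity)]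
  norm_num

theorem enorm_tri_le_pair_refFun {a c : E5 → ℝ} (ha : InX a) (hc : InX c) (h0 : ∀ x, 0 ≤ a x)
    (h0' : ∀ x, 0 ≤ c x) {M : ℝ≥0∞} (h1 : nx a ≤ M) (h2 : nx c ≤ M) :
    ‖tri a a c‖ₑ ≤ (ENNReal.ofReal (pair (fun ξ => (1 + ‖ξ‖) ^ 2) a refFun) +
      ENNReal.ofReal (pair (fun ξ => (1 + ‖ξ‖) ^ 2) a refFun) +
      ENNReal.ofReal (pair (fun ξ => (1 + ‖ξ‖) ^ 2) c refFun)) * (M * M) := by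
  refine (enorm_tri_le ha.1 ha.1 hc.1).trans ((ltri_le_sum ha.1.enorm ha.1.enorm hc.1.enorm
    zero_le_one zero_le_one zero_le_one (by norm_num)).trans ?_)
  rw [lintegral_wt_eq_pair ha h0, lintegral_wt_eq_pair hc h0']
  simp only [ENNReal.rpow_one, mul_assoc, add_mul]
  change _ * (nx a * nx c) + _ * (nx a * nx c) + _ * (nx a * nx a) ≤ _
  gcongr

theorem exists_maximizing_seq {m₁ m₂ : E5 → ℝ} (h₁ : IsDensity m₁) (h₂ : IsDensity m₂) :
    ∃ a c : ℕ → E5 → ℝ, (∀ n, InX (a n)) ∧ (∀ n, InX (c n)) ∧ (∀ n x, 0 ≤ a n x) ∧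
      (∀ n x, 0 ≤ c n x) ∧ (∀ n, en m₁ m₂ (a n) (c n) ≤ 1) ∧
      Tendsto (fun n => tri (a n) (a n) (c n)) atTop (𝓝 (best m₁ m₂)) := by
  have hne : {t | ∃ a c, InX a ∧ InX c ∧ en m₁ m₂ a c ≤ 1 ∧ t = tri a a c}.Nonempty := by
    have h0 : InX (fun x => 0 * refFun x) := inX_refFun.const_mul 0
    exact ⟨_, _, _, h0, h0, by simp [en, pair], rfl⟩
  obtain ⟨t, -, ht, hmem⟩ := exists_seq_tendsto_sSup hne (bddAbove_best h₁ h₂)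
  choose a c ha hc he htr using hmem
  refine ⟨fun n x => |a n x|, fun n x => |c n x|, fun n => (ha n).abs, fun n => (hc n).abs,
    fun n x => abs_nonneg _, fun n x => abs_nonneg _, fun n => by rw [en_abs]; exact he n, ?_⟩
  refine tendsto_of_tendsto_of_tendsto_of_le_of_le ht tendsto_const_nhds (fun n => ?_) fun n => ?_
  · simp only [htr n]; exact tri_le_tri_abs (ha n) (ha n) (hc n)
  · exact le_csSup (bddAbove_best h₁ h₂)
      ⟨_, _, (ha n).abs, (hc n).abs, by rw [en_abs]; exact he n, rfl⟩

theorem tri_add_expand {a r c s : E5 → ℝ} (ha : InX a) (hr : InX r) (hc : InX c) (hs : InX s) :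
    tri (fun x => a x + r x) (fun x => a x + r x) (fun x => c x + s x) =
      tri a a c + 2 * tri a r c + tri a s a + 2 * tri r s a + tri r r c + tri r r s := by
  rw [tri_add_left ha hr (ha.add hr) (hc.add hs), tri_add_mid ha ha hr (hc.add hs),
    tri_add_mid hr ha hr (hc.add hs), tri_add_right ha ha hc hs, tri_add_right ha hr hc hs,
    tri_add_right hr ha hc hs, tri_add_right hr hr hc hs, tri_comm r a, tri_comm r a,
    tri_comm' ha ha hs, tri_comm' hr hs ha, tri_comm r a]
  ring

theorem en_add {m₁ m₂ a r c s : E5 → ℝ} (h₁ : IsDensity m₁) (h₂ : IsDensity m₂)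
    (ha : InX a) (hr : InX r) (hc : InX c) (hs : InX s) :
    en m₁ m₂ (fun x => a x + r x) (fun x => c x + s x) =
      en m₁ m₂ a c + 2 * (pair m₁ r a + pair m₂ s c) + en m₁ m₂ r s := by
  unfold en; rw [pair_add_self h₁ ha hr, pair_add_self h₂ hc hs]; ring

theorem WeakTo.sub_self {a : ℕ → E5 → ℝ} {a₀ : E5 → ℝ} (h : WeakTo a a₀) (ha : ∀ n, InX (a n))
    (h₀ : InX a₀) : WeakTo (fun n x => a n x - a₀ x) 0 := by
  intro b hb
  have := (h b hb).sub_const (pair (fun ξ => (1 + ‖ξ‖) ^ 2) a₀ b)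
  simp only [pair_sub_left isDensity_sq (ha _) h₀ hb]
  simpa [pair] using this

theorem WeakTo.tendsto_pair_zero {a : ℕ → E5 → ℝ} (h : WeakTo a 0) {m b : E5 → ℝ}
    (hm : IsDensity m) (hb : InX b) : Tendsto (fun n => pair m (a n) b) atTop (𝓝 0) := by
  simpa [pair] using h.tendsto_pair hm hb

theorem exists_weak_limit {m₁ m₂ : E5 → ℝ} (h₁ : IsDensity m₁) (h₂ : IsDensity m₂) :
    ∃ (a c : ℕ → E5 → ℝ) (a₀ c₀ : E5 → ℝ), (∀ n, InX (a n)) ∧ (∀ n, InX (c n)) ∧ InX a₀ ∧ InX c₀ ∧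
      (∀ n x, 0 ≤ a n x) ∧ (∀ n x, 0 ≤ c n x) ∧ (∀ n, en m₁ m₂ (a n) (c n) ≤ 1) ∧
      Tendsto (fun n => tri (a n) (a n) (c n)) atTop (𝓝 (best m₁ m₂)) ∧ WeakTo a a₀ ∧
      WeakTo c c₀ := by
  obtain ⟨a, c, ha, hc, a0, c0, he, ht⟩ := exists_maximizing_seq h₁ h₂
  obtain ⟨M, hM, hb⟩ := exists_nx_le_of_en_le h₁ h₂ 1
  have hb' := fun n => hb _ _ (ha n) (hc n) (he n)
  obtain ⟨a₀, ha₀, φ, hφ, hw⟩ := exists_weakTo ha hM fun n => (hb' n).1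
  obtain ⟨c₀, hc₀, ψ, hψ, hw'⟩ := exists_weakTo (fun n => hc (φ n)) hM fun n => (hb' (φ n)).2
  exact ⟨fun n => a (φ (ψ n)), fun n => c (φ (ψ n)), a₀, c₀, fun n => ha _, fun n => hc _, ha₀,
    hc₀, fun n => a0 _, fun n => c0 _, fun n => he _, ht.comp (hφ.comp hψ).tendsto_atTop,
    hw.comp hψ, hw'⟩

theorem exists_maximizer {m₁ m₂ : E5 → ℝ} (h₁ : IsDensity m₁) (h₂ : IsDensity m₂) :
    ∃ a c, InX a ∧ InX c ∧ 0 < en m₁ m₂ a c ∧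
      tri a a c = best m₁ m₂ * (en m₁ m₂ a c * √(en m₁ m₂ a c)) := by
  obtain ⟨a, c, a₀, c₀, ha, hc, ha₀, hc₀, a0, c0, he, ht, hwa, hwc⟩ := exists_weak_limit h₁ h₂
  obtain ⟨M, hM, hb⟩ := exists_nx_le_of_en_le h₁ h₂ 1
  have hb' := fun n => hb _ _ (ha n) (hc n) (he n)
  have hC := best_pos h₁ h₂
  refine ⟨a₀, c₀, ha₀, hc₀, ?_, ?_⟩
  · refine lt_of_le_of_ne (en_nonneg h₁ h₂ _ _) fun h => ?_
    have p1 := pair_self_nonneg h₁ a₀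
    have p2 := pair_self_nonneg h₂ c₀
    have za : a₀ =ᵐ[volume] 0 := ae_eq_zero_of_pair_self h₁ ha₀ (by unfold en at h; linarith)
    have zc : c₀ =ᵐ[volume] 0 := ae_eq_zero_of_pair_self h₂ hc₀ (by unfold en at h; linarith)
    have key : ∀ {b : ℕ → E5 → ℝ} {b₀ : E5 → ℝ}, WeakTo b b₀ → b₀ =ᵐ[volume] 0 →
        Tendsto (fun n => ENNReal.ofReal (pair (fun ξ => (1 + ‖ξ‖) ^ 2) (b n) refFun)) atTop
          (𝓝 0) := by
      intro b b₀ hw hz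
      have h1 := ENNReal.tendsto_ofReal (hw _ inX_refFun)
      have h2 : pair (fun ξ => (1 + ‖ξ‖) ^ 2) b₀ refFun = 0 := by
        unfold pair
        refine integral_eq_zero_of_ae ?_
        filter_upwards [hz] with x hx
        simp [hx]
      simpa [h2] using h1
    have h3 := ENNReal.Tendsto.mul_const (b := M * M)
      (((key hwa za).add (key hwa za)).add (key hwc zc)) (Or.inr (ENNReal.mul_lt_top hM hM).ne)
    have h4 : Tendsto (fun n => ‖tri (a n) (a n) (c n)‖ₑ) atTop (𝓝 0) :=
      tendsto_of_tendsto_of_tendsto_of_le_of_le tendsto_const_nhds (by simpa using h3)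
        (fun n => zero_le) fun n => enorm_tri_le_pair_refFun (ha n) (hc n) (a0 n) (c0 n)
          (hb' n).1 (hb' n).2
    exact hC.ne' (tendsto_nhds_unique ht (tendsto_zero_iff_enorm_tendsto_zero.2 h4))
  · set r : ℕ → E5 → ℝ := fun n x => a n x - a₀ x with hr
    set s : ℕ → E5 → ℝ := fun n x => c n x - c₀ x with hs
    have Xr : ∀ n, InX (r n) := fun n => (ha n).sub ha₀
    have Xs : ∀ n, InX (s n) := fun n => (hc n).sub hc₀
    have wr : WeakTo r 0 := hwa.sub_self ha ha₀
    have ws : WeakTo s 0 := hwc.sub_self hc hc₀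
    have ea : ∀ n, a n = fun x => a₀ x + r n x := fun n => by ext x; simp [hr]
    have ec : ∀ n, c n = fun x => c₀ x + s n x := fun n => by ext x; simp [hs]
    set θ := en m₁ m₂ a₀ c₀ with hθ
    have hθ0 : 0 ≤ θ := en_nonneg h₁ h₂ _ _
    set y : ℕ → ℝ := fun n => 1 - θ - 2 * (pair m₁ (r n) a₀ + pair m₂ (s n) c₀) with hy
    have ty : Tendsto y atTop (𝓝 (1 - θ)) := by
      have := (((wr.tendsto_pair_zero h₁ ha₀).add (ws.tendsto_pair_zero h₂ hc₀)).const_mul 2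
        ).const_sub (1 - θ)
      simpa using this
    have hen : ∀ n, en m₁ m₂ (r n) (s n) ≤ y n := fun n => by
      have := he n
      rw [ea n, ec n, en_add h₁ h₂ ha₀ (Xr n) hc₀ (Xs n)] at this
      simp only [hy]; linarith
    have hθ1 : θ ≤ 1 := by
      have := ge_of_tendsto' ty fun n => (en_nonneg h₁ h₂ (r n) (s n)).trans (hen n)
      linarith
    set K : ℝ≥0∞ := M + nx a₀ + nx c₀ with hK
    have hKt : K < ⊤ := by simp [hK, hM, ha₀.2, hc₀.2]
    have nr : ∀ n, nx (r n) ≤ K := fun n => by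
      have e : r n = fun x => a n x + (-1) * a₀ x := by ext x; simp [hr]; ring
      rw [e]
      refine (nx_add_le (ha n).1 (ha₀.const_mul _).1).trans ?_
      rw [nx_const_mul ha₀.1]
      refine le_trans ?_ le_self_add
      simpa using add_le_add_left (hb' n).1 _
    have ns : ∀ n, nx (s n) ≤ K := fun n => by
      have e : s n = fun x => c n x + (-1) * c₀ x := by ext x; simp [hs]; ring
      rw [e]
      refine (nx_add_le (hc n).1 (hc₀.const_mul _).1).trans ?_
      rw [nx_const_mul hc₀.1]
      refine le_trans ?_ (add_le_add_left le_self_add _)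
      simpa using add_le_add_left (hb' n).2 _
    have na : nx a₀ ≤ K := le_add_self.trans le_self_add
    have T1 := tendsto_tri_zero (fun _ => ha₀) Xr hc₀ hKt (fun _ => na) nr wr
    have T2 := tendsto_tri_zero (fun _ => ha₀) Xs ha₀ hKt (fun _ => na) ns ws
    have T3 := tendsto_tri_zero Xr Xs ha₀ hKt nr ns ws
    have T4 := tendsto_tri_zero Xr Xr hc₀ hKt nr nr wr
    have hle : ∀ n, tri (a n) (a n) (c n) ≤ tri a₀ a₀ c₀ + 2 * tri a₀ (r n) c₀ + tri a₀ (s n) a₀ +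
        2 * tri (r n) (s n) a₀ + tri (r n) (r n) c₀ + best m₁ m₂ * (y n * √(y n)) := fun n => by
      rw [ea n, ec n, tri_add_expand ha₀ (Xr n) hc₀ (Xs n)]
      have h5 := tri_le_best h₁ h₂ (Xr n) (Xs n)
      have h6 := en_nonneg h₁ h₂ (r n) (s n)
      have h7 : best m₁ m₂ * (en m₁ m₂ (r n) (s n) * √(en m₁ m₂ (r n) (s n))) ≤
          best m₁ m₂ * (y n * √(y n)) := by
        have h8 := hen n
        have h9 : 0 ≤ y n := h6.trans h8
        gcongr
      linarith
    have hlim := le_of_tendsto_of_tendsto' ht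
      ((((((tendsto_const_nhds (x := tri a₀ a₀ c₀)).add (T1.const_mul 2)).add T2).add
        (T3.const_mul 2)).add T4).add ((ty.mul ty.sqrt).const_mul (best m₁ m₂))) hle
    have h10 : √(1 - θ) ≤ 1 := Real.sqrt_le_one.2 (by linarith)
    have h11 : √θ ≤ 1 := Real.sqrt_le_one.2 hθ1
    have h12 : (1 - θ) * √(1 - θ) ≤ 1 - θ := mul_le_of_le_one_right (by linarith) h10
    have h13 : θ * √θ ≤ θ := mul_le_of_le_one_right hθ0 h11
    refine le_antisymm (tri_le_best h₁ h₂ ha₀ hc₀) ?_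
    nlinarith [mul_le_mul_of_nonneg_left h12 hC.le, mul_le_mul_of_nonneg_left h13 hC.le]

theorem euler_lagrange {m₁ m₂ a c φ ψ : E5 → ℝ} (h₁ : IsDensity m₁) (h₂ : IsDensity m₂)
    (ha : InX a) (hc : InX c) (hφ : InX φ) (hψ : InX ψ) (hpos : 0 < en m₁ m₂ a c)
    (heq : tri a a c = best m₁ m₂ * (en m₁ m₂ a c * √(en m₁ m₂ a c))) :
    2 * tri a φ c + tri a ψ a =
      3 * best m₁ m₂ * √(en m₁ m₂ a c) * (pair m₁ φ a + pair m₂ ψ c) := by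
  set C := best m₁ m₂
  set θ := en m₁ m₂ a c with hθ
  set p := pair m₁ φ a + pair m₂ ψ c with hp
  set q := en m₁ m₂ φ ψ with hq
  set L := 2 * tri a φ c + tri a ψ a with hL
  set n : ℝ → ℝ := fun t => θ + 2 * p * t + q * t ^ 2 with hn
  set T : ℝ → ℝ := fun t => tri a a c + L * t + (2 * tri φ ψ a + tri φ φ c) * t ^ 2 +
    tri φ φ ψ * t ^ 3 with hT
  have en_t : ∀ t : ℝ, en m₁ m₂ (fun x => a x + t * φ x) (fun x => c x + t * ψ x) = n t := by
    intro t
    rw [en_add h₁ h₂ ha (hφ.const_mul t) hc (hψ.const_mul t), en_const_mul, pair_const_mul_left,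
      pair_const_mul_left]
    simp only [hn, hp, hq, hθ]; ring
  have tri_t : ∀ t : ℝ, tri (fun x => a x + t * φ x) (fun x => a x + t * φ x)
      (fun x => c x + t * ψ x) = T t := by
    intro t
    rw [tri_add_expand ha (hφ.const_mul t) hc (hψ.const_mul t), tri_scale]
    simp only [tri_const_mul_left, tri_const_mul_mid, hT, hL]; ring
  have hmin : IsLocalMin (fun t => C * (n t * √(n t)) - T t) 0 := by
    refine .of_forall fun t => ?_
    have h3 := tri_le_best h₁ h₂ (ha.add (hφ.const_mul t)) (hc.add (hψ.const_mul t))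
    rw [en_t, tri_t] at h3
    have h4 : C * (n 0 * √(n 0)) - T 0 = 0 := by simp [hn, hT, heq]
    dsimp only; rw [h4]; linarith
  have n0 : n 0 = θ := by simp [hn]
  have dn : HasDerivAt n (2 * p) 0 := by
    have := (((hasDerivAt_id (0 : ℝ)).const_mul (2 * p)).const_add θ).add
      (((hasDerivAt_id (0 : ℝ)).pow 2).const_mul q)
    exact this.congr_deriv (by simp)
  have dT : HasDerivAt T L 0 := by
    have := ((((hasDerivAt_id (0 : ℝ)).const_mul L).const_add (tri a a c)).add
      (((hasDerivAt_id (0 : ℝ)).pow 2).const_mul (2 * tri φ ψ a + tri φ φ c))).add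
      (((hasDerivAt_id (0 : ℝ)).pow 3).const_mul (tri φ φ ψ))
    exact this.congr_deriv (by simp)
  have ds := dn.sqrt (by rw [n0]; exact hpos.ne')
  have hz := hmin.hasDerivAt_eq_zero (((dn.mul ds).const_mul C).sub dT)
  rw [n0] at hz
  have hs : 0 < √θ := Real.sqrt_pos.2 hpos
  have hsq : θ = √θ * √θ := (Real.mul_self_sqrt hpos.le).symm
  have e : θ * (2 * p / (2 * √θ)) = √θ * p := by
    conv_lhs => rw [hsq]
    rw [Real.sqrt_mul_self hs.le]
    field_simp
  rw [e] at hz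
  linarith

theorem ae_eq_of_forall_tri_eq {m a c d : E5 → ℝ} (hm : IsDensity m) (ha : InX a) (hc : InX c)
    (hd : InX d) {κ : ℝ} (h : ∀ φ, InX φ → tri φ a c = κ * pair m φ d) :
    ∀ᵐ ξ, ∫ η, a η * c (-ξ - η) = κ * (m ξ * d ξ) := by
  set G : E5 → ℝ := fun ξ => ∫ η, a η * c (-ξ - η) with hG
  have mG : Measurable G := by
    have h1 := ha.1; have h2 := hc.1
    have : Measurable (fun p : E5 × E5 => a p.2 * c (-p.1 - p.2)) := by fun_prop
    exact (this.stronglyMeasurable.integral_prod_right' (ν := volume)).measurable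
  set H : E5 → ℝ := fun ξ => G ξ - κ * (m ξ * d ξ) with hH
  have mH : Measurable H := by have := hm.1; have := hd.1; fun_prop
  set φ : E5 → ℝ := fun ξ => refFun ξ * (H ξ / (1 + |H ξ|)) with hφ
  have Xφ : InX φ := inX_refFun.mono (by have := measurable_refFun; fun_prop) fun ξ => by
    rw [hφ, abs_mul]
    refine mul_le_of_le_one_right (abs_nonneg _) ?_
    rw [abs_div, abs_of_pos (show 0 < 1 + |H ξ| by positivity), div_le_one (by positivity)]
    linarith
  have iG : Integrable (fun ξ => φ ξ * G ξ) := by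
    have := (integrable_tri Xφ ha hc).integral_prod_left
    simpa only [mul_assoc, integral_const_mul] using this
  have iP := (integrable_pair hm Xφ hd).const_mul κ
  have e : ∀ ξ, φ ξ * H ξ = φ ξ * G ξ - κ * (m ξ * (φ ξ * d ξ)) := fun ξ => by
    simp only [hH]; ring
  have hInt : ∫ ξ, φ ξ * H ξ = 0 := by
    simp only [e]
    rw [integral_sub iG iP, integral_const_mul, ← tri_eq_integral_integral Xφ ha hc, h φ Xφ, pair,
      sub_self]
  have hnn : ∀ ξ, 0 ≤ φ ξ * H ξ := fun ξ => by
    have : φ ξ * H ξ = refFun ξ * (H ξ * H ξ / (1 + |H ξ|)) := by simp only [hφ]; ring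
    rw [this]
    exact mul_nonneg (refFun_pos ξ).le (div_nonneg (mul_self_nonneg _) (by positivity))
  have hI : Integrable (fun ξ => φ ξ * H ξ) := by simp only [e]; exact iG.sub iP
  filter_upwards [(integral_eq_zero_iff_of_nonneg hnn hI).1 hInt] with ξ hξ
  have h5 : H ξ = 0 := by
    by_contra h6
    have : φ ξ * H ξ ≠ 0 := mul_ne_zero (mul_ne_zero (refFun_pos ξ).ne'
      (div_ne_zero h6 (by positivity))) h6
    exact this hξ
  exact sub_eq_zero.1 h5

theorem exists_wt_sq_mul_le {m a c d : E5 → ℝ} (hm : IsDensity m) (ha : InX a) (hc : InX c)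
    (hd : InX d) {κ : ℝ} (hκ : 0 < κ) (h : ∀ φ, InX φ → tri φ a c = κ * pair m φ d) :
    ∃ Λ < (⊤ : ℝ≥0∞), ∀ᵐ ξ, wt ξ ^ (2 : ℝ) * ‖d ξ‖ₑ ≤ Λ * ∫⁻ η, ‖a η‖ₑ * ‖c (-ξ - η)‖ₑ := by
  obtain ⟨k, hk, hlow⟩ := hm.lower
  refine ⟨ENNReal.ofReal (1 / (κ * k)), by simp, ?_⟩
  filter_upwards [ae_eq_of_forall_tri_eq hm ha hc hd h] with ξ hξ
  have h1 : ‖∫ η, a η * c (-ξ - η)‖ₑ ≤ ∫⁻ η, ‖a η‖ₑ * ‖c (-ξ - η)‖ₑ := by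
    simpa only [enorm_mul] using enorm_integral_le_lintegral_enorm (fun η => a η * c (-ξ - η))
  refine le_trans ?_ (mul_le_mul_right h1 _)
  rw [hξ, wt_eq_ofReal, ENNReal.ofReal_rpow_of_pos (by positivity), ← ofReal_norm, ← ofReal_norm,
    ← ENNReal.ofReal_mul (by positivity), ← ENNReal.ofReal_mul (by positivity)]
  refine ENNReal.ofReal_le_ofReal ?_
  rw [norm_mul, norm_mul, Real.norm_of_nonneg hκ.le, Real.norm_of_nonneg (hm.pos ξ).le,
    Real.rpow_two]
  have h2 : (1 + ‖ξ‖) ^ 2 ≤ 1 / k * m ξ := by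
    rw [one_div, ← div_eq_inv_mul, le_div_iff₀ hk, mul_comm]; exact hlow ξ
  calc (1 + ‖ξ‖) ^ 2 * ‖d ξ‖ ≤ (1 / k * m ξ) * ‖d ξ‖ := by gcongr
    _ = _ := by field_simp

theorem nrm_mono_ae {f g : E5 → ℝ≥0∞} (h : ∀ᵐ x, f x ≤ g x) : nrm f ≤ nrm g := by
  unfold nrm
  refine ENNReal.rpow_le_rpow (lintegral_mono_ae ?_) (by norm_num)
  filter_upwards [h] with x hx
  exact ENNReal.rpow_le_rpow hx (by norm_num)

/-- Young's inequality `L¹ * L² → L²`. -/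
theorem nrm_conv_le {p g : E5 → ℝ≥0∞} (hp : Measurable p) (hg : Measurable g) :
    nrm (fun ξ => ∫⁻ η, p η * g (-ξ - η)) ≤ (∫⁻ η, p η) * nrm g := by
  have hcs : ∀ ξ, (∫⁻ η, p η * g (-ξ - η)) ^ (2 : ℝ) ≤
      (∫⁻ η, p η) * ∫⁻ η, p η * g (-ξ - η) ^ (2 : ℝ) := by
    intro ξ
    have e : ∀ η, p η * g (-ξ - η) = p η ^ (1 / 2 : ℝ) * (p η ^ (1 / 2 : ℝ) * g (-ξ - η)) := by
      intro η
      rw [← mul_assoc, ← ENNReal.rpow_add_of_nonneg _ _ (by norm_num) (by norm_num)]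
      norm_num
    have h1 := lintegral_mul_le_nrm (f := fun η => p η ^ (1 / 2 : ℝ))
      (g := fun η => p η ^ (1 / 2 : ℝ) * g (-ξ - η)) (by fun_prop) (by fun_prop)
    simp only [← e] at h1
    refine (ENNReal.rpow_le_rpow h1 (by norm_num : (0 : ℝ) ≤ 2)).trans (le_of_eq ?_)
    unfold nrm
    rw [ENNReal.mul_rpow_of_nonneg _ _ (by norm_num), ← ENNReal.rpow_mul, ← ENNReal.rpow_mul]
    norm_num
    congr 1
    · refine lintegral_congr fun η => ?_
      rw [← ENNReal.rpow_ofNat, ← ENNReal.rpow_mul]; norm_num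
    · refine lintegral_congr fun η => ?_
      rw [mul_pow, ← ENNReal.rpow_ofNat, ← ENNReal.rpow_mul]; norm_num
  unfold nrm
  calc (∫⁻ ξ, (∫⁻ η, p η * g (-ξ - η)) ^ (2 : ℝ)) ^ (1 / 2 : ℝ)
      ≤ ((∫⁻ η, p η) * ((∫⁻ η, p η) * ∫⁻ x, g x ^ (2 : ℝ))) ^ (1 / 2 : ℝ) := by
        refine ENNReal.rpow_le_rpow ((lintegral_mono hcs).trans ?_) (by norm_num)
        rw [lintegral_const_mul _ (by
          exact Measurable.lintegral_prod_right' (f := fun q : E5 × E5 => p q.2 * g (-q.1 - q.2) ^ (2 : ℝ))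
            (by fun_prop))]
        refine mul_le_mul_right (le_of_eq ?_) _
        rw [lintegral_lintegral_swap (by fun_prop), ← lintegral_mul_const _ hp]
        refine lintegral_congr fun η => ?_
        rw [lintegral_const_mul _ (by fun_prop)]
        congr 1
        have e : ∀ ξ : E5, -ξ - η = -η - ξ := fun ξ => by abel
        simp only [e]
        exact lintegral_sub_left_eq_self (fun x => g x ^ (2 : ℝ)) (-η)
    _ = _ := by
        rw [← mul_assoc, ENNReal.mul_rpow_of_nonneg _ _ (by norm_num), ← sq, ← ENNReal.rpow_ofNat,
          ← ENNReal.rpow_mul]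
        norm_num

theorem nrm_wt_mul_conv_lt_top {f g : E5 → ℝ≥0∞} (hf : Measurable f) (hg : Measurable g)
    {s γ : ℝ} (hs : 0 ≤ s) (hγ : 0 ≤ γ) (hsγ : 11 / 4 ≤ 2 * s + γ)
    (hfs : nrm (fun x => wt x ^ s * f x) < ⊤) (hgs : nrm (fun x => wt x ^ s * g x) < ⊤) :
    nrm (fun ξ => wt ξ ^ (-γ) * ∫⁻ η, f η * g (-ξ - η)) < ⊤ := by
  set k : E5 → ℝ≥0∞ := fun x => wt x ^ (-(11 / 4) : ℝ) with hk
  set F : E5 → ℝ≥0∞ := fun x => wt x ^ s * f x with hF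
  set G : E5 → ℝ≥0∞ := fun x => wt x ^ s * g x with hG
  have mk : Measurable k := by fun_prop
  have mF : Measurable F := by fun_prop
  have mG : Measurable G := by fun_prop
  have hinv : ∀ (x : E5) (t : ℝ) (y : ℝ≥0∞), wt x ^ (-t) * (wt x ^ t * y) = y := by
    intro x t y
    rw [← mul_assoc, wt_rpow_mul_wt_rpow]; simp
  have hpt : ∀ ξ η, wt ξ ^ (-γ) * (f η * g (-ξ - η)) ≤ k ξ * (F η * G (-ξ - η)) +
      (k η * F η) * G (-ξ - η) + F η * (k (-ξ - η) * G (-ξ - η)) := by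
    intro ξ η
    calc wt ξ ^ (-γ) * (f η * g (-ξ - η))
        = (wt ξ ^ (-γ) * wt η ^ (-s) * wt (-ξ - η) ^ (-s)) * (F η * G (-ξ - η)) := by
          conv_lhs => rw [← hinv η s (f η), ← hinv (-ξ - η) s (g (-ξ - η))]
          simp only [hF, hG]; ring
      _ ≤ (k ξ + k η + k (-ξ - η)) * (F η * G (-ξ - η)) := by
          gcongr; exact wt_rpow_mul_le ξ η _ hγ hs hs (by linarith)
      _ = _ := by ring
  have m1 : Measurable (fun ξ => ∫⁻ η, (k η * F η) * G (-ξ - η)) :=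
    Measurable.lintegral_prod_right' (f := fun q : E5 × E5 => (k q.2 * F q.2) * G (-q.1 - q.2))
      (by fun_prop)
  have m2 : Measurable (fun ξ => ∫⁻ η, F η * (k (-ξ - η) * G (-ξ - η))) :=
    Measurable.lintegral_prod_right'
      (f := fun q : E5 × E5 => F q.2 * (k (-q.1 - q.2) * G (-q.1 - q.2))) (by fun_prop)
  have hle : ∀ ξ, wt ξ ^ (-γ) * ∫⁻ η, f η * g (-ξ - η) ≤ (nrm F * nrm G) * k ξ +
      (∫⁻ η, (k η * F η) * G (-ξ - η)) + ∫⁻ η, F η * (k (-ξ - η) * G (-ξ - η)) := by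
    intro ξ
    rw [← lintegral_const_mul _ (by fun_prop)]
    refine (lintegral_mono fun η => hpt ξ η).trans ?_
    rw [lintegral_add_left (by fun_prop), lintegral_add_left (by fun_prop),
      lintegral_const_mul _ (by fun_prop), mul_comm (nrm F * nrm G)]
    gcongr
    refine (lintegral_mul_le_nrm mF (by fun_prop)).trans (le_of_eq ?_)
    rw [nrm_comp_sub]
  have hk2 : nrm k < ⊤ := nrm_wt_lt_top
  refine (nrm_mono hle).trans_lt ?_
  refine (nrm_add_le (by fun_prop) m2).trans_lt (ENNReal.add_lt_top.2 ⟨?_, ?_⟩)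
  · refine (nrm_add_le (by fun_prop) m1).trans_lt (ENNReal.add_lt_top.2 ⟨?_, ?_⟩)
    · rw [nrm_const_mul mk]
      exact ENNReal.mul_lt_top (ENNReal.mul_lt_top hfs hgs) hk2
    · refine (nrm_conv_le (by fun_prop) mG).trans_lt (ENNReal.mul_lt_top ?_ hgs)
      exact (lintegral_mul_le_nrm mk mF).trans_lt (ENNReal.mul_lt_top hk2 hfs)
  · have e : ∀ ξ, ∫⁻ η, F η * (k (-ξ - η) * G (-ξ - η)) = ∫⁻ η, (k η * G η) * F (-ξ - η) := by
      intro ξ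
      rw [← lintegral_sub_left_eq_self _ (-ξ)]
      refine lintegral_congr fun η => ?_
      rw [sub_sub_cancel]; ring
    simp only [e]
    refine (nrm_conv_le (by fun_prop) mF).trans_lt (ENNReal.mul_lt_top ?_ hfs)
    exact (lintegral_mul_le_nrm mk mG).trans_lt (ENNReal.mul_lt_top hk2 hgs)

theorem nrm_lt_top_of_conv_le {f g h : E5 → ℝ≥0∞} (hf : Measurable f) (hg : Measurable g)
    {Λ : ℝ≥0∞} (hΛ : Λ < ⊤)
    (hle : ∀ᵐ ξ, wt ξ ^ (2 : ℝ) * h ξ ≤ Λ * ∫⁻ η, f η * g (-ξ - η))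
    {s γ : ℝ} (hs : 0 ≤ s) (hγ : 0 ≤ γ) (hsγ : 11 / 4 ≤ 2 * s + γ)
    (hfs : nrm (fun x => wt x ^ s * f x) < ⊤) (hgs : nrm (fun x => wt x ^ s * g x) < ⊤) :
    nrm (fun ξ => wt ξ ^ (2 - γ) * h ξ) < ⊤ := by
  have mc : Measurable (fun ξ => ∫⁻ η, f η * g (-ξ - η)) :=
    Measurable.lintegral_prod_right' (f := fun q : E5 × E5 => f q.2 * g (-q.1 - q.2)) (by fun_prop)
  refine lt_of_le_of_lt (nrm_mono_ae (g := fun ξ => Λ * (wt ξ ^ (-γ) * ∫⁻ η, f η * g (-ξ - η))) ?_)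
    ?_
  · filter_upwards [hle] with ξ hξ
    rw [show (2 - γ : ℝ) = -γ + 2 by ring, ← wt_rpow_mul_wt_rpow, mul_assoc, mul_left_comm Λ]
    exact mul_le_mul_right hξ _
  · rw [nrm_const_mul (by fun_prop)]
    exact ENNReal.mul_lt_top hΛ (nrm_wt_mul_conv_lt_top hf hg hs hγ hsγ hfs hgs)

theorem wt_le_mul (ξ η : E5) : wt ξ ≤ wt η * wt (-ξ - η) := by
  rw [wt_eq_ofReal, wt_eq_ofReal, wt_eq_ofReal, ← ENNReal.ofReal_mul (by positivity)]
  refine ENNReal.ofReal_le_ofReal ?_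
  have h : ‖ξ‖ ≤ ‖η‖ + ‖-ξ - η‖ := by
    have := norm_add_le η (-ξ - η)
    rwa [add_sub_cancel, norm_neg] at this
  nlinarith [mul_nonneg (norm_nonneg η) (norm_nonneg (-ξ - η))]

theorem nrm_lt_top_of_conv_le' {f g h : E5 → ℝ≥0∞} (hf : Measurable f) (hg : Measurable g)
    {Λ : ℝ≥0∞} (hΛ : Λ < ⊤)
    (hle : ∀ᵐ ξ, wt ξ ^ (2 : ℝ) * h ξ ≤ Λ * ∫⁻ η, f η * g (-ξ - η))
    {s : ℝ} (hs : 11 / 8 ≤ s)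
    (hfs : nrm (fun x => wt x ^ s * f x) < ⊤) (hgs : nrm (fun x => wt x ^ s * g x) < ⊤) :
    nrm (fun ξ => wt ξ ^ (s + 5 / 8) * h ξ) < ⊤ := by
  set σ : ℝ := s - 11 / 8 with hσ
  have hmul : ∀ (x : E5) (y : ℝ≥0∞), wt x ^ (11 / 8 : ℝ) * (wt x ^ σ * y) = wt x ^ s * y := by
    intro x y
    rw [← mul_assoc, wt_rpow_mul_wt_rpow, hσ]; congr 2; ring
  have key := nrm_lt_top_of_conv_le (f := fun x => wt x ^ σ * f x) (g := fun x => wt x ^ σ * g x)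
    (h := fun x => wt x ^ σ * h x) (s := 11 / 8) (γ := 0) (by fun_prop) (by fun_prop) hΛ ?_
    (by norm_num) le_rfl (by norm_num) (by simpa only [hmul] using hfs)
    (by simpa only [hmul] using hgs)
  · refine lt_of_le_of_lt (nrm_mono fun ξ => le_of_eq ?_) key
    rw [← mul_assoc, wt_rpow_mul_wt_rpow, hσ]; congr 2; ring
  · filter_upwards [hle] with ξ hξ
    rw [mul_left_comm]
    refine (mul_le_mul_right hξ _).trans ?_
    rw [mul_left_comm]
    refine mul_le_mul_right ?_ _
    rw [← lintegral_const_mul _ (by fun_prop)]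
    refine lintegral_mono fun η => ?_
    have h1 : wt ξ ^ σ ≤ wt η ^ σ * wt (-ξ - η) ^ σ := by
      rw [← ENNReal.mul_rpow_of_nonneg _ _ (by linarith)]
      exact ENNReal.rpow_le_rpow (wt_le_mul ξ η) (by linarith)
    exact (mul_le_mul_left h1 _).trans (le_of_eq (by ring))

theorem regularity_bootstrap {f g : E5 → ℝ≥0∞} (hf : Measurable f) (hg : Measurable g)
    {Λ Λ' : ℝ≥0∞} (hΛ : Λ < ⊤) (hΛ' : Λ' < ⊤)
    (hle : ∀ᵐ ξ, wt ξ ^ (2 : ℝ) * f ξ ≤ Λ * ∫⁻ η, f η * g (-ξ - η))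
    (hle' : ∀ᵐ ξ, wt ξ ^ (2 : ℝ) * g ξ ≤ Λ' * ∫⁻ η, f η * f (-ξ - η))
    (h1 : nrm (fun x => wt x ^ (1 : ℝ) * f x) < ⊤) (h2 : nrm (fun x => wt x ^ (1 : ℝ) * g x) < ⊤) :
    nrm (fun x => wt x ^ (17 / 4 : ℝ) * f x) < ⊤ ∧ nrm (fun x => wt x ^ (17 / 4 : ℝ) * g x) < ⊤ := by
  have low : ∀ {s γ t : ℝ}, 0 ≤ s → 0 ≤ γ → 11 / 4 ≤ 2 * s + γ → t = 2 - γ →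
      (nrm (fun x => wt x ^ s * f x) < ⊤ ∧ nrm (fun x => wt x ^ s * g x) < ⊤) →
      (nrm (fun x => wt x ^ t * f x) < ⊤ ∧ nrm (fun x => wt x ^ t * g x) < ⊤) := by
    rintro s γ t hs hγ hsγ rfl ⟨i, j⟩
    exact ⟨nrm_lt_top_of_conv_le hf hg hΛ hle hs hγ hsγ i j,
      nrm_lt_top_of_conv_le hf hf hΛ' hle' hs hγ hsγ i i⟩
  have high : ∀ {s t : ℝ}, 11 / 8 ≤ s → t = s + 5 / 8 →
      (nrm (fun x => wt x ^ s * f x) < ⊤ ∧ nrm (fun x => wt x ^ s * g x) < ⊤) →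
      (nrm (fun x => wt x ^ t * f x) < ⊤ ∧ nrm (fun x => wt x ^ t * g x) < ⊤) := by
    rintro s t hs rfl ⟨i, j⟩
    exact ⟨nrm_lt_top_of_conv_le' hf hg hΛ hle hs i j, nrm_lt_top_of_conv_le' hf hf hΛ' hle' hs i i⟩
  have h3 := low (t := 5 / 4) (γ := 3 / 4) zero_le_one (by norm_num) (by norm_num) (by norm_num)
    ⟨h1, h2⟩
  have h4 := low (t := 7 / 4) (γ := 1 / 4) (by norm_num) (by norm_num) (by norm_num) (by norm_num) h3
  have h5 := high (t := 19 / 8) (by norm_num) (by norm_num) h4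
  have h6 := high (t := 3) (by norm_num) (by norm_num) h5
  have h7 := high (t := 29 / 8) (by norm_num) (by norm_num) h6
  exact high (by norm_num) (by norm_num) h7

theorem integrable_of_nrm_lt_top {a : E5 → ℝ} (ha : Measurable a)
    (h : nrm (fun x => wt x ^ (17 / 4 : ℝ) * ‖a x‖ₑ) < ⊤) :
    Integrable (fun x => (1 + ‖x‖) * a x) := by
  refine ⟨Measurable.aestronglyMeasurable (by fun_prop), ?_⟩
  have e : ∀ x, ‖(1 + ‖x‖) * a x‖ₑ ≤
      wt x ^ (-(11 / 4) : ℝ) * (wt x ^ (17 / 4 : ℝ) * ‖a x‖ₑ) := fun x => by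
    rw [← mul_assoc, wt_rpow_mul_wt_rpow, enorm_mul, Real.enorm_of_nonneg
      (show (0 : ℝ) ≤ 1 + ‖x‖ by positivity), ← wt_eq_ofReal]
    refine mul_le_mul_left ?_ _
    conv_lhs => rw [← ENNReal.rpow_one (wt x)]
    exact wt_rpow_le_wt_rpow x (by norm_num)
  refine (lintegral_mono e).trans_lt ((lintegral_mul_le_nrm (by fun_prop) (by fun_prop)).trans_lt ?_)
  exact ENNReal.mul_lt_top nrm_wt_lt_top h

theorem exists_regular_maximizer {m₁ m₂ : E5 → ℝ} (h₁ : IsDensity m₁) (h₂ : IsDensity m₂) :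
    ∃ a c, InX a ∧ InX c ∧ 0 < en m₁ m₂ a c ∧
      tri a a c = best m₁ m₂ * (en m₁ m₂ a c * √(en m₁ m₂ a c)) ∧
      Integrable (fun x => (1 + ‖x‖) * a x) ∧ Integrable (fun x => (1 + ‖x‖) * c x) := by
  obtain ⟨a, c, ha, hc, hpos, heq⟩ := exists_maximizer h₁ h₂
  have hκ : 0 < best m₁ m₂ * √(en m₁ m₂ a c) := mul_pos (best_pos h₁ h₂) (Real.sqrt_pos.2 hpos)
  have h0 : InX (fun x => 0 * refFun x) := inX_refFun.const_mul 0
  have z1 : ∀ b d : E5 → ℝ, tri b (fun x => 0 * refFun x) d = 0 := fun b d => by simp [tri]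
  have z2 : ∀ m d : E5 → ℝ, pair m (fun x => 0 * refFun x) d = 0 := fun b d => by simp [pair]
  have e1 : ∀ φ, InX φ → tri φ a c = (3 / 2 * (best m₁ m₂ * √(en m₁ m₂ a c))) * pair m₁ φ a :=
    fun φ hφ => by
      have := euler_lagrange h₁ h₂ ha hc hφ h0 hpos heq
      rw [z1, z2] at this
      rw [tri_comm]; linarith
  have e2 : ∀ φ, InX φ → tri φ a a = (3 * (best m₁ m₂ * √(en m₁ m₂ a c))) * pair m₂ φ c :=
    fun φ hφ => by
      have := euler_lagrange h₁ h₂ ha hc h0 hφ hpos heq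
      rw [z1, z2] at this
      rw [tri_comm]; linarith
  obtain ⟨Λ, hΛ, hle⟩ := exists_wt_sq_mul_le h₁ ha hc ha (by positivity) e1
  obtain ⟨Λ', hΛ', hle'⟩ := exists_wt_sq_mul_le h₂ ha ha hc (by positivity) e2
  obtain ⟨r1, r2⟩ := regularity_bootstrap ha.1.enorm hc.1.enorm hΛ hΛ' hle hle'
    (by simpa only [ENNReal.rpow_one, nx] using ha.2) (by simpa only [ENNReal.rpow_one, nx] using hc.2)
  exact ⟨a, c, ha, hc, hpos, heq, integrable_of_nrm_lt_top ha.1 r1, integrable_of_nrm_lt_top hc.1 r2⟩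

/-- The `j`-th coordinate vector. -/
noncomputable def bv (j : Fin 5) : E5 := EuclideanSpace.single j (1 : ℝ)

theorem norm_sq_le_sum {F : Type*} [NormedAddCommGroup F] [NormedSpace ℝ F] (L : E5 →L[ℝ] F) :
    ‖L‖ ^ 2 ≤ ∑ j, ‖L (bv j)‖ ^ 2 := by
  have h : ‖L‖ ≤ √(∑ j, ‖L (bv j)‖ ^ 2) := by
    refine L.opNorm_le_bound (Real.sqrt_nonneg _) fun x => ?_
    have hx : x = ∑ j, x j • bv j := by
      ext i; simp [bv, Finset.sum_apply, Pi.single_apply]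
    calc ‖L x‖ = ‖∑ j, x j • L (bv j)‖ := by conv_lhs => rw [hx, map_sum]; simp only [map_smul]
      _ ≤ ∑ j, ‖L (bv j)‖ * ‖x j‖ := (norm_sum_le _ _).trans_eq <| by
          simp only [norm_smul, mul_comm]
      _ ≤ √(∑ j, ‖L (bv j)‖ ^ 2) * √(∑ j, ‖x j‖ ^ 2) := Real.sum_mul_le_sqrt_mul_sqrt _ _ _
      _ = _ := by rw [EuclideanSpace.norm_eq x]
  calc ‖L‖ ^ 2 ≤ √(∑ j, ‖L (bv j)‖ ^ 2) ^ 2 := by gcongr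
    _ = _ := Real.sq_sqrt (by positivity)

theorem fderiv_fourier_apply {f : E5 → ℂ} (hf : Integrable f)
    (hf' : Integrable (fun x => ‖x‖ * ‖f x‖)) (ξ : E5) (j : Fin 5) :
    fderiv ℝ (𝓕 f) ξ (bv j) = 𝓕 (fun x => -(2 * Real.pi * I) * ((x j : ℂ) * f x)) ξ := by
  rw [Real.fderiv_fourier hf hf', Real.fourier_continuousLinearMap_apply]
  · congr! 2 with x
    rw [VectorFourier.fourierSMulRight_apply]
    have h : (innerSL ℝ x) (bv j) = x j := by
      rw [innerSL_apply_apply]; simp [bv, EuclideanSpace.inner_single_right]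
    rw [h]; simp
  · refine (hf'.const_mul (2 * Real.pi * ‖innerSL ℝ (E := E5)‖)).mono'
      hf.aestronglyMeasurable.fourierSMulRight (.of_forall fun x => ?_)
    exact (VectorFourier.norm_fourierSMulRight_le _ _ _).trans_eq (by ring)

theorem InX.memLp_complex {a : E5 → ℝ} (ha : InX a) {w : E5 → ℂ} (hw : Measurable w) {C : ℝ}
    (h : ∀ x, ‖w x‖ ≤ C * (1 + ‖x‖)) : MemLp (fun x => w x * (a x : ℂ)) 2 := by
  refine (ha.memLp.norm.const_mul C).mono' ?_ (.of_forall fun x => ?_)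
  · have := ha.1
    exact Measurable.aestronglyMeasurable (by fun_prop)
  · rw [norm_mul, norm_mul, ← mul_assoc, Complex.norm_real]
    gcongr
    simpa [abs_of_nonneg (show (0 : ℝ) ≤ 1 + ‖x‖ by positivity)] using h x

theorem integrable_complex {a : E5 → ℝ} (hm : Measurable a)
    (ha : Integrable (fun x => (1 + ‖x‖) * a x)) {w : E5 → ℂ} (hw : Measurable w) {C : ℝ}
    (h : ∀ x, ‖w x‖ ≤ C * (1 + ‖x‖)) : Integrable (fun x => w x * (a x : ℂ)) := by
  refine (ha.norm.const_mul C).mono' ?_ (.of_forall fun x => ?_)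
  · exact Measurable.aestronglyMeasurable (by fun_prop)
  · rw [norm_mul, norm_mul, ← mul_assoc, Complex.norm_real]
    gcongr
    simpa [abs_of_nonneg (show (0 : ℝ) ≤ 1 + ‖x‖ by positivity)] using h x

theorem norm_coord_le (x : E5) (j : Fin 5) : ‖(x j : ℂ)‖ ≤ ‖x‖ := by
  rw [Complex.norm_real]; exact PiLp.norm_apply_le x j

theorem inH1_fourier {a : E5 → ℝ} (ha : InX a) (hi : Integrable (fun x => (1 + ‖x‖) * a x)) :
    InH1 (𝓕 (fun x => (a x : ℂ))) ∧ ∫ ξ, ‖𝓕 (fun x => (a x : ℂ)) ξ‖ ^ 2 = ∫ x, a x ^ 2 ∧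
      ∫ ξ, ‖fderiv ℝ (𝓕 (fun x => (a x : ℂ))) ξ‖ ^ 2 ≤
        ∫ x, 4 * Real.pi ^ 2 * ‖x‖ ^ 2 * a x ^ 2 := by
  set f : E5 → ℂ := fun x => (a x : ℂ) with hf_def
  have hf : Integrable f := by
    simpa using integrable_complex ha.1 hi (w := fun _ => 1) (by fun_prop) (C := 1) (by simp)
  have hf2 : MemLp f 2 := by
    simpa using ha.memLp_complex (w := fun _ => 1) (by fun_prop) (C := 1) (by simp)
  have hf' : Integrable (fun x => ‖x‖ * ‖f x‖) := by
    simpa [f] using (integrable_complex ha.1 hi (w := fun x => (‖x‖ : ℂ)) (by fun_prop) (C := 1)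
      (by simp)).norm
  have hw (j : Fin 5) (x : E5) : ‖-(2 * Real.pi * I) * (x j : ℂ)‖ ≤ 2 * Real.pi * (1 + ‖x‖) := by
    have := norm_coord_le x j
    rw [norm_mul]
    simp only [norm_neg, norm_mul, Complex.norm_ofNat, Complex.norm_real, norm_I, mul_one,
      Real.norm_of_nonneg Real.pi_pos.le]
    gcongr
    simp only [Complex.norm_real] at this
    linarith
  have hg (j : Fin 5) : Integrable (fun x => -(2 * Real.pi * I) * ((x j : ℂ) * f x)) := by
    simpa only [mul_assoc] using integrable_complex ha.1 hi (by fun_prop) (hw j)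
  have hg2 (j : Fin 5) : MemLp (fun x => -(2 * Real.pi * I) * ((x j : ℂ) * f x)) 2 := by
    simpa only [mul_assoc] using ha.memLp_complex (by fun_prop) (hw j)
  have hgF (j : Fin 5) : MemLp (fun ξ => fderiv ℝ (𝓕 f) ξ (bv j)) 2 := by
    simpa only [fderiv_fourier_apply hf hf'] using memLp_fourier (hg j) (hg2 j)
  have hsum : Integrable (fun ξ => ∑ j, ‖fderiv ℝ (𝓕 f) ξ (bv j)‖ ^ 2) :=
    integrable_finsetSum _ fun j _ => (hgF j).integrable_norm_pow (by norm_num)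
  have hmeas : AEStronglyMeasurable (fderiv ℝ (𝓕 f)) volume :=
    (measurable_fderiv ℝ (𝓕 f)).aestronglyMeasurable
  refine ⟨⟨memLp_fourier hf hf2, Real.differentiable_fourier hf hf', ?_⟩, ?_, ?_⟩
  · rw [memLp_two_iff_integrable_sq_norm hmeas]
    refine hsum.mono' (by fun_prop) (.of_forall fun ξ => ?_)
    rw [Real.norm_of_nonneg (by positivity)]
    exact norm_sq_le_sum _
  · rw [integral_norm_fourier_sq hf hf2]
    simp [f]
  · calc ∫ ξ, ‖fderiv ℝ (𝓕 f) ξ‖ ^ 2 ≤ ∫ ξ, ∑ j, ‖fderiv ℝ (𝓕 f) ξ (bv j)‖ ^ 2 :=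
          integral_mono_of_nonneg (.of_forall fun _ => by positivity) hsum
            (.of_forall fun ξ => norm_sq_le_sum _)
      _ = ∑ j, ∫ x, ‖-(2 * Real.pi * I) * ((x j : ℂ) * f x)‖ ^ 2 := by
          rw [integral_finsetSum _ fun j _ => (hgF j).integrable_norm_pow (by norm_num)]
          refine Finset.sum_congr rfl fun j _ => ?_
          simp only [fderiv_fourier_apply hf hf']
          exact integral_norm_fourier_sq (hg j) (hg2 j)
      _ = _ := by
          rw [← integral_finsetSum _ fun j _ => (hg2 j).integrable_norm_pow (by norm_num)]
          congr! 2 with x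
          rw [EuclideanSpace.real_norm_sq_eq, Finset.mul_sum, Finset.sum_mul]
          refine Finset.sum_congr rfl fun j _ => ?_
          simp [f, mul_pow, Complex.norm_real]
          ring

theorem InX.comp_neg {c : E5 → ℝ} (hc : InX c) : InX (fun x => c (-x)) :=
  InX.of_memLp (hc.1.comp measurable_neg) (by
    simpa [Function.comp_def] using
      hc.memLp.comp_measurePreserving (Measure.measurePreserving_neg volume))

theorem memLp_conv {a : E5 → ℝ} (ha : InX a) (hi : Integrable a) :
    MemLp (fun x => ∫ t, a t * a (x - t)) 2 := by
  have hm := ha.1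
  have hmeas : Measurable (fun x => ∫ t, a t * a (x - t)) := by
    have : Measurable (fun p : E5 × E5 => a p.2 * a (p.1 - p.2)) := by fun_prop
    exact (this.stronglyMeasurable.integral_prod_right' (ν := volume)).measurable
  refine ⟨hmeas.aestronglyMeasurable, ?_⟩
  rw [← nrm_enorm_eq, ← nrm_comp_sub _ 0]
  calc nrm (fun x => ‖∫ t, a t * a (0 - x - t)‖ₑ)
      ≤ nrm (fun x => ∫⁻ t, ‖a t‖ₑ * ‖a (-x - t)‖ₑ) := nrm_mono fun x => by
        simpa only [enorm_mul, zero_sub] using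
          enorm_integral_le_lintegral_enorm (μ := volume) fun t => a t * a (0 - x - t)
    _ ≤ (∫⁻ t, ‖a t‖ₑ) * nrm (fun x => ‖a x‖ₑ) := nrm_conv_le hm.enorm hm.enorm
    _ < ⊤ := ENNReal.mul_lt_top hi.2 ((nrm_enorm_le_nx a).trans_lt ha.2)

theorem pot_fourier {a c : E5 → ℝ} (ha : InX a) (hc : InX c) (hia : Integrable a)
    (hic : Integrable c) :
    Pot (𝓕 (fun x => (a x : ℂ))) (𝓕 (fun x => (c (-x) : ℂ))) = tri a a c := by
  have hA : Integrable (fun x => (a x : ℂ)) := hia.ofReal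
  have hC : Integrable (fun x => (c (-x) : ℂ)) := hic.comp_neg.ofReal
  have hC2 : MemLp (fun x => (c (-x) : ℂ)) 2 := by
    simpa using hc.comp_neg.memLp_complex (w := fun _ => 1) (by fun_prop) (C := 1) (by simp)
  have hconv : convolution (fun x => (a x : ℂ)) (fun x => (a x : ℂ))
      (ContinuousLinearMap.mul ℂ ℂ) volume = fun x => ((∫ t, a t * a (x - t) : ℝ) : ℂ) := by
    ext x
    rw [convolution, ← integral_complex_ofReal]
    simp
  have hAA : Integrable (fun x => ((∫ t, a t * a (x - t) : ℝ) : ℂ)) := by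
    rw [← hconv]; exact hA.integrable_convolution _ hA
  have hAA2 : MemLp (fun x => ((∫ t, a t * a (x - t) : ℝ) : ℂ)) 2 := (memLp_conv ha hia).ofReal
  have hF (ξ : E5) : 𝓕 (fun x => (a x : ℂ)) ξ ^ 2 =
      𝓕 (fun x => ((∫ t, a t * a (x - t) : ℝ) : ℂ)) ξ := by
    rw [← hconv, Real.fourier_mul_convolution_eq hA hA, sq]
  unfold Pot
  simp only [hF]
  have hInt : Integrable (fun x => (starRingEnd ℂ) (𝓕 (fun x => (c (-x) : ℂ)) x) *
      𝓕 (fun x => ((∫ t, a t * a (x - t) : ℝ) : ℂ)) x) :=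
    (memLp_fourier hC hC2).star.integrable_mul (memLp_fourier hAA hAA2)
  have hre := reCLM.integral_comp_comm hInt
  simp only [reCLM_apply] at hre
  rw [hre, integral_conj_fourier_mul_fourier hC hC2 hAA hAA2]
  simp only [conj_ofReal, ← ofReal_mul]
  rw [integral_complex_ofReal, ofReal_re, tri_comm' ha ha hc, tri_comm,
    tri_eq_integral_integral hc ha ha,
    ← integral_neg_eq_self]
  simp

theorem isDensity_of_pos {p q : ℝ} (hp : 0 < p) (hq : 0 < q) :
    IsDensity (fun ξ => p + q * ‖ξ‖ ^ 2) := by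
  refine ⟨by fun_prop, ⟨min p q / 2, by positivity, fun ξ => ?_⟩, ⟨p + q, fun ξ => ?_⟩⟩
  · have h1 := min_le_left p q
    have h2 := min_le_right p q
    have h0 : 0 < min p q := by positivity
    nlinarith [mul_le_mul_of_nonneg_right h2 (sq_nonneg ‖ξ‖),
      mul_nonneg h0.le (sq_nonneg (1 - ‖ξ‖))]
  · nlinarith [norm_nonneg ξ, mul_nonneg hp.le (norm_nonneg ξ), mul_nonneg hq.le (norm_nonneg ξ),
      mul_nonneg hp.le (sq_nonneg ‖ξ‖)]

/-- The Fourier density of `‖∇u‖² + ω ‖u‖²`. -/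
noncomputable def dens₁ (ω : ℝ) (ξ : E5) : ℝ := ω + 4 * Real.pi ^ 2 * ‖ξ‖ ^ 2

/-- The Fourier density of `(1/2) ‖∇v‖² + 2 ω ‖v‖²`. -/
noncomputable def dens₂ (ω : ℝ) (ξ : E5) : ℝ := 2 * ω + 2 * Real.pi ^ 2 * ‖ξ‖ ^ 2

theorem isDensity_dens₁ {ω : ℝ} (hω : 0 < ω) : IsDensity (dens₁ ω) :=
  isDensity_of_pos hω (by positivity)

theorem isDensity_dens₂ {ω : ℝ} (hω : 0 < ω) : IsDensity (dens₂ ω) :=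
  isDensity_of_pos (by positivity) (by positivity)

/-- The quadratic part `K + ω M` of the action. -/
noncomputable def quad (ω : ℝ) (u v : E5 → ℂ) : ℝ := Kin u v + ω * Mass u v

theorem InX.integrable_sq {a : E5 → ℝ} (ha : InX a) : Integrable (fun x => a x ^ 2) := by
  have hm := ha.1
  refine (integrable_pair isDensity_sq ha ha).mono' (by fun_prop) (.of_forall fun x => ?_)
  rw [Real.norm_of_nonneg (by positivity)]
  nlinarith [norm_nonneg x, mul_nonneg (norm_nonneg x) (sq_nonneg (a x)),
    mul_nonneg (sq_nonneg ‖x‖) (sq_nonneg (a x))]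

theorem InX.integrable_norm_sq_mul {a : E5 → ℝ} (ha : InX a) (k : ℝ) :
    Integrable (fun x => k * ‖x‖ ^ 2 * a x ^ 2) := by
  have hm := ha.1
  simp only [mul_assoc]
  refine Integrable.const_mul ?_ k
  refine (integrable_pair isDensity_sq ha ha).mono' (by fun_prop) (.of_forall fun x => ?_)
  rw [Real.norm_of_nonneg (by positivity)]
  nlinarith [norm_nonneg x, mul_nonneg (norm_nonneg x) (sq_nonneg (a x)),
    mul_nonneg (sq_nonneg ‖x‖) (sq_nonneg (a x)), sq_nonneg (a x)]

theorem en_dens_eq (ω : ℝ) {a c : E5 → ℝ} (ha : InX a) (hc : InX c) :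
    en (dens₁ ω) (dens₂ ω) a c =
      ((∫ x, 4 * Real.pi ^ 2 * ‖x‖ ^ 2 * a x ^ 2) +
        1 / 2 * ∫ x, 4 * Real.pi ^ 2 * ‖x‖ ^ 2 * c x ^ 2) +
      ω * ((∫ x, a x ^ 2) + 2 * ∫ x, c x ^ 2) := by
  have h1 : pair (dens₁ ω) a a =
      (∫ x, 4 * Real.pi ^ 2 * ‖x‖ ^ 2 * a x ^ 2) + ω * ∫ x, a x ^ 2 := by
    rw [← integral_const_mul, ← integral_add (ha.integrable_norm_sq_mul _)
      (ha.integrable_sq.const_mul _)]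
    unfold pair dens₁
    congr! 2 with x
    ring
  have h2 : pair (dens₂ ω) c c =
      1 / 2 * (∫ x, 4 * Real.pi ^ 2 * ‖x‖ ^ 2 * c x ^ 2) + 2 * ω * ∫ x, c x ^ 2 := by
    rw [← integral_const_mul, ← integral_const_mul, ← integral_add
      ((hc.integrable_norm_sq_mul _).const_mul _) (hc.integrable_sq.const_mul _)]
    unfold pair dens₂
    congr! 2 with x
    ring
  rw [en, h1, h2]; ring

theorem eq_zero_of_integral_norm_sq {u : E5 → ℂ} (hu : InH1 u) (h : ∫ x, ‖u x‖ ^ 2 = 0) :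
    u = 0 := by
  have h1 := (integral_eq_zero_iff_of_nonneg (fun x => by positivity)
    (hu.1.integrable_norm_pow (by norm_num))).1 h
  refine (hu.2.1.continuous.ae_eq_iff_eq volume continuous_zero).1 ?_
  filter_upwards [h1] with x hx
  simpa using hx

theorem quad_pos {ω : ℝ} (hω : 0 < ω) {u v : E5 → ℂ} (hu : InH1 u) (hv : InH1 v)
    (h : Nontriv2 u v) : 0 < quad ω u v := by
  have e1 : 0 ≤ ∫ x, ‖u x‖ ^ 2 := integral_nonneg fun _ => by positivity
  have e2 : 0 ≤ ∫ x, ‖v x‖ ^ 2 := integral_nonneg fun _ => by positivity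
  have e3 : 0 ≤ ∫ x, ‖fderiv ℝ u x‖ ^ 2 := integral_nonneg fun _ => by positivity
  have e4 : 0 ≤ ∫ x, ‖fderiv ℝ v x‖ ^ 2 := integral_nonneg fun _ => by positivity
  have hm : 0 < Mass u v := by
    unfold Mass
    by_contra hcon
    exact h ⟨eq_zero_of_integral_norm_sq hu (by linarith),
      eq_zero_of_integral_norm_sq hv (by linarith)⟩
  unfold quad Kin
  have := mul_pos hω hm
  linarith

theorem inH1_smul {u : E5 → ℂ} (hu : InH1 u) (t : ℝ) : InH1 (fun x => t • u x) := by
  refine ⟨hu.1.const_smul t, hu.2.1.const_smul t, ?_⟩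
  have : (fun x => fderiv ℝ (fun x => t • u x) x) = fun x => t • fderiv ℝ u x := by
    ext1 x; exact fderiv_fun_const_smul (hu.2.1 x) t
  rw [this]
  exact hu.2.2.const_smul t

theorem quad_smul (ω t : ℝ) {u v : E5 → ℂ} (hu : InH1 u) (hv : InH1 v) :
    quad ω (fun x => t • u x) (fun x => t • v x) = t ^ 2 * quad ω u v := by
  have h1 (x : E5) : fderiv ℝ (fun x => t • u x) x = t • fderiv ℝ u x :=
    fderiv_fun_const_smul (hu.2.1 x) t
  have h2 (x : E5) : fderiv ℝ (fun x => t • v x) x = t • fderiv ℝ v x :=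
    fderiv_fun_const_smul (hv.2.1 x) t
  unfold quad Kin Mass
  simp only [h1, h2, norm_smul, mul_pow, integral_const_mul, Real.norm_eq_abs, sq_abs]
  ring

theorem pot_smul (t : ℝ) (u v : E5 → ℂ) :
    Pot (fun x => t • u x) (fun x => t • v x) = t ^ 3 * Pot u v := by
  unfold Pot
  rw [← integral_const_mul]
  congr! 2 with x
  rw [← re_ofReal_mul]
  congr 1
  simp only [real_smul, map_mul, conj_ofReal, ofReal_pow]
  ring

theorem exists_on_nehari {ω : ℝ} (hω : 0 < ω) {u v : E5 → ℂ} (hu : InH1 u) (hv : InH1 v)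
    (hP : 0 < Pot u v) : ∃ u' v', InH1 u' ∧ InH1 v' ∧ Nontriv2 u' v' ∧ Nehari ω u' v' = 0 ∧
      Sfun ω u' v' = quad ω u v ^ 3 / (54 * Pot u v ^ 2) := by
  have hne : Nontriv2 u v := by
    rintro ⟨rfl, rfl⟩
    simp [Pot] at hP
  have hN := quad_pos hω hu hv hne
  set t := quad ω u v / (3 * Pot u v) with ht
  have ht0 : 0 < t := by positivity
  have hq := quad_smul ω t hu hv
  have hp := pot_smul t u v
  refine ⟨_, _, inH1_smul hu t, inH1_smul hv t, ?_, ?_, ?_⟩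
  · rintro ⟨h1, h2⟩
    refine hne ⟨?_, ?_⟩
    · ext x; simpa [ht0.ne'] using congrFun h1 x
    · ext x; simpa [ht0.ne'] using congrFun h2 x
  · unfold Nehari
    unfold quad at hq
    rw [hq, hp, ht]
    change _ * quad ω u v - _ = 0
    field_simp
    ring
  · have : Sfun ω (fun x => t • u x) (fun x => t • v x) =
        1 / 2 * (t ^ 2 * quad ω u v) - t ^ 3 * Pot u v := by
      rw [← hq, ← hp]; unfold Sfun quad; ring
    rw [this, ht]
    field_simp
    ring

theorem exists_candidate {ω : ℝ} (hω : 0 < ω) : ∃ u v, InH1 u ∧ InH1 v ∧ Nontriv2 u v ∧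
    Nehari ω u v = 0 ∧ Sfun ω u v ≤ 1 / (54 * best (dens₁ ω) (dens₂ ω) ^ 2) := by
  have d₁ := isDensity_dens₁ hω
  have d₂ := isDensity_dens₂ hω
  obtain ⟨a, c, ha, hc, he, htri, hia, hic⟩ := exists_regular_maximizer d₁ d₂
  have hb := best_pos d₁ d₂
  have hi' {f : E5 → ℝ} (hf : Measurable f) (h : Integrable (fun x => (1 + ‖x‖) * f x)) :
      Integrable f := by
    refine h.mono hf.aestronglyMeasurable (.of_forall fun x => ?_)
    rw [norm_mul, Real.norm_of_nonneg (show (0 : ℝ) ≤ 1 + ‖x‖ by positivity)]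
    nlinarith [norm_nonneg x, norm_nonneg (f x)]
  have hic' : Integrable (fun x => (1 + ‖x‖) * c (-x)) := by simpa using hic.comp_neg
  obtain ⟨hu, hu1, hu2⟩ := inH1_fourier ha hia
  obtain ⟨hv, hv1, hv2⟩ := inH1_fourier hc.comp_neg hic'
  have hpot := pot_fourier ha hc (hi' ha.1 hia) (hi' hc.1 hic)
  set u := 𝓕 (fun x => (a x : ℂ))
  set v := 𝓕 (fun x => (c (-x) : ℂ))
  set e := en (dens₁ ω) (dens₂ ω) a c with hedef
  set B := best (dens₁ ω) (dens₂ ω)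
  have hP : 0 < Pot u v := by rw [hpot, htri]; positivity
  have hq : quad ω u v ≤ e := by
    have n1 := integral_neg_eq_self (fun x => c x ^ 2) volume
    have n2 := integral_neg_eq_self (fun x => 4 * Real.pi ^ 2 * ‖x‖ ^ 2 * c x ^ 2) volume
    simp only [norm_neg] at n1 n2
    rw [hedef, en_dens_eq ω ha hc]
    unfold quad Kin Mass
    rw [hu1, hv1, n1]
    linarith
  obtain ⟨u', v', h1, h2, h3, h4, h5⟩ := exists_on_nehari hω hu hv hP
  refine ⟨u', v', h1, h2, h3, h4, ?_⟩
  have hne : Nontriv2 u v := by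
    rintro ⟨h, -⟩
    simp [Pot, h] at hP
  have hN := quad_pos hω hu hv hne
  rw [h5]
  calc quad ω u v ^ 3 / (54 * Pot u v ^ 2) ≤ e ^ 3 / (54 * Pot u v ^ 2) := by gcongr
    _ = e ^ 3 / (54 * (B ^ 2 * (e ^ 2 * √e ^ 2))) := by rw [hpot, htri]; ring
    _ = 1 / (54 * B ^ 2) := by
      rw [Real.sq_sqrt he.le]; field_simp

/-- Compactly supported differentiable real functions with square integrable gradient. -/
structure IsTest (w : E5 → ℝ) : Prop where
  differentiable : Differentiable ℝ w
  hasCompactSupport : HasCompactSupport w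
  memLp_fderiv : MemLp (fderiv ℝ w) 2

theorem norm_sq_eq_sum (L : E5 →L[ℝ] ℝ) : ∑ j, ‖L (bv j)‖ ^ 2 = ‖L‖ ^ 2 := by
  have h (x : E5) : L x = inner ℝ ((InnerProductSpace.toDual ℝ E5).symm L) x := by simp
  simp only [h, bv, EuclideanSpace.inner_single_right]
  rw [← LinearIsometryEquiv.norm_map (InnerProductSpace.toDual ℝ E5).symm L,
    EuclideanSpace.real_norm_sq_eq]
  simp

theorem norm_fourier_ofReal_neg (w : E5 → ℝ) (ξ : E5) :
    ‖𝓕 (fun x => (w x : ℂ)) (-ξ)‖ = ‖𝓕 (fun x => (w x : ℂ)) ξ‖ := by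
  rw [← Complex.norm_conj (𝓕 (fun x => (w x : ℂ)) ξ), Real.fourier_eq, Real.fourier_eq,
    ← integral_conj]
  congr! 3 with x
  simp [Circle.smul_def, ← Circle.coe_inv_eq_conj, AddChar.map_neg_eq_inv]

theorem IsTest.integrable_pow {w : E5 → ℝ} (hw : IsTest w) (n : ℕ) (hn : n ≠ 0) : Integrable (fun x => w x ^ n) := by
  refine (hw.differentiable.continuous.pow n).integrable_of_hasCompactSupport ?_
  exact hw.hasCompactSupport.comp_left (g := fun y => y ^ n) (by simp [hn])

theorem IsTest.integrable {w : E5 → ℝ} (hw : IsTest w) : Integrable (fun x => (w x : ℂ)) := by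
  simpa using (hw.integrable_pow 1 one_ne_zero).ofReal (𝕜 := ℂ)

theorem IsTest.memLp_two {w : E5 → ℝ} (hw : IsTest w) : MemLp (fun x => (w x : ℂ)) 2 := by
  refine MemLp.ofReal ?_
  rw [memLp_two_iff_integrable_sq hw.differentiable.continuous.aestronglyMeasurable]
  exact hw.integrable_pow 2 two_ne_zero

theorem IsTest.integrable_sq {w : E5 → ℝ} (hw : IsTest w) : Integrable (fun x => (w x : ℂ) ^ 2) := by
  simpa using (hw.integrable_pow 2 two_ne_zero).ofReal (𝕜 := ℂ)

theorem IsTest.memLp_sq {w : E5 → ℝ} (hw : IsTest w) : MemLp (fun x => (w x : ℂ) ^ 2) 2 := by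
  have : MemLp (fun x => w x ^ 2) 2 := by
    refine (memLp_two_iff_integrable_sq
      (hw.differentiable.continuous.pow 2).aestronglyMeasurable).2 ?_
    simpa [← pow_mul] using hw.integrable_pow 4 (by norm_num)
  simpa using this.ofReal (K := ℂ)

theorem IsTest.fderiv_ofReal {w : E5 → ℝ} (hw : IsTest w) (x : E5) :
    fderiv ℝ (fun x => (w x : ℂ)) x = ofRealCLM.comp (fderiv ℝ w x) :=
  (ofRealCLM.hasFDerivAt.comp x (hw.differentiable x).hasFDerivAt).fderiv

theorem IsTest.integrable_fderiv {w : E5 → ℝ} (hw : IsTest w) : Integrable (fderiv ℝ w) := by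
  have hK : HasCompactSupport (fun x => ‖fderiv ℝ w x‖) :=
    (hw.hasCompactSupport.fderiv (𝕜 := ℝ)).norm
  refine (integrable_norm_iff hw.memLp_fderiv.1).1 ?_
  refine (integrableOn_iff_integrable_of_support_subset
    (subset_tsupport (fun x => ‖fderiv ℝ w x‖))).1 ?_
  have : IsFiniteMeasure (volume.restrict (tsupport (fun x => ‖fderiv ℝ w x‖))) :=
    ⟨by simpa using hK.isCompact.measure_lt_top⟩
  exact (hw.memLp_fderiv.norm.restrict _).integrable (by norm_num)

theorem IsTest.fourier_fderiv_apply {w : E5 → ℝ} (hw : IsTest w) (ξ : E5) (j : Fin 5) :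
    𝓕 (fun x => (fderiv ℝ w x (bv j) : ℂ)) ξ =
      2 * Real.pi * I * ((ξ j : ℂ) * 𝓕 (fun x => (w x : ℂ)) ξ) := by
  have hd : Integrable (fderiv ℝ (fun x => (w x : ℂ))) := by
    refine hw.integrable_fderiv.norm.mono' (measurable_fderiv ℝ _).aestronglyMeasurable
      (.of_forall fun x => ?_)
    rw [hw.fderiv_ofReal]
    exact (ContinuousLinearMap.opNorm_comp_le _ _).trans_eq (by simp)
  have h := Real.fourier_fderiv hw.integrable
    (ofRealCLM.differentiable.comp hw.differentiable) hd
  have h2 := congrArg (fun L => L (bv j)) (congrFun h ξ)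
  simp only [Real.fourier_continuousLinearMap_apply hd, hw.fderiv_ofReal] at h2
  rw [VectorFourier.fourierSMulRight_apply] at h2
  have h3 : (innerSL ℝ ξ) (bv j) = ξ j := by
    rw [innerSL_apply_apply]; simp [bv, EuclideanSpace.inner_single_right]
  refine Eq.trans ?_ (h2.trans ?_)
  · rfl
  · simp [h3]

theorem IsTest.fourier {w : E5 → ℝ} (hw : IsTest w) :
    InX (fun ξ => ‖𝓕 (fun x => (w x : ℂ)) ξ‖) ∧
    (∫ ξ, ‖𝓕 (fun x => (w x : ℂ)) ξ‖ ^ 2 = ∫ x, w x ^ 2) ∧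
    ∫ ξ, 4 * Real.pi ^ 2 * ‖ξ‖ ^ 2 * ‖𝓕 (fun x => (w x : ℂ)) ξ‖ ^ 2 =
      ∫ x, ‖fderiv ℝ w x‖ ^ 2 := by
  set a := fun ξ => ‖𝓕 (fun x => (w x : ℂ)) ξ‖ with ha
  have hcont : Continuous (𝓕 (fun x => (w x : ℂ))) :=
    VectorFourier.fourierIntegral_continuous Real.continuous_fourierChar
      (by exact continuous_inner) hw.integrable
  have hac : Continuous a := hcont.norm
  have hd (j : Fin 5) : Integrable (fun x => (fderiv ℝ w x (bv j) : ℂ)) :=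
    (hw.integrable_fderiv.apply_continuousLinearMap (bv j)).ofReal
  have hd2 (j : Fin 5) : MemLp (fun x => (fderiv ℝ w x (bv j) : ℂ)) 2 :=
    (hw.memLp_fderiv.continuousLinearMap_comp (ContinuousLinearMap.apply ℝ ℝ (bv j))).ofReal
  have hF (ξ : E5) (j : Fin 5) : ‖𝓕 (fun x => (fderiv ℝ w x (bv j) : ℂ)) ξ‖ ^ 2 =
      4 * Real.pi ^ 2 * (ξ j) ^ 2 * a ξ ^ 2 := by
    rw [hw.fourier_fderiv_apply]
    simp [a, mul_pow, Complex.norm_real]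
    ring
  have hInt (j : Fin 5) : Integrable (fun ξ : E5 => 4 * Real.pi ^ 2 * (ξ j) ^ 2 * a ξ ^ 2) := by
    simpa only [hF] using (memLp_fourier (hd j) (hd2 j)).integrable_norm_pow (by norm_num)
  have hsum (ξ : E5) : 4 * Real.pi ^ 2 * ‖ξ‖ ^ 2 * a ξ ^ 2 =
      ∑ j, 4 * Real.pi ^ 2 * (ξ j) ^ 2 * a ξ ^ 2 := by
    rw [EuclideanSpace.real_norm_sq_eq, Finset.mul_sum, Finset.sum_mul]
  have hI : Integrable (fun ξ => 4 * Real.pi ^ 2 * ‖ξ‖ ^ 2 * a ξ ^ 2) := by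
    simp only [hsum]
    exact integrable_finsetSum _ fun j _ => hInt j
  have hI0 : Integrable (fun ξ => a ξ ^ 2) :=
    (memLp_fourier hw.integrable hw.memLp_two).integrable_norm_pow (by norm_num)
  refine ⟨InX.of_memLp hac.measurable ?_, ?_, ?_⟩
  · refine (memLp_two_iff_integrable_sq (by fun_prop)).2 ?_
    refine ((hI0.const_mul 2).add (hI.const_mul 2)).mono' (by fun_prop) (.of_forall fun ξ => ?_)
    rw [Real.norm_of_nonneg (by positivity)]
    have h3 : (1 : ℝ) ≤ 4 * Real.pi ^ 2 := by nlinarith [Real.pi_gt_three]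
    have h4 := mul_le_mul_of_nonneg_right h3 (show 0 ≤ ‖ξ‖ ^ 2 * a ξ ^ 2 by positivity)
    simp only [Pi.add_apply]
    nlinarith [mul_nonneg (sq_nonneg (1 - ‖ξ‖)) (sq_nonneg (a ξ))]
  · rw [integral_norm_fourier_sq hw.integrable hw.memLp_two]
    simp
  · change ∫ ξ, 4 * Real.pi ^ 2 * ‖ξ‖ ^ 2 * a ξ ^ 2 = _
    simp only [hsum, ← norm_sq_eq_sum]
    rw [integral_finsetSum _ fun j _ => hInt j, integral_finsetSum]
    · refine Finset.sum_congr rfl fun j _ => ?_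
      simp only [← hF]
      rw [integral_norm_fourier_sq (hd j) (hd2 j)]
      simp
    · intro j _
      simpa using (hd2 j).integrable_norm_pow (by norm_num)

theorem IsTest.fourier_sq {w : E5 → ℝ} (hw : IsTest w) (ξ : E5) :
    𝓕 (fun x => (w x : ℂ) ^ 2) ξ = ∫ η, (starRingEnd ℂ) (𝓕 (fun x => (w x : ℂ)) η) *
      𝓕 (fun x => (w x : ℂ)) (η + ξ) := by
  set g : E5 → ℂ := fun x => Real.fourierChar (-inner ℝ x ξ) • (w x : ℂ) with hg
  have hgm : Continuous g := by
    have := hw.differentiable.continuous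
    have := Real.continuous_fourierChar
    fun_prop
  have hn (x : E5) : ‖g x‖ = ‖(w x : ℂ)‖ := by simp [g, Circle.norm_smul]
  have hgi : Integrable g :=
    hw.integrable.norm.mono' hgm.aestronglyMeasurable (.of_forall fun x => (hn x).le)
  have hg2 : MemLp g 2 :=
    hw.memLp_two.of_le hgm.aestronglyMeasurable (.of_forall fun x => (hn x).le)
  have hgF (η : E5) : 𝓕 g η = 𝓕 (fun x => (w x : ℂ)) (η + ξ) := by
    rw [Real.fourier_eq, Real.fourier_eq]
    congr! 2 with x
    rw [hg, ← mul_smul, ← AddChar.map_add_eq_mul, inner_add_right, neg_add]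
  simp only [← hgF]
  rw [integral_conj_fourier_mul_fourier hw.integrable hw.memLp_two hgi hg2, Real.fourier_eq]
  congr! 2 with x
  simp [g, Circle.smul_def]
  ring

theorem IsTest.integral_mul_sq_le {w z : E5 → ℝ} (hw : IsTest w) (hz : IsTest z) :
    ∫ x, z x * w x ^ 2 ≤ tri (fun ξ => ‖𝓕 (fun x => (w x : ℂ)) ξ‖)
      (fun ξ => ‖𝓕 (fun x => (w x : ℂ)) ξ‖) (fun ξ => ‖𝓕 (fun x => (z x : ℂ)) ξ‖) := by
  have ha := hw.fourier.1
  have hc := hz.fourier.1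
  set a := fun ξ => ‖𝓕 (fun x => (w x : ℂ)) ξ‖ with ha_def
  set c := fun ξ => ‖𝓕 (fun x => (z x : ℂ)) ξ‖ with hc_def
  have key := integral_conj_fourier_mul_fourier hz.integrable hz.memLp_two
    hw.integrable_sq hw.memLp_sq
  have hle (ξ : E5) : ‖𝓕 (fun x => (w x : ℂ) ^ 2) ξ‖ ≤ ∫ η, a η * a (-ξ - η) := by
    rw [hw.fourier_sq]
    refine (norm_integral_le_integral_norm _).trans_eq ?_
    congr! 2 with η
    rw [norm_mul, Complex.norm_conj, ← norm_fourier_ofReal_neg w (η + ξ)]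
    congr! 3
    abel
  have hInt : Integrable (fun ξ => c ξ * ∫ η, a η * a (-ξ - η)) := by
    have := (integrable_tri hc ha ha).integral_prod_left
    simpa only [mul_assoc, integral_const_mul] using this
  rw [tri_comm' ha ha hc, tri_comm, tri_eq_integral_integral hc ha ha]
  calc ∫ x, z x * w x ^ 2 ≤ ‖((∫ x, z x * w x ^ 2 : ℝ) : ℂ)‖ := by
        rw [Complex.norm_real]; exact le_abs_self _
    _ = ‖∫ ξ, (starRingEnd ℂ) (𝓕 (fun x => (z x : ℂ)) ξ) * 𝓕 (fun x => (w x : ℂ) ^ 2) ξ‖ := by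
        rw [key, ← integral_complex_ofReal]; simp
    _ ≤ ∫ ξ, ‖(starRingEnd ℂ) (𝓕 (fun x => (z x : ℂ)) ξ) * 𝓕 (fun x => (w x : ℂ) ^ 2) ξ‖ :=
        norm_integral_le_integral_norm _
    _ ≤ _ := by
        refine integral_mono_of_nonneg (.of_forall fun _ => by positivity) hInt
          (.of_forall fun ξ => ?_)
        dsimp only
        rw [norm_mul, Complex.norm_conj]
        exact mul_le_mul_of_nonneg_left (hle ξ) (norm_nonneg _)

theorem IsTest.gagliardo {ω : ℝ} (hω : 0 < ω) {w z : E5 → ℝ} (hw : IsTest w) (hz : IsTest z)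
    {Q : ℝ} (hQ : ((∫ x, ‖fderiv ℝ w x‖ ^ 2) + 1 / 2 * ∫ x, ‖fderiv ℝ z x‖ ^ 2) +
      ω * ((∫ x, w x ^ 2) + 2 * ∫ x, z x ^ 2) ≤ Q) :
    ∫ x, z x * w x ^ 2 ≤ best (dens₁ ω) (dens₂ ω) * (Q * √Q) := by
  have d₁ := isDensity_dens₁ hω
  have d₂ := isDensity_dens₂ hω
  obtain ⟨hw1, hw2, hw3⟩ := hw.fourier
  obtain ⟨hz1, hz2, hz3⟩ := hz.fourier
  refine (hw.integral_mul_sq_le hz).trans ((tri_le_best d₁ d₂ hw1 hz1).trans ?_)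
  have hb := best_pos d₁ d₂
  have he := en_nonneg d₁ d₂ (fun ξ => ‖𝓕 (fun x => (w x : ℂ)) ξ‖)
    (fun ξ => ‖𝓕 (fun x => (z x : ℂ)) ξ‖)
  have : en (dens₁ ω) (dens₂ ω) (fun ξ => ‖𝓕 (fun x => (w x : ℂ)) ξ‖)
      (fun ξ => ‖𝓕 (fun x => (z x : ℂ)) ξ‖) ≤ Q := by
    rwa [en_dens_eq ω hw1 hz1, hw2, hw3, hz2, hz3]
  have := he.trans this
  gcongr

theorem exists_cutoff : ∃ (χ : E5 → ℝ) (C : ℝ), 0 ≤ C ∧ Differentiable ℝ χ ∧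
    HasCompactSupport χ ∧ (∀ x, 0 ≤ χ x) ∧ (∀ x, χ x ≤ 1) ∧ χ =ᶠ[𝓝 0] 1 ∧
    ∀ x, ‖fderiv ℝ χ x‖ ≤ C := by
  let χ : ContDiffBump (0 : E5) := ⟨1, 2, one_pos, one_lt_two⟩
  have hd : ContDiff ℝ 1 χ := χ.contDiff
  obtain ⟨C, hC⟩ := (hd.continuous_fderiv one_ne_zero).bounded_above_of_compact_support
    (χ.hasCompactSupport.fderiv (𝕜 := ℝ))
  exact ⟨χ, C, (norm_nonneg _).trans (hC 0), hd.differentiable one_ne_zero, χ.hasCompactSupport,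
    fun x => χ.nonneg, fun x => χ.le_one, χ.eventuallyEq_one, hC⟩

/-- A differentiable regularization of the modulus. -/
noncomputable def regMod (ε : ℝ) (u : E5 → ℂ) (x : E5) : ℝ := √(‖u x‖ ^ 2 + ε ^ 2) - ε

theorem regMod_nonneg {ε : ℝ} (u : E5 → ℂ) (x : E5) : 0 ≤ regMod ε u x :=
  sub_nonneg.2 (Real.le_sqrt_of_sq_le (by nlinarith [sq_nonneg ‖u x‖]))

theorem regMod_le {ε : ℝ} (hε : 0 ≤ ε) (u : E5 → ℂ) (x : E5) : regMod ε u x ≤ ‖u x‖ := by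
  unfold regMod
  rw [sub_le_iff_le_add]
  refine Real.sqrt_le_left (by positivity) |>.2 ?_
  nlinarith [mul_nonneg (norm_nonneg (u x)) hε]

theorem exists_hasFDerivAt_regMod {ε : ℝ} (hε : 0 < ε) {u : E5 → ℂ} (hu : Differentiable ℝ u)
    (x : E5) : ∃ L : E5 →L[ℝ] ℝ, HasFDerivAt (regMod ε u) L x ∧ ‖L‖ ≤ ‖fderiv ℝ u x‖ := by
  have h1 := ((hu x).hasFDerivAt.norm_sq.add_const (ε ^ 2)).sqrt (by positivity)
  refine ⟨_, h1.sub_const ε, ?_⟩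
  have hle : ‖u x‖ ≤ √(‖u x‖ ^ 2 + ε ^ 2) := Real.le_sqrt_of_sq_le (by nlinarith [sq_nonneg ε])
  have hpos : 0 < √(‖u x‖ ^ 2 + ε ^ 2) := Real.sqrt_pos.2 (by positivity)
  have hcomp : ‖(innerSL ℝ (u x)).comp (fderiv ℝ u x)‖ ≤ ‖u x‖ * ‖fderiv ℝ u x‖ :=
    (ContinuousLinearMap.opNorm_comp_le _ _).trans_eq (by rw [innerSL_apply_norm])
  rw [← Nat.cast_smul_eq_nsmul ℝ, smul_smul, norm_smul, Real.norm_of_nonneg (by positivity)]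
  calc _ ≤ 1 / (2 * √(‖u x‖ ^ 2 + ε ^ 2)) * (2 : ℕ) * (‖u x‖ * ‖fderiv ℝ u x‖) := by gcongr
    _ = ‖u x‖ / √(‖u x‖ ^ 2 + ε ^ 2) * ‖fderiv ℝ u x‖ := by push_cast; field_simp
    _ ≤ 1 * ‖fderiv ℝ u x‖ := by gcongr; exact (div_le_one hpos).2 hle
    _ = _ := one_mul _

theorem tendsto_regMod (u : E5 → ℂ) (x : E5) {ε : ℕ → ℝ} (h : Tendsto ε atTop (𝓝 0)) :
    Tendsto (fun n => regMod (ε n) u x) atTop (𝓝 ‖u x‖) := by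
  have hc : Continuous (fun t : ℝ => √(‖u x‖ ^ 2 + t ^ 2) - t) := by fun_prop
  simpa [regMod, Function.comp_def] using (hc.tendsto 0).comp h

theorem exists_approx {u : E5 → ℂ} (hu : InH1 u) : ∃ (w : ℕ → E5 → ℝ) (D : ℕ → ℝ),
    (∀ n, IsTest (w n)) ∧ (∀ n x, 0 ≤ w n x) ∧ (∀ n x, w n x ≤ ‖u x‖) ∧
    (∀ x, Tendsto (fun n => w n x) atTop (𝓝 ‖u x‖)) ∧
    Tendsto D atTop (𝓝 (∫ x, ‖fderiv ℝ u x‖ ^ 2)) ∧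
    ∀ n, ∫ x, ‖fderiv ℝ (w n) x‖ ^ 2 ≤ D n := by
  obtain ⟨χ, C, hC, hχd, hχc, hχ0, hχ1, hχe, hχC⟩ := exists_cutoff
  set δ : ℕ → ℝ := fun n => 1 / ((n : ℝ) + 1) with hδ
  have hδ0 (n : ℕ) : 0 < δ n := by positivity
  have hδt : Tendsto δ atTop (𝓝 0) := tendsto_one_div_add_atTop_nhds_zero_nat
  set A := ∫ x, ‖fderiv ℝ u x‖ ^ 2 with hA
  set B := ∫ x, ‖u x‖ ^ 2 with hB
  have hIu := hu.1.integrable_norm_pow (by norm_num : (2 : ℕ) ≠ 0)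
  have hId := hu.2.2.integrable_norm_pow (by norm_num : (2 : ℕ) ≠ 0)
  have hder (n : ℕ) (x : E5) : ∃ L : E5 →L[ℝ] ℝ, HasFDerivAt (fun x => χ (δ n • x) * regMod (δ n) u x) L x ∧
      ‖L‖ ≤ ‖fderiv ℝ u x‖ + C * δ n * ‖u x‖ := by
    obtain ⟨L, hL, hLn⟩ := exists_hasFDerivAt_regMod (hδ0 n) hu.2.1 x
    have h1 := (hχd (δ n • x)).hasFDerivAt.comp x ((hasFDerivAt_id x).const_smul (δ n))
    refine ⟨_, h1.mul hL, ?_⟩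
    refine (norm_add_le _ _).trans ?_
    rw [norm_smul, norm_smul]
    have e1 : ‖χ (δ n • x)‖ ≤ 1 := by
      rw [Real.norm_of_nonneg (hχ0 _)]; exact hχ1 _
    have e2 : ‖regMod (δ n) u x‖ ≤ ‖u x‖ := by
      rw [Real.norm_of_nonneg (regMod_nonneg _ _)]; exact regMod_le (hδ0 n).le _ _
    have e3 : ‖(fderiv ℝ χ (δ n • x)).comp (δ n • ContinuousLinearMap.id ℝ E5)‖ ≤ C * δ n := by
      refine (ContinuousLinearMap.opNorm_comp_le _ _).trans ?_
      rw [norm_smul, Real.norm_of_nonneg (hδ0 n).le]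
      refine mul_le_mul (hχC _) ?_ (by have := hδ0 n; positivity) hC
      exact mul_le_of_le_one_right (hδ0 n).le ContinuousLinearMap.norm_id_le
    refine add_le_add ?_ ?_
    · calc _ ≤ 1 * ‖fderiv ℝ u x‖ := mul_le_mul e1 hLn (norm_nonneg _) zero_le_one
        _ = _ := one_mul _
    · calc _ ≤ ‖u x‖ * (C * δ n) := mul_le_mul e2 e3 (norm_nonneg _) (norm_nonneg _)
        _ = _ := mul_comm _ _
  have hbd (n : ℕ) (x : E5) : ‖fderiv ℝ (fun x => χ (δ n • x) * regMod (δ n) u x) x‖ ≤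
      ‖fderiv ℝ u x‖ + C * δ n * ‖u x‖ := by
    obtain ⟨L, hL, hLn⟩ := hder n x
    rwa [hL.fderiv]
  refine ⟨fun n x => χ (δ n • x) * regMod (δ n) u x,
    fun n => (1 + C * δ n) * A + (C * δ n + (C * δ n) ^ 2) * B, fun n => ⟨?_, ?_, ?_⟩,
    fun n x => mul_nonneg (hχ0 _) (regMod_nonneg _ _), fun n x => ?_, fun x => ?_, ?_, fun n => ?_⟩
  · exact fun x => (hder n x).choose_spec.1.differentiableAt
  · refine HasCompactSupport.mul_right ?_
    exact hχc.comp_smul (hδ0 n).ne'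
  · refine (hu.2.2.norm.add (hu.1.norm.const_mul (C * δ n))).mono'
      (measurable_fderiv ℝ _).aestronglyMeasurable (.of_forall fun x => hbd n x)
  · calc _ ≤ 1 * ‖u x‖ := mul_le_mul (hχ1 _) (regMod_le (hδ0 n).le _ _) (regMod_nonneg _ _)
          zero_le_one
      _ = _ := one_mul _
  · have h1 : Tendsto (fun n => δ n • x) atTop (𝓝 0) := by simpa using hδt.smul_const x
    have h2 : ∀ᶠ n in atTop, χ (δ n • x) = 1 := h1.eventually hχe
    refine (tendsto_regMod u x hδt).congr' ?_
    filter_upwards [h2] with n hn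
    rw [hn, one_mul]
  · have hc : Continuous (fun t : ℝ => (1 + C * t) * A + (C * t + (C * t) ^ 2) * B) := by fun_prop
    simpa [Function.comp_def] using (hc.tendsto 0).comp hδt
  · have := hδ0 n
    calc _ ≤ ∫ x, ((1 + C * δ n) * ‖fderiv ℝ u x‖ ^ 2 + (C * δ n + (C * δ n) ^ 2) * ‖u x‖ ^ 2) := by
          refine integral_mono_of_nonneg (.of_forall fun _ => by positivity)
            ((hId.const_mul _).add (hIu.const_mul _)) (.of_forall fun x => ?_)
          refine (pow_le_pow_left₀ (norm_nonneg _) (hbd n x) 2).trans ?_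
          have hCd : 0 ≤ C * δ n := by positivity
          nlinarith [mul_nonneg hCd (sq_nonneg (‖fderiv ℝ u x‖ - ‖u x‖))]
      _ = _ := by
          rw [integral_add (hId.const_mul _) (hIu.const_mul _), integral_const_mul,
            integral_const_mul]

theorem pot_le {ω : ℝ} (hω : 0 < ω) {u v : E5 → ℂ} (hu : InH1 u) (hv : InH1 v) :
    Pot u v ≤ best (dens₁ ω) (dens₂ ω) * (quad ω u v * √(quad ω u v)) := by
  obtain ⟨w, D, hwT, hw0, hwle, hwt, hDt, hD⟩ := exists_approx hu
  obtain ⟨z, G, hzT, hz0, hzle, hzt, hGt, hG⟩ := exists_approx hv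
  set b := best (dens₁ ω) (dens₂ ω)
  have hb : 0 < b := best_pos (isDensity_dens₁ hω) (isDensity_dens₂ hω)
  set Q : ℕ → ℝ := fun n => (D n + 1 / 2 * G n) + ω * Mass u v with hQ
  have hQt : Tendsto Q atTop (𝓝 (quad ω u v)) := (hDt.add (hGt.const_mul _)).add_const _
  have hmass {f : E5 → ℝ} {g : E5 → ℂ} (h0 : ∀ x, 0 ≤ f x) (h : ∀ x, f x ≤ ‖g x‖) (hg : InH1 g) :
      ∫ x, f x ^ 2 ≤ ∫ x, ‖g x‖ ^ 2 :=
    integral_mono_of_nonneg (.of_forall fun _ => by positivity)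
      (hg.1.integrable_norm_pow (by norm_num))
      (.of_forall fun x => pow_le_pow_left₀ (h0 x) (h x) 2)
  have hgag (n : ℕ) : ∫ x, z n x * w n x ^ 2 ≤ b * (Q n * √(Q n)) := by
    refine (hwT n).gagliardo hω (hzT n) ?_
    have m1 := hmass (hw0 n) (hwle n) hu
    have m2 := hmass (hz0 n) (hzle n) hv
    have : ω * ((∫ x, w n x ^ 2) + 2 * ∫ x, z n x ^ 2) ≤ ω * Mass u v := by
      unfold Mass; gcongr
    have h1 := hD n
    have h2 := hG n
    simp only [hQ]
    linarith
  have hwm (n : ℕ) : Measurable (w n) := (hwT n).differentiable.continuous.measurable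
  have hzm (n : ℕ) : Measurable (z n) := (hzT n).differentiable.continuous.measurable
  have hfatou : ∫⁻ x, ENNReal.ofReal (‖v x‖ * ‖u x‖ ^ 2) ≤
      ENNReal.ofReal (b * (quad ω u v * √(quad ω u v))) := by
    calc ∫⁻ x, ENNReal.ofReal (‖v x‖ * ‖u x‖ ^ 2)
        = ∫⁻ x, liminf (fun n => ENNReal.ofReal (z n x * w n x ^ 2)) atTop := by
          congr! 2 with x
          exact (ENNReal.tendsto_ofReal ((hzt x).mul ((hwt x).pow 2))).liminf_eq.symm
      _ ≤ liminf (fun n => ∫⁻ x, ENNReal.ofReal (z n x * w n x ^ 2)) atTop :=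
          lintegral_liminf_le fun n => by
            have := hwm n
            have := hzm n
            fun_prop
      _ ≤ liminf (fun n => ENNReal.ofReal (b * (Q n * √(Q n)))) atTop := by
          refine liminf_le_liminf (.of_forall fun n => ?_)
          have hInt : Integrable (fun x => z n x * w n x ^ 2) := by
            refine Continuous.integrable_of_hasCompactSupport ?_
              (hzT n).hasCompactSupport.mul_right
            exact (hzT n).differentiable.continuous.mul
              ((hwT n).differentiable.continuous.pow 2)
          rw [← ofReal_integral_eq_lintegral_ofReal hInt
            (.of_forall fun x => mul_nonneg (hz0 n x) (sq_nonneg _))]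
          exact ENNReal.ofReal_le_ofReal (hgag n)
      _ = _ := by
          refine (ENNReal.tendsto_ofReal ?_).liminf_eq
          exact (hQt.mul ((Real.continuous_sqrt.tendsto _).comp hQt)).const_mul b
  have hq0 : 0 ≤ quad ω u v := by
    have e1 : 0 ≤ ∫ x, ‖u x‖ ^ 2 := integral_nonneg fun _ => by positivity
    have e2 : 0 ≤ ∫ x, ‖v x‖ ^ 2 := integral_nonneg fun _ => by positivity
    have e3 : 0 ≤ ∫ x, ‖fderiv ℝ u x‖ ^ 2 := integral_nonneg fun _ => by positivity
    have e4 : 0 ≤ ∫ x, ‖fderiv ℝ v x‖ ^ 2 := integral_nonneg fun _ => by positivity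
    unfold quad Kin Mass
    positivity
  have hnorm : ‖Pot u v‖ₑ ≤ ENNReal.ofReal (b * (quad ω u v * √(quad ω u v))) := by
    refine (enorm_integral_le_lintegral_enorm _).trans (le_trans (lintegral_mono fun x => ?_) hfatou)
    rw [← ofReal_norm]
    refine ENNReal.ofReal_le_ofReal ((Complex.abs_re_le_norm _).trans_eq ?_)
    simp
  rw [← ofReal_norm, ENNReal.ofReal_le_ofReal_iff (by positivity)] at hnorm
  exact (le_abs_self _).trans hnorm

theorem le_sfun_of_nehari {ω : ℝ} (hω : 0 < ω) {u v : E5 → ℂ} (hu : InH1 u) (hv : InH1 v)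
    (hne : Nontriv2 u v) (h : Nehari ω u v = 0) :
    1 / (54 * best (dens₁ ω) (dens₂ ω) ^ 2) ≤ Sfun ω u v := by
  have hN := quad_pos hω hu hv hne
  have hle := pot_le hω hu hv
  have hb := best_pos (isDensity_dens₁ hω) (isDensity_dens₂ hω)
  set b := best (dens₁ ω) (dens₂ ω)
  have hP : Pot u v = quad ω u v / 3 := by unfold Nehari at h; unfold quad; linarith
  have hS : Sfun ω u v = quad ω u v / 6 := by
    have : Sfun ω u v = 1 / 2 * quad ω u v - Pot u v := by unfold Sfun quad; ring
    rw [this, hP]; ring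
  set N := quad ω u v
  have h1 : 1 ≤ 3 * b * √N := by
    rw [hP] at hle
    have : N * 1 ≤ N * (3 * b * √N) := by linarith
    exact le_of_mul_le_mul_left this hN
  have h2 : 1 ≤ 9 * b ^ 2 * N := by
    have := pow_le_pow_left₀ zero_le_one h1 2
    rw [mul_pow, mul_pow, Real.sq_sqrt hN.le] at this
    linarith
  rw [hS, div_le_div_iff₀ (by positivity) (by norm_num)]
  linarith

end GroundState

/-- For every `ω > 0` the infimum `d(ω)` is attained: the set `ℳ_ω` is nonempty. -/
theorem exists_minimizer (ω : ℝ) (hω : 0 < ω) :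
    ∃ u v : E5 → ℂ, InH1 u ∧ InH1 v ∧ Nontriv2 u v ∧
      Nehari ω u v = 0 ∧ Sfun ω u v = dmin ω := by
  obtain ⟨u, v, hu, hv, hne, hN, hS⟩ := GroundState.exists_candidate hω
  refine ⟨u, v, hu, hv, hne, hN, Eq.symm (IsLeast.csInf_eq ⟨⟨u, v, hu, hv, hne, hN, rfl⟩, ?_⟩)⟩
  rintro s ⟨u', v', hu', hv', hne', hN', rfl⟩
  exact hS.trans (GroundState.le_sfun_of_nehari hω hu' hv' hne' hN')
end
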